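/- Let G be a triangulated planar graph with maximum vertex degree Δ. Then fix(G) ≥ √((Δ+1)/2). -/

import Mathlib

/-- A straight-line drawing `δ` of a simple graph `G` is *plane* if it is injective,
no vertex image lies on the segment of an edge except as one of its endpoints, and
any two distinct edges intersect only in images of common endpoints. -/
def IsPlaneDrawing {V : Type*} (G : SimpleGraph V) (δ : V → ℝ × ℝ) : Prop :=
  Function.Injective δ ∧
  (∀ u v w : V, G.Adj u v → δ w ∈ segment ℝ (δ u) (δ v) → w = u ∨ w = v) ∧
  (∀ u v a b : V, G.Adj u v → G.Adj a b → ({u, v} : Set V) ≠ ({a, b} : Set V) →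
    ∀ p : ℝ × ℝ, p ∈ segment ℝ (δ u) (δ v) → p ∈ segment ℝ (δ a) (δ b) →
      ∃ w : V, (w = u ∨ w = v) ∧ (w = a ∨ w = b) ∧ p = δ w)

section

/-- Combinatorial oriented triangulation of the sphere. -/
structure Tri (W : Type*) where
  F : W → W → W → Prop
  rot : ∀ {a b c}, F a b c → F b c a
  ne : ∀ {a b c}, F a b c → a ≠ b
  uniq : ∀ {a b c d}, F a b c → F a b d → c = d
  opp : ∀ {a b c}, F a b c → ∃ d, F b a d
  link : ∀ z (U : Set W), (∀ w u, F z w u → (w ∈ U ↔ u ∈ U)) →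
    ∀ w w', w ∈ U → (∃ c, F z w c) → (∃ c, F z w' c) → w' ∈ U
  rank : W → ℕ
  rank_inj : Function.Injective rank
  low_conn : ∀ r w w', (∃ c, F r w c) → (∃ c, F r w' c) → rank w < rank r → rank w' < rank r →
    Relation.ReflTransGen
      (fun u u' => rank u < rank r ∧ rank u' < rank r ∧ (F r u u' ∨ F r u' u)) w w'
  lower : ∀ z, (∀ u, rank z ≤ rank u) ∨ ∃ u c, F z u c ∧ rank u < rank z

namespace Tri
variable {W : Type*} (T : Tri W)

def Adj (a b : W) : Prop := ∃ c, T.F a b c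

theorem adj_symm {a b : W} (h : T.Adj a b) : T.Adj b a := by
  obtain ⟨c, hc⟩ := h
  exact T.opp hc

theorem adj_ne {a b : W} (h : T.Adj a b) : a ≠ b := by
  obtain ⟨c, hc⟩ := h
  exact T.ne hc

theorem prev_uniq {z w w' u : W} (h : T.F z w u) (h' : T.F z w' u) : w = w' :=
  T.uniq (T.rot (T.rot h)) (T.rot (T.rot h'))

theorem adj_of_F {z w u : W} (h : T.F z w u) : T.Adj z u :=
  T.adj_symm ⟨w, T.rot (T.rot h)⟩

theorem link1 [Finite W] (z : W) (U : Set W) (hU : ∀ w u, w ∈ U → T.F z w u → u ∈ U)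
    (w w' : W) (hw : w ∈ U) (h1 : T.Adj z w) (h2 : T.Adj z w') : w' ∈ U := by
  classical
  -- the successor map on `U ∩ N(z)`
  let U' : Set W := {w | w ∈ U ∧ T.Adj z w}
  have hnx : ∀ w : U', ∃ u : U', T.F z w u := by
    rintro ⟨w, hw, c, hc⟩
    exact ⟨⟨c, hU w c hw hc, T.adj_of_F hc⟩, hc⟩
  choose nx hnx using hnx
  have hinj : Function.Injective nx := by
    intro x y hxy
    have h1 := hnx x
    have h2 := hnx y
    rw [hxy] at h1
    exact Subtype.ext (T.prev_uniq h1 h2)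
  have hsurj := Finite.surjective_of_injective hinj
  refine (T.link z U' ?_ w w' ⟨hw, h1⟩ h1 h2).1
  intro x u hxu
  constructor
  · rintro ⟨hx, _⟩
    exact ⟨hU x u hx hxu, T.adj_of_F hxu⟩
  · intro hu
    obtain ⟨y, hy⟩ := hsurj ⟨u, hu⟩
    have := hnx y
    rw [hy] at this
    have e := T.prev_uniq this hxu
    rw [← e]
    exact y.2

section H1
variable [Fintype W] [DecidableEq W]

def cyc : Submodule (ZMod 2) (W → W → ZMod 2) where
  carrier := {C | (∀ i j, C i j = C j i) ∧ (∀ i j, C i j ≠ 0 → T.Adj i j) ∧ ∀ i, ∑ j, C i j = 0}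
  zero_mem' := by simp
  add_mem' := by
    rintro C D ⟨h1, h2, h3⟩ ⟨g1, g2, g3⟩
    refine ⟨fun i j => by simp [h1 i j, g1 i j], fun i j h => ?_, fun i => ?_⟩
    · by_contra hn
      apply h
      have e1 : C i j = 0 := by
        by_contra h'
        exact hn (h2 i j h')
      have e2 : D i j = 0 := by
        by_contra h'
        exact hn (g2 i j h')
      simp [e1, e2]
    · simp [Finset.sum_add_distrib, h3, g3]
  smul_mem' := by
    rintro c C ⟨h1, h2, h3⟩
    refine ⟨fun i j => by simp [h1 i j], fun i j h => h2 i j ?_, fun i => ?_⟩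
    · intro h'
      apply h
      simp [h']
    · simp [← Finset.mul_sum, h3]

def bdry : Submodule (ZMod 2) (W → W → ZMod 2) where
  carrier := {C | ∃ A : W → W → ZMod 2, (∀ a b c, T.F a b c → A a b = A b c) ∧
    ∀ a b, T.Adj a b → A a b + A b a = C a b}
  zero_mem' := ⟨0, by simp, by simp⟩
  add_mem' := by
    rintro C D ⟨A, h1, h2⟩ ⟨B, g1, g2⟩
    refine ⟨A + B, fun a b c h => by simp [h1 a b c h, g1 a b c h], fun a b h => ?_⟩
    simp only [Pi.add_apply, ← h2 a b h, ← g2 a b h]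
    ring
  smul_mem' := by
    rintro c C ⟨A, h1, h2⟩
    refine ⟨c • A, fun x y z h => by simp [h1 x y z h], fun x y h => ?_⟩
    simp only [Pi.smul_apply, ← h2 x y h, smul_eq_mul]
    ring

def supp (k : ℕ) : Submodule (ZMod 2) (W → W → ZMod 2) where
  carrier := {C | ∀ i j, k ≤ T.rank i → C i j = 0}
  zero_mem' := by simp
  add_mem' := by
    intro C D h g i j hk
    simp [h i j hk, g i j hk]
  smul_mem' := by
    intro c C h i j hk
    simp [h i j hk]

def dd (a b : W) : W → W → ZMod 2 := fun i j => if i = a ∧ j = b then 1 else 0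
def ee (a b : W) : W → W → ZMod 2 := fun i j => dd a b i j + dd b a i j

theorem sum_ee (a b i : W) : ∑ j, ee a b i j = (if i = a then 1 else 0) + (if i = b then 1 else 0) := by
  simp only [ee, dd, Finset.sum_add_distrib]
  congr 1
  · by_cases h : i = a <;> simp [h]
  · by_cases h : i = b <;> simp [h]

end H1
end Tri

end

section
namespace Tri
variable {W : Type*} (T : Tri W)
section H1
variable [Fintype W] [DecidableEq W]

theorem ee_symm (a b i j : W) : ee a b i j = ee a b j i := by
  simp only [ee, dd]
  rw [add_comm]
  congr 1 <;> simp only [and_comm]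

theorem z2 (x : ZMod 2) : x + x = 0 := CharTwo.add_self_eq_zero x

theorem ee_ne {a b i j : W} (h : ee a b i j ≠ 0) : (i = a ∧ j = b) ∨ (i = b ∧ j = a) := by
  by_contra hn
  push Not at hn
  apply h
  simp only [ee, dd]
  rw [if_neg, if_neg]
  · simp
  · rintro ⟨h1, h2⟩
    exact hn.2 h1 h2
  · rintro ⟨h1, h2⟩
    exact hn.1 h1 h2

theorem face_cyc {a b c : W} (h : T.F a b c) : ee a b + ee b c + ee c a ∈ T.cyc := by
  refine ⟨fun i j => ?_, fun i j hij => ?_, fun i => ?_⟩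
  · simp only [Pi.add_apply]
    rw [ee_symm a b, ee_symm b c, ee_symm c a]
  · by_contra hn
    apply hij
    have h1 : T.Adj a b := ⟨c, h⟩
    have h2 : T.Adj b c := ⟨a, T.rot h⟩
    have h3 : T.Adj c a := ⟨b, T.rot (T.rot h)⟩
    have key : ∀ x y, T.Adj x y → ee x y i j = 0 := by
      intro x y hxy
      by_contra h'
      rcases ee_ne h' with ⟨rfl, rfl⟩ | ⟨rfl, rfl⟩
      · exact hn hxy
      · exact hn (T.adj_symm hxy)
    simp [key _ _ h1, key _ _ h2, key _ _ h3]
  · simp only [Pi.add_apply, Finset.sum_add_distrib, sum_ee]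
    have := z2 (if i = a then 1 else 0 : ZMod 2)
    have := z2 (if i = b then 1 else 0 : ZMod 2)
    have := z2 (if i = c then 1 else 0 : ZMod 2)
    linear_combination (z2 (if i = a then 1 else 0 : ZMod 2)) + (z2 (if i = b then 1 else 0 : ZMod 2)) + (z2 (if i = c then 1 else 0 : ZMod 2))

theorem face_bdry {a b c : W} (h : T.F a b c) : ee a b + ee b c + ee c a ∈ T.bdry := by
  refine ⟨dd a b + dd b c + dd c a, fun x y z hxyz => ?_, fun x y _ => ?_⟩
  · have h1 : T.F b c a := T.rot h
    have h2 := T.rot h1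
    have k1 : T.F y z x := T.rot hxyz
    have n1 := T.ne h
    have n2 := T.ne h1
    have n3 := T.ne h2
    simp only [dd, Pi.add_apply]
    have e1 : (x = a ∧ y = b) ↔ (y = b ∧ z = c) := by
      constructor
      · rintro ⟨rfl, rfl⟩
        exact ⟨rfl, T.uniq hxyz h⟩
      · rintro ⟨rfl, rfl⟩
        exact ⟨T.uniq k1 h1, rfl⟩
    have e2 : (x = b ∧ y = c) ↔ (y = c ∧ z = a) := by
      constructor
      · rintro ⟨rfl, rfl⟩
        exact ⟨rfl, T.uniq hxyz h1⟩
      · rintro ⟨rfl, rfl⟩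
        exact ⟨T.uniq k1 h2, rfl⟩
    have e3 : (x = c ∧ y = a) ↔ (y = a ∧ z = b) := by
      constructor
      · rintro ⟨rfl, rfl⟩
        exact ⟨rfl, T.uniq hxyz h2⟩
      · rintro ⟨rfl, rfl⟩
        exact ⟨T.uniq k1 h, rfl⟩
    simp only [e1, e2, e3]
    ring
  · simp only [ee, dd, Pi.add_apply]
    have : ∀ p q : W, (y = p ∧ x = q) ↔ (x = q ∧ y = p) := fun p q => and_comm
    simp only [this]
    ring

theorem face_D {k : ℕ} {r a b : W} (hr : T.rank r = k) (h : T.F r a b) (ha : T.rank a < k)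
    (hb : T.rank b < k) : ∃ D ∈ T.cyc ⊓ T.bdry ⊓ T.supp (k+1),
      ∀ u, D r u = (if u = a then 1 else 0) + (if u = b then 1 else 0) := by
  refine ⟨ee r a + ee a b + ee b r, ⟨⟨T.face_cyc h, T.face_bdry h⟩, ?_⟩, ?_⟩
  · intro i j hi
    have h1 : i ≠ r := by rintro rfl; omega
    have h2 : i ≠ a := by rintro rfl; omega
    have h3 : i ≠ b := by rintro rfl; omega
    simp [ee, dd, h1, h2, h3]
  · intro u
    have h2 : r ≠ a := by rintro rfl; omega
    have h3 : r ≠ b := by rintro rfl; omega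
    simp [ee, dd, h2, h3]

theorem low_D {k : ℕ} {r w w' : W} (hr : T.rank r = k) (h : T.Adj r w) (h' : T.Adj r w')
    (ha : T.rank w < k) (hb : T.rank w' < k) : ∃ D ∈ T.cyc ⊓ T.bdry ⊓ T.supp (k+1),
      ∀ u, D r u = (if u = w then 1 else 0) + (if u = w' then 1 else 0) := by
  have hc := T.low_conn r w w' h h' (by omega) (by omega)
  clear h' hb
  induction hc with
  | refl => exact ⟨0, Submodule.zero_mem _, fun u => by simp [z2]⟩
  | @tail b c _ hbc ih =>
    obtain ⟨D, hD, hD'⟩ := ih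
    obtain ⟨h1, h2, h3⟩ := hbc
    have : ∃ E ∈ T.cyc ⊓ T.bdry ⊓ T.supp (k+1),
      ∀ u, E r u = (if u = b then 1 else 0) + (if u = c then 1 else 0) := by
      rcases h3 with h3 | h3
      · exact T.face_D hr h3 (by omega) (by omega)
      · obtain ⟨E, hE, hE'⟩ := T.face_D hr h3 (by omega) (by omega)
        exact ⟨E, hE, fun u => by rw [hE', add_comm]⟩
    obtain ⟨E, hE, hE'⟩ := this
    refine ⟨D + E, Submodule.add_mem _ hD hE, fun u => ?_⟩
    simp only [Pi.add_apply, hD', hE']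
    linear_combination (z2 (if u = b then 1 else 0 : ZMod 2))

theorem h1_aux (k : ℕ) : ∀ C ∈ T.cyc, C ∈ T.supp k → C ∈ T.bdry := by
  induction k with
  | zero =>
    intro C _ h
    have : C = 0 := by
      funext i j
      exact h i j (Nat.zero_le _)
    rw [this]
    exact Submodule.zero_mem _
  | succ k ih =>
    intro C hC hs
    by_cases hr : ∃ r, T.rank r = k
    swap
    · apply ih C hC
      intro i j hi
      apply hs i j
      have : T.rank i ≠ k := fun h => hr ⟨i, h⟩
      omega
    obtain ⟨r, hr⟩ := hr
    have hlow : ∀ w, C r w ≠ 0 → T.Adj r w ∧ T.rank w < k := by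
      intro w hw
      have ha := hC.2.1 r w hw
      refine ⟨ha, ?_⟩
      have h1 : T.rank w < k + 1 := by
        by_contra hn
        apply hw
        rw [hC.1]
        exact hs w r (by omega)
      have h2 : T.rank w ≠ k := by
        intro h
        exact T.adj_ne ha (T.rank_inj (hr.trans h.symm))
      omega
    by_cases h0 : ∃ w0, C r w0 ≠ 0
    swap
    · push Not at h0
      apply ih C hC
      intro i j hi
      by_cases hi' : T.rank i = k
      · rw [T.rank_inj (hi'.trans hr.symm)]
        exact h0 j
      · exact hs i j (by omega)
    obtain ⟨w0, hw0⟩ := h0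
    have : ∀ w, ∃ D ∈ T.cyc ⊓ T.bdry ⊓ T.supp (k+1), C r w ≠ 0 →
      ∀ u, D r u = (if u = w then 1 else 0) + (if u = w0 then 1 else 0) := by
      intro w
      by_cases hw : C r w = 0
      · exact ⟨0, Submodule.zero_mem _, fun h => absurd hw h⟩
      · obtain ⟨D, h1, h2⟩ := T.low_D hr (hlow w hw).1 (hlow w0 hw0).1 (hlow w hw).2 (hlow w0 hw0).2
        exact ⟨D, h1, fun _ => h2⟩
    choose D hD hD' using this
    have hsum : ∑ w, C r w • D w ∈ T.cyc ⊓ T.bdry ⊓ T.supp (k+1) :=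
      Submodule.sum_mem _ fun w _ => Submodule.smul_mem _ _ (hD w)
    have hC' : C + ∑ w, C r w • D w ∈ T.bdry := by
      apply ih _ (Submodule.add_mem _ hC hsum.1.1)
      have hs' := Submodule.add_mem _ hs hsum.2
      intro i j hi
      by_cases hi' : T.rank i = k
      · rw [T.rank_inj (hi'.trans hr.symm)]
        simp only [Pi.add_apply, Finset.sum_apply, Pi.smul_apply, smul_eq_mul]
        have : ∀ w, C r w * D w r j = C r w * ((if j = w then 1 else 0) + (if j = w0 then 1 else 0)) := by
          intro w
          by_cases hw : C r w = 0
          · simp [hw]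
          · rw [hD' w hw]
        simp only [this, mul_add, Finset.sum_add_distrib, ← Finset.sum_mul, hC.2.2 r]
        simp [z2]
      · exact hs' i j (by omega)
    have := Submodule.sub_mem _ hC' hsum.1.2
    simpa using this

theorem h1 (C) (hC : C ∈ T.cyc) : C ∈ T.bdry := by
  apply T.h1_aux (∑ w, T.rank w + 1) C hC
  intro i j hi
  have := Finset.single_le_sum (f := T.rank) (fun _ _ => Nat.zero_le _) (Finset.mem_univ i)
  omega
end H1
end Tri

end

section
set_option linter.unusedSectionVars false
namespace Tri
variable {W : Type*} (T : Tri W)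
section NC
variable [Fintype W] [DecidableEq W]

theorem fan1 {R : Set W} {A C : W → W → ZMod 2} (hA : ∀ a b c, T.F a b c → A a b = A b c)
    (hC : ∀ a b, T.Adj a b → A a b + A b a = C a b) {z p s : W} (hz : z ∉ R)
    (hp : p ∉ R) (hs : s ∉ R)
    (hzs : ∀ w, w ∉ R → ((∃ r ∈ R, T.F z w r) ↔ w = s))
    (hpz : ∀ u, u ∉ R → ((∃ r ∈ R, T.F u z r) ↔ u = p))
    (h0 : ∀ u ∈ R, C z u = 0) : A p z = A z s := by
  obtain ⟨r1, hr1, hf1⟩ := (hzs s hs).2 rfl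
  obtain ⟨r2, hr2, hf2⟩ := (hpz p hp).2 rfl
  have hst : ∀ k k', T.F z k k' → A z k = A z k' + C z k' := by
    intro k k' h
    have e1 := hA _ _ _ h
    have e2 := hA _ _ _ (T.rot h)
    have e3 := hC z k' (T.adj_of_F h)
    rw [← e3]
    linear_combination e1 + e2 - z2 (A z k')
  have key : ∀ k, T.Adj z k → k ∈ {k | (k ∈ R ∨ k = s) → A z k = A z s} := by
    intro k hk
    refine T.link1 z _ ?_ s k (fun _ => rfl) ⟨_, hf1⟩ hk
    intro w u hw hwu hu
    rcases hu with hu | rfl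
    swap
    · rfl
    have hw' : w ∈ R ∨ w = s := by
      by_cases hwR : w ∈ R
      · exact Or.inl hwR
      · exact Or.inr ((hzs w hwR).1 ⟨u, hu, hwu⟩)
    have e1 := hw hw'
    have e2 := hst _ _ hwu
    rw [h0 u hu, add_zero] at e2
    rw [← e2, e1]
  have h2 := T.rot hf2
  have e := key r2 ⟨_, h2⟩ (Or.inl hr2)
  rw [← e, hA _ _ _ h2, hA _ _ _ (T.rot h2)]

theorem fan2 {R : Set W} {A C : W → W → ZMod 2} (hA : ∀ a b c, T.F a b c → A a b = A b c)
    (hC : ∀ a b, T.Adj a b → A a b + A b a = C a b) {z p s : W} (hz : z ∉ R)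
    (hp : p ∉ R) (hs : s ∉ R)
    (hzs : ∀ w, w ∉ R → ((∃ r ∈ R, T.F z w r) ↔ w = s))
    (hpz : ∀ u, u ∉ R → ((∃ r ∈ R, T.F u z r) ↔ u = p))
    (h0 : ∀ u, u ≠ p → u ≠ s → C z u = 0) {k : W} (hk : T.Adj z k) (hkR : k ∉ R) (hks : k ≠ s) :
    A z k = A z s + C z p := by
  have e1 := T.fan1 hA hC hz hp hs hzs hpz (fun u hu => h0 u (by rintro rfl; exact hp hu) (by rintro rfl; exact hs hu))
  obtain ⟨r1, hr1, hf1⟩ := (hzs s hs).2 rfl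
  obtain ⟨r2, hr2, hf2⟩ := (hpz p hp).2 rfl
  have hst : ∀ k k', T.F z k k' → A z k = A z k' + C z k' := by
    intro k k' h
    have e1 := hA _ _ _ h
    have e2 := hA _ _ _ (T.rot h)
    have e3 := hC z k' (T.adj_of_F h)
    rw [← e3]
    linear_combination e1 + e2 - z2 (A z k')
  have hzp : T.Adj z p := T.adj_symm ⟨_, hf2⟩
  have key : k ∈ {k | k ∉ R → k ≠ s → A z k = A z p} := by
    refine T.link1 z _ ?_ p k (fun _ _ => rfl) hzp hk
    intro w u hw hwu hu hus
    by_cases hup : u = p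
    · rw [hup]
    by_cases hwR : w ∈ R
    · exact absurd ((hpz u hu).1 ⟨w, hwR, T.rot (T.rot hwu)⟩) hup
    · have hws : w ≠ s := by
        rintro rfl
        rw [T.uniq hwu hf1] at hu
        exact hu hr1
      have e2 := hst _ _ hwu
      rw [h0 u hup hus, add_zero] at e2
      rw [← e2, hw hwR hws]
  rw [key hkR hks, ← e1, ← hC z p hzp]
  linear_combination (-z2 (A p z))

theorem noncross {R : Set W} {l : ℕ → W} {m : ℕ} (hm : 2 ≤ m)
    (hinj : ∀ s t, s ≤ m → t ≤ m → l s = l t → s = t) (hlR : ∀ t ≤ m, l t ∉ R)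
    (hB : ∀ u w, u ∉ R → w ∉ R → ((∃ r ∈ R, T.F u w r) ↔
      (∃ t < m, u = l t ∧ w = l (t+1)) ∨ (u = l m ∧ w = l 0)))
    {i j z k : ℕ} (hiz : i < z) (hzj : z < j) (hj : j ≤ m) (hk : k ≤ m) (hk' : k < i ∨ j < k)
    (hij : T.Adj (l i) (l j)) (hzk : T.Adj (l z) (l k)) : False := by
  let C : W → W → ZMod 2 := ∑ t ∈ Finset.Ico i j, ee (l t) (l (t+1)) + ee (l j) (l i)
  have hadj : ∀ t < m, T.Adj (l t) (l (t+1)) := by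
    intro t ht
    obtain ⟨r, _, hr⟩ := (hB (l t) (l (t+1)) (hlR _ (by omega)) (hlR _ (by omega))).2 (Or.inl ⟨t, ht, rfl, rfl⟩)
    exact ⟨r, hr⟩
  have hCap : ∀ x y, C x y = ∑ t ∈ Finset.Ico i j, ee (l t) (l (t+1)) x y + ee (l j) (l i) x y := by
    intro x y
    simp [C, Finset.sum_apply]
  have hC : C ∈ T.cyc := by
    refine ⟨fun x y => ?_, fun x y hxy => ?_, fun x => ?_⟩
    · rw [hCap, hCap, ee_symm]
      congr 1
      exact Finset.sum_congr rfl fun t _ => ee_symm _ _ _ _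
    · by_contra hn
      apply hxy
      have key : ∀ a b, T.Adj a b → ee a b x y = 0 := by
        intro a b hab
        by_contra h'
        rcases ee_ne h' with ⟨rfl, rfl⟩ | ⟨rfl, rfl⟩
        · exact hn hab
        · exact hn (T.adj_symm hab)
      rw [hCap, key _ _ (T.adj_symm hij), Finset.sum_eq_zero, add_zero]
      intro t ht
      simp only [Finset.mem_Ico] at ht
      exact key _ _ (hadj t (by omega))
    · simp only [hCap, Finset.sum_add_distrib]
      rw [Finset.sum_comm]
      simp only [sum_ee]
      have : ∀ j', i ≤ j' → ∑ t ∈ Finset.Ico i j', ((if x = l t then 1 else 0 : ZMod 2) + (if x = l (t+1) then 1 else 0 : ZMod 2)) =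
          (if x = l i then 1 else 0 : ZMod 2) + (if x = l j' then 1 else 0 : ZMod 2) := by
        intro j' hj'
        induction j', hj' using Nat.le_induction with
        | base => simp [z2]
        | succ n hn ih =>
          rw [Finset.sum_Ico_succ_top hn, ih]
          linear_combination z2 (if x = l n then 1 else 0 : ZMod 2)
      rw [this j (by omega)]
      linear_combination z2 (if x = l i then 1 else 0 : ZMod 2) + z2 (if x = l j then 1 else 0 : ZMod 2)
  obtain ⟨A, hA, hAC⟩ := T.h1 C hC
  have hCR : ∀ x, x ∉ l '' Set.Icc i j → ∀ y, C x y = 0 ∧ C y x = 0 := by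
    intro x hx y
    have h1 : C x y = 0 := by
      rw [hCap, Finset.sum_eq_zero, zero_add]
      · by_contra h
        rcases ee_ne h with ⟨rfl, _⟩ | ⟨rfl, _⟩
        · exact hx ⟨j, by simp; omega, rfl⟩
        · exact hx ⟨i, by simp; omega, rfl⟩
      · intro t ht
        simp only [Finset.mem_Ico] at ht
        by_contra h
        rcases ee_ne h with ⟨rfl, _⟩ | ⟨rfl, _⟩
        · exact hx ⟨t, by simp; omega, rfl⟩
        · exact hx ⟨t+1, by simp; omega, rfl⟩
    exact ⟨h1, by rw [hC.1]; exact h1⟩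
  let nx : ℕ → ℕ := fun t => if t = m then 0 else t + 1
  let pv : ℕ → ℕ := fun t => if t = 0 then m else t - 1
  have hnx : ∀ t ≤ m, nx t ≤ m := by intro t ht; simp only [nx]; split_ifs <;> omega
  have hpv : ∀ t ≤ m, pv t ≤ m := by intro t ht; simp only [pv]; split_ifs <;> omega
  have hN : ∀ t ≤ m, ∀ w, w ∉ R → ((∃ r ∈ R, T.F (l t) w r) ↔ w = l (nx t)) := by
    intro t ht w hw
    rw [hB _ _ (hlR t ht) hw]
    constructor
    · rintro (⟨t', h1, h2, h3⟩ | ⟨h1, h2⟩)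
      · have := hinj _ _ ht (by omega) h2
        subst this
        simp only [nx]
        rw [if_neg (by omega), h3]
      · have := hinj _ _ ht (le_refl _) h1
        subst this
        simp [nx, h2]
    · rintro rfl
      simp only [nx]
      split_ifs with h
      · right; simp [h]
      · left; exact ⟨t, by omega, rfl, rfl⟩
  have hP : ∀ t ≤ m, ∀ u, u ∉ R → ((∃ r ∈ R, T.F u (l t) r) ↔ u = l (pv t)) := by
    intro t ht w hw
    rw [hB _ _ hw (hlR t ht)]
    constructor
    · rintro (⟨t', h1, h2, h3⟩ | ⟨h1, h2⟩)
      · have := hinj _ _ ht (by omega) h3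
        subst this
        simp only [pv]
        rw [if_neg (by omega), h2]
        simp
      · have := hinj _ _ ht (by omega) h2
        subst this
        simp [pv, h1]
    · rintro rfl
      simp only [pv]
      split_ifs with h
      · right; simp [h]
      · left; exact ⟨t-1, by omega, rfl, by congr 1; omega⟩
  have hβ : ∀ t ≤ m, A (l (pv t)) (l t) = A (l t) (l (nx t)) := by
    intro t ht
    refine T.fan1 hA hAC (hlR t ht) (hlR _ (hpv t ht)) (hlR _ (hnx t ht)) (hN t ht) (hP t ht) ?_
    intro u hu
    refine (hCR u ?_ _).2
    rintro ⟨t', ht', rfl⟩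
    simp only [Set.mem_Icc] at ht'
    exact hlR t' (by omega) hu
  have hβ' : ∀ t ≤ m, A (l t) (l (nx t)) = A (l 0) (l (nx 0)) := by
    intro t
    induction t with
    | zero => intro _; rfl
    | succ t ih =>
      intro ht
      rw [← hβ (t+1) ht, ← ih (by omega)]
      simp only [pv, nx]
      rw [if_neg (by omega), if_neg (by omega)]
      simp
  have hzm : z ≤ m := by omega
  have ez : A (l z) (l k) = A (l z) (l (nx z)) + C (l z) (l (pv z)) := by
    refine T.fan2 hA hAC (hlR z hzm) (hlR _ (hpv z hzm)) (hlR _ (hnx z hzm)) (hN z hzm) (hP z hzm) ?_ hzk (hlR k hk) ?_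
    · intro u h1 h2
      rw [hCap, Finset.sum_eq_zero, zero_add]
      · by_contra h
        rcases ee_ne h with ⟨h, _⟩ | ⟨h, _⟩
        · have := hinj _ _ hzm hj h; omega
        · have := hinj _ _ hzm (by omega) h; omega
      · intro t ht
        simp only [Finset.mem_Ico] at ht
        by_contra h
        rcases ee_ne h with ⟨h, h'⟩ | ⟨h, h'⟩
        · have := hinj _ _ hzm (by omega) h
          subst this
          apply h2
          simp only [nx]
          rw [if_neg (by omega), h']
        · have := hinj _ _ hzm (by omega) h
          subst this
          apply h1
          simp only [pv]
          rw [if_neg (by omega), h']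
          simp
    · intro h
      have := hinj _ _ hk (hnx z hzm) h
      simp only [nx] at this
      split_ifs at this <;> omega
  have hk0 : l k ∉ l '' Set.Icc i j := by
    rintro ⟨t, ht, h⟩
    simp only [Set.mem_Icc] at ht
    have := hinj _ _ (by omega) hk h
    omega
  have ek : A (l k) (l z) = A (l k) (l (nx k)) + C (l k) (l (pv k)) := by
    refine T.fan2 hA hAC (hlR k hk) (hlR _ (hpv k hk)) (hlR _ (hnx k hk)) (hN k hk) (hP k hk) ?_ (T.adj_symm hzk) (hlR z hzm) ?_
    · intro u _ _
      exact (hCR _ hk0 u).1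
    · intro h
      have := hinj _ _ hzm (hnx k hk) h
      simp only [nx] at this
      split_ifs at this <;> omega
  have hc1 : C (l z) (l (pv z)) = 1 := by
    have hpz : pv z = z - 1 := by simp only [pv]; rw [if_neg (by omega)]
    have hpm := hpv z hzm
    rw [hCap, Finset.sum_eq_single (z-1)]
    · have h1 : l j ≠ l z := fun h => by have := hinj _ _ hj hzm h; omega
      have h2 : l i ≠ l z := fun h => by have := hinj _ _ (by omega) hzm h; omega
      have h3 : l (z-1) ≠ l z := fun h => by have := hinj _ _ (by omega) hzm h; omega
      have h4 : z - 1 + 1 = z := by omega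
      simp [ee, dd, h1.symm, h2.symm, h3.symm, hpz, h4]
    · intro t ht hne
      simp only [Finset.mem_Ico] at ht
      by_contra h
      rcases ee_ne h with ⟨h, h'⟩ | ⟨h, h'⟩
      · have := hinj _ _ hzm (by omega) h
        have := hinj _ _ hpm (by omega) h'
        omega
      · have := hinj _ _ hzm (by omega) h
        omega
    · intro h
      simp only [Finset.mem_Ico] at h
      omega
  have h5 := hAC _ _ hzk
  rw [ez, ek, hc1, (hCR _ hk0 _).1, (hCR _ hk0 _).2, hβ' z hzm, hβ' k hk] at h5
  have h6 := z2 (A (l 0) (l (nx 0)))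
  have : (1 : ZMod 2) = 0 := by linear_combination h5 - h6
  exact absurd this (by decide)
end NC
end Tri

end

section
set_option linter.unusedSectionVars false
section ConsSec
variable {W : Type*}

/-- `Cons L u w`: `u`, `w` are consecutive in the list `L`. -/
def Cons : List W → W → W → Prop
  | x :: y :: L, u, w => (x = u ∧ y = w) ∨ Cons (y :: L) u w
  | _, _, _ => False

namespace Cons

@[simp] theorem nil (u w : W) : ¬ Cons [] u w := by simp [Cons]
@[simp] theorem one (x u w : W) : ¬ Cons [x] u w := by simp [Cons]
@[simp] theorem two (x y : W) (L : List W) (u w : W) :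
    Cons (x :: y :: L) u w ↔ (x = u ∧ y = w) ∨ Cons (y :: L) u w := by simp [Cons]

theorem append (A : List W) (x : W) (B : List W) (u w : W) :
    Cons (A ++ x :: B) u w ↔ Cons (A ++ [x]) u w ∨ Cons (x :: B) u w := by
  induction A with
  | nil => simp
  | cons a A ih =>
    cases A with
    | nil => simp
    | cons c A => simp only [List.cons_append, two] at *; rw [ih, or_assoc]

theorem mem {L : List W} {u w : W} (h : Cons L u w) : u ∈ L ∧ w ∈ L := by
  induction L with
  | nil => simp at h
  | cons a A ih =>
    cases A with
    | nil => simp at h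
    | cons c A =>
      rw [two] at h
      rcases h with ⟨rfl, rfl⟩ | h
      · simp
      · have := ih h
        exact ⟨List.mem_cons_of_mem _ this.1, List.mem_cons_of_mem _ this.2⟩

theorem exists_succ {L : List W} {u : W} (h : u ∈ L) (h' : L.getLast? ≠ some u) :
    ∃ w, Cons L u w := by
  induction L with
  | nil => simp at h
  | cons a A ih =>
    cases A with
    | nil => simp at h h'; exact absurd h.symm h'
    | cons c A =>
      rw [List.mem_cons] at h
      rcases h with rfl | h
      · exact ⟨c, by simp⟩
      · obtain ⟨w, hw⟩ := ih h (by simpa using h')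
        exact ⟨w, by rw [two]; exact Or.inr hw⟩

theorem exists_pred {L : List W} {w : W} (h : w ∈ L) (h' : L.head? ≠ some w) :
    ∃ u, Cons L u w := by
  induction L with
  | nil => simp at h
  | cons a A ih =>
    cases A with
    | nil => simp at h h'; exact absurd h.symm h'
    | cons c A =>
      rw [List.mem_cons] at h
      rcases h with rfl | h
      · simp at h'
      · by_cases hc : c = w
        · exact ⟨a, by simp [hc]⟩
        obtain ⟨u, hu⟩ := ih h (by simpa using hc)
        exact ⟨u, by rw [two]; exact Or.inr hu⟩

theorem not_last {L : List W} (hn : L.Nodup) {u w : W} (h : Cons L u w) : L.getLast? ≠ some u := by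
  induction L with
  | nil => simp at h
  | cons a A ih =>
    cases A with
    | nil => simp at h
    | cons c A =>
      rw [two] at h
      rw [List.nodup_cons] at hn
      rcases h with ⟨rfl, rfl⟩ | h
      · intro h
        rw [List.getLast?_cons_cons] at h
        exact hn.1 (List.mem_of_getLast? h)
      · have := ih hn.2 h
        rwa [List.getLast?_cons_cons]

theorem not_head {L : List W} (hn : L.Nodup) {u w : W} (h : Cons L u w) : L.head? ≠ some w := by
  cases L with
  | nil => simp at h
  | cons a A =>
    cases A with
    | nil => simp at h
    | cons c A =>
      rw [two] at h
      rw [List.nodup_cons] at hn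
      rintro h'
      simp at h'
      subst h'
      rcases h with ⟨rfl, rfl⟩ | h
      · simp at hn
      · exact hn.1 h.mem.2

theorem ne {L : List W} (hn : L.Nodup) {u w : W} (h : Cons L u w) : u ≠ w := by
  induction L with
  | nil => simp at h
  | cons a A ih =>
    cases A with
    | nil => simp at h
    | cons c A =>
      rw [two] at h
      rw [List.nodup_cons] at hn
      rcases h with ⟨rfl, rfl⟩ | h
      · rintro rfl; simp at hn
      · exact ih hn.2 h

theorem succ_uniq {L : List W} (hn : L.Nodup) {u w w' : W} (h : Cons L u w) (h' : Cons L u w') :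
    w = w' := by
  induction L with
  | nil => simp at h
  | cons a A ih =>
    cases A with
    | nil => simp at h
    | cons c A =>
      rw [two] at h h'
      rw [List.nodup_cons] at hn
      rcases h with ⟨rfl, rfl⟩ | h
      · rcases h' with ⟨_, h⟩ | h'
        · exact h
        · exact absurd h'.mem.1 hn.1
      · rcases h' with ⟨rfl, _⟩ | h'
        · exact absurd h.mem.1 hn.1
        · exact ih hn.2 h h'

theorem reverse (L : List W) (u w : W) : Cons L.reverse u w ↔ Cons L w u := by
  induction L with
  | nil => simp
  | cons a A ih =>
    cases A with
    | nil => simp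
    | cons c A =>
      rw [two, ← ih]
      simp only [List.reverse_cons, List.append_assoc, List.singleton_append]
      rw [append]
      simp only [two, one, or_false]
      tauto

theorem of_chain {r : W → W → Prop} {L : List W} (hc : L.IsChain r) {u w : W} (h : Cons L u w) :
    r u w := by
  induction L with
  | nil => simp at h
  | cons a A ih =>
    cases A with
    | nil => simp at h
    | cons c A =>
      rw [two] at h
      rw [List.isChain_cons_cons] at hc
      rcases h with ⟨rfl, rfl⟩ | h
      · exact hc.1
      · exact ih hc.2 h

theorem chain_iff {r : W → W → Prop} {L : List W} : L.IsChain r ↔ ∀ u w, Cons L u w → r u w := by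
  refine ⟨fun h u w h' => h'.of_chain h, fun h => ?_⟩
  induction L with
  | nil => simp
  | cons a A ih =>
    cases A with
    | nil => simp
    | cons c A =>
      rw [List.isChain_cons_cons]
      exact ⟨h _ _ (by simp), ih fun u w h' => h u w (by rw [two]; exact Or.inr h')⟩

theorem iff_idx {L : List W} {u w : W} : Cons L u w ↔ ∃ t : ℕ, L[t]? = some u ∧ L[t+1]? = some w := by
  induction L with
  | nil => simp
  | cons a A ih =>
    cases A with
    | nil => simp
    | cons c A =>
      rw [two, ih]
      constructor
      · rintro (⟨rfl, rfl⟩ | ⟨t, h1, h2⟩)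
        · exact ⟨0, by simp⟩
        · exact ⟨t+1, by simpa using h1, by simpa using h2⟩
      · rintro ⟨t, h1, h2⟩
        cases t with
        | zero => left; simp at h1 h2; exact ⟨h1, h2⟩
        | succ t => right; exact ⟨t, by simpa using h1, by simpa using h2⟩

theorem snoc {L : List W} {x y u w : W} (hx : L.getLast? = some x) :
    Cons (L ++ [y]) u w ↔ Cons L u w ∨ (x = u ∧ y = w) := by
  rw [List.getLast?_eq_some_iff] at hx
  obtain ⟨ys, rfl⟩ := hx
  rw [List.append_assoc, List.singleton_append, append]
  simp

end Cons

theorem chain_list (step : W → W → Prop) (hf : ∀ u w w', step u w → step u w' → w = w')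
    (hi : ∀ u u' w, step u w → step u' w → u = u') (p q : W) (hp : ∀ u, ¬ step u p)
    (hq : ∀ w, ¬ step q w) (h : Relation.ReflTransGen step p q) :
    ∃ L : List W, L.head? = some p ∧ L.getLast? = some q ∧ L.Nodup ∧ L.IsChain step ∧
      ∀ u, Relation.ReflTransGen step p u → u ∈ L := by
  have key : ∃ L : List W, L.head? = some p ∧ L.getLast? = some q ∧ L.Nodup ∧ L.IsChain step := by
    clear hq
    induction h with
    | refl => exact ⟨[p], by simp⟩
    | @tail x y _ hxy ih =>
      obtain ⟨L, h1, h2, h3, h4⟩ := ih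
      have hy : y ∉ L := by
        intro hy
        obtain ⟨x', hx'⟩ := Cons.exists_pred hy (by
          rw [h1]; intro h; simp at h; subst h; exact hp _ hxy)
        have := hi _ _ _ hxy (hx'.of_chain h4)
        subst this
        exact hx'.not_last h3 h2
      refine ⟨L ++ [y], ?_, by simp, ?_, ?_⟩
      · rw [List.head?_append, h1]; rfl
      · rw [List.nodup_append]
        refine ⟨h3, by simp, ?_⟩
        rintro a ha b hb rfl
        simp at hb
        subst hb
        exact hy ha
      · rw [Cons.chain_iff]
        intro u w
        rw [Cons.snoc h2]
        rintro (h | ⟨rfl, rfl⟩)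
        · exact h.of_chain h4
        · exact hxy
  obtain ⟨L, h1, h2, h3, h4⟩ := key
  refine ⟨L, h1, h2, h3, h4, fun u hu => ?_⟩
  induction hu with
  | refl => exact List.mem_of_head? h1
  | @tail x y _ hxy ih =>
    obtain ⟨w, hw⟩ := Cons.exists_succ ih (by
      rw [h2]; intro h; simp at h; subst h; exact hq _ hxy)
    rw [hf _ _ _ hxy (hw.of_chain h4)]
    exact hw.mem.2
end ConsSec

end

section
set_option linter.unusedSectionVars false
set_option linter.unusedVariables false

/-- canonical-ordering style construction with times -/
inductive BuiltT {W : Type*} (Ad : W → W → Prop) (τ : W → ℕ) : List W → Set W → Prop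
  | base (a b : W) : a ≠ b → τ a = 0 → τ b = 0 → BuiltT Ad τ [a, b] {a, b}
  | step (A : List W) (p : W) (M : List W) (q : W) (B : List W) (U : Set W) (z : W) :
      BuiltT Ad τ (A ++ p :: (M ++ q :: B)) U → z ∉ U →
      (∀ u ∈ U, Ad z u → u ∈ p :: (M ++ [q])) → (∀ u ∈ U, τ u < τ z) →
      BuiltT Ad τ (A ++ p :: z :: q :: B) (insert z U)

theorem BuiltT.congr {W : Type*} {Ad : W → W → Prop} {τ τ' : W → ℕ} {L : List W} {U : Set W}
    (h : BuiltT Ad τ L U) (h' : ∀ u ∈ U, τ u = τ' u) : BuiltT Ad τ' L U := by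
  induction h with
  | base a b hab ha hb =>
    exact BuiltT.base a b hab (by rw [← h' a (by simp)]; exact ha) (by rw [← h' b (by simp)]; exact hb)
  | step A p M q B U z h hz h1 h2 ih =>
    refine BuiltT.step A p M q B U z (ih fun u hu => h' u (Or.inr hu)) hz h1 ?_
    intro u hu
    rw [← h' u (Or.inr hu), ← h' z (Or.inl rfl)]
    exact h2 u hu

namespace Tri
variable {W : Type*} (T : Tri W)

structure St (R : Set W) (L : List W) (a b : W) : Prop where
  nodup : L.Nodup
  head : L.head? = some a
  last : L.getLast? = some b
  ab : a ≠ b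
  disj : ∀ u ∈ L, u ∉ R
  bd : ∀ u w, u ∉ R → w ∉ R → ((∃ r ∈ R, T.F u w r) ↔ Cons L u w ∨ (u = b ∧ w = a))
  cov : ∀ r ∈ R, ∀ u, T.Adj r u → u ∈ R ∨ u ∈ L

theorem conn [Finite W] (U : Set W) (w : W) (hw : w ∈ U) (hU : ∀ w ∈ U, ∀ u, T.Adj w u → u ∈ U) (x : W) : x ∈ U := by
  have key : ∀ n z z0, T.rank z = n → (∀ u, T.rank z0 ≤ T.rank u) → (z ∈ U ↔ z0 ∈ U) := by
    intro n
    induction n using Nat.strong_induction_on with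
    | _ n ih =>
      intro z z0 hz h0
      rcases T.lower z with h | ⟨u, c, h, hl⟩
      · rw [T.rank_inj (le_antisymm (h z0) (h0 z))]
      · rw [← ih _ (by omega) u z0 rfl h0]
        exact ⟨fun hz => hU z hz u ⟨c, h⟩, fun hu => hU u hu z (T.adj_symm ⟨c, h⟩)⟩
  have : Nonempty W := ⟨w⟩
  obtain ⟨z0, h0⟩ := Finite.exists_min T.rank
  rw [key _ x z0 rfl h0, ← key _ w z0 rfl h0]
  exact hw

theorem peel_fan [Fintype W] [DecidableEq W] {R : Set W} {A B : List W} {p z q a b : W}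
    (h : T.St R (A ++ p :: z :: q :: B) a b)
    (hz : ∀ x ∈ A ++ p :: z :: q :: B, T.Adj z x → x = p ∨ x = q) :
    ∃ M, T.St (insert z R) (A ++ p :: (M ++ q :: B)) a b ∧
      ∀ u, u ∉ insert z R → T.Adj z u → u ∈ p :: (M ++ [q]) := by
  obtain ⟨hn, hh, hl, hab, hd, hb, hc⟩ := h
  have hpR : p ∉ R := hd p (by simp)
  have hzR : z ∉ R := hd z (by simp)
  have hqR : q ∉ R := hd q (by simp)
  have c1 : Cons (A ++ p :: z :: q :: B) p z := by rw [Cons.append]; simp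
  have c2 : Cons (A ++ p :: z :: q :: B) z q := by rw [Cons.append]; simp
  have hza : z ≠ a := by
    rintro rfl; exact c1.not_head hn hh
  have hzb : z ≠ b := by
    rintro rfl; exact c2.not_last hn hl
  obtain ⟨r1, hr1, f1⟩ := (hb p z hpR hzR).2 (Or.inl c1)
  obtain ⟨r2, hr2, f2⟩ := (hb z q hzR hqR).2 (Or.inl c2)
  have hsucc : ∀ w, w ∉ R → ∀ r ∈ R, T.F z w r → w = q := by
    intro w hw r hr hf
    rcases (hb z w hzR hw).1 ⟨r, hr, hf⟩ with h | ⟨h, _⟩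
    · exact Cons.succ_uniq hn h c2
    · exact absurd h hzb
  have hpred : ∀ u, u ∉ R → ∀ r ∈ R, T.F u z r → u = p := by
    intro w hw r hr hf
    rcases (hb w z hw hzR).1 ⟨r, hr, hf⟩ with h | ⟨_, h⟩
    · have h' := (Cons.reverse _ _ _).2 h
      have c1' := (Cons.reverse _ _ _).2 c1
      exact Cons.succ_uniq (List.nodup_reverse.2 hn) h' c1'
    · exact absurd h hza
  have hpq : p ≠ q := by
    have : (A ++ p :: z :: q :: B).Nodup := hn
    rw [List.nodup_append] at this
    simp at this
    tauto
  let step : W → W → Prop := fun u w => T.F z u w ∧ u ∉ R ∧ w ∉ R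
  have hreach : ∀ u, T.Adj z u → u ∉ R → Relation.ReflTransGen step p u := by
    intro u hu huR
    have := T.link1 z {u | u ∈ R ∨ Relation.ReflTransGen step p u} ?_ p u (Or.inr Relation.ReflTransGen.refl)
      (T.adj_symm ⟨_, f1⟩) hu
    · exact this.resolve_left huR
    · intro w u hw hwu
      by_cases huR : u ∈ R
      · exact Or.inl huR
      right
      by_cases hwR : w ∈ R
      · rw [hpred u huR w hwR (T.rot (T.rot hwu))]
      · exact (hw.resolve_left hwR).tail ⟨hwu, hwR, huR⟩
  have hzq : T.Adj z q := ⟨_, f2⟩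
  obtain ⟨L0, g1, g2, g3, g4, g5⟩ := chain_list step (fun u w w' h h' => T.uniq h.1 h'.1)
    (fun u u' w h h' => T.prev_uniq h.1 h'.1) p q
    (fun u hu => by
      have := T.prev_uniq hu.1 (T.rot f1)
      exact hu.2.1 (this ▸ hr1))
    (fun w hw => by
      have := T.uniq hw.1 f2
      exact hw.2.2 (this ▸ hr2))
    (hreach q hzq hqR)
  obtain ⟨M, rfl⟩ : ∃ M, L0 = p :: (M ++ [q]) := by
    cases L0 with
    | nil => simp at g1
    | cons x L1 =>
      simp at g1
      subst g1
      rw [List.getLast?_eq_some_iff] at g2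
      obtain ⟨ys, hys⟩ := g2
      cases ys with
      | nil => simp at hys; exact absurd hys.1 hpq
      | cons y ys =>
        simp at hys
        exact ⟨ys, by rw [hys.2]⟩
  have hM : ∀ x ∈ p :: (M ++ [q]), T.Adj z x ∧ x ∉ R := by
    intro x hx
    by_cases hxq : x = q
    · subst hxq; exact ⟨hzq, hqR⟩
    obtain ⟨w, hw⟩ := Cons.exists_succ hx (by rw [g2]; simpa using fun h => hxq h.symm)
    have := hw.of_chain g4
    exact ⟨⟨w, this.1⟩, this.2.1⟩
  have hMd : ∀ x ∈ M, x ∉ A ++ p :: z :: q :: B := by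
    intro x hx hx'
    have h1 := hM x (by simp [hx])
    rcases hz x hx' h1.1 with rfl | rfl
    · simp at g3; tauto
    · simp only [List.nodup_append, List.nodup_cons, List.mem_cons, List.mem_append, List.not_mem_nil] at g3
      grind
  have hMz : z ∉ M := by
    intro hx
    exact hMd z hx (by simp)
  have hnodup : (A ++ p :: (M ++ q :: B)).Nodup := by
    simp only [List.nodup_append, List.nodup_cons, List.mem_cons, List.mem_append, List.not_mem_nil] at hn g3 hMd ⊢
    grind
  refine ⟨M, ⟨hnodup, ?_, ?_, hab, ?_, ?_, ?_⟩, ?_⟩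
  · rw [← hh]; cases A <;> simp
  · rw [← hl]
    have e1 : A ++ p :: (M ++ q :: B) = (A ++ p :: M) ++ q :: B := by simp
    have e2 : A ++ p :: z :: q :: B = (A ++ [p, z]) ++ q :: B := by simp
    rw [e1, e2, List.getLast?_append_cons, List.getLast?_append_cons]
  · intro u hu
    have hMR : ∀ x ∈ M, x ∉ R := fun x hx => (hM x (by simp [hx])).2
    have hne : u ≠ z := by
      rintro rfl
      simp only [List.nodup_append, List.nodup_cons, List.mem_cons, List.mem_append, List.not_mem_nil] at hn hu
      grind
    simp only [Set.mem_insert_iff, not_or]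
    refine ⟨hne, ?_⟩
    simp only [List.mem_cons, List.mem_append] at hu hd
    grind
  · intro u w hu hw
    simp only [Set.mem_insert_iff, not_or] at hu hw
    have e1 : (∃ r ∈ insert z R, T.F u w r) ↔ T.F z u w ∨ (∃ r ∈ R, T.F u w r) := by
      constructor
      · rintro ⟨r, rfl | hr, hf⟩
        · exact Or.inl (T.rot (T.rot hf))
        · exact Or.inr ⟨r, hr, hf⟩
      · rintro (hf | ⟨r, hr, hf⟩)
        · exact ⟨z, Or.inl rfl, T.rot hf⟩
        · exact ⟨r, Or.inr hr, hf⟩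
    have e2 : T.F z u w ↔ Cons (p :: (M ++ [q])) u w := by
      constructor
      · intro hf
        have hu' := g5 u (hreach u ⟨_, hf⟩ hu.2)
        have huq : u ≠ q := by
          rintro rfl
          have := T.uniq hf f2
          exact hw.2 (this ▸ hr2)
        obtain ⟨w', hw'⟩ := Cons.exists_succ hu' (by rw [g2]; simpa using fun h => huq h.symm)
        rw [T.uniq hf (hw'.of_chain g4).1]
        exact hw'
      · intro hcn
        exact (hcn.of_chain g4).1
    rw [e1, e2, hb u w hu.2 hw.2]
    have e3 : Cons (p :: (M ++ q :: B)) u w ↔ Cons (p :: (M ++ [q])) u w ∨ Cons (q :: B) u w :=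
      Cons.append (p :: M) q B u w
    rw [Cons.append A p (M ++ q :: B), e3, Cons.append A p (z :: q :: B)]
    simp only [Cons.two, List.cons_append]
    have := hu.1
    have := hw.1
    grind
  · intro r hr u hru
    have : u ∈ R ∨ u ∈ A ++ p :: z :: q :: B ∨ u ∈ p :: (M ++ [q]) := by
      rcases hr with rfl | hr
      · by_cases huR : u ∈ R
        · exact Or.inl huR
        · exact Or.inr (Or.inr (g5 u (hreach u hru huR)))
      · have := hc r hr u hru
        tauto
    simp only [List.mem_cons, List.mem_append, Set.mem_insert_iff] at this ⊢
    grind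
  · intro u hu hzu
    simp only [Set.mem_insert_iff, not_or] at hu
    exact g5 u (hreach u hzu hu.2)

end Tri

end

section
set_option linter.unusedSectionVars false
set_option linter.unusedVariables false
namespace Tri
variable {W : Type*} (T : Tri W)

theorem peel_min [Fintype W] [DecidableEq W] {R : Set W} {L : List W} {a b : W}
    (h : T.St R L a b) (hlen : 3 ≤ L.length) : ∃ A p z q B, L = A ++ p :: z :: q :: B ∧
      ∀ x ∈ L, T.Adj z x → x = p ∨ x = q := by
  let m := L.length - 1
  let l : ℕ → W := fun t => L.getD t a
  have hl : ∀ t ≤ m, L[t]? = some (l t) := by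
    intro t ht
    have : t < L.length := by omega
    simp [l, List.getD_eq_getElem?_getD, this]
  have hinj : ∀ s t, s ≤ m → t ≤ m → l s = l t → s = t := by
    intro s t hs ht hst
    have e1 := hl s hs
    have e2 := hl t ht
    rw [hst, ← e2] at e1
    exact (List.getElem?_inj (by omega) h.nodup).1 e1
  have hmem : ∀ t ≤ m, l t ∈ L := fun t ht => List.mem_of_getElem? (hl t ht)
  have hidx : ∀ x ∈ L, ∃ t ≤ m, x = l t := by
    intro x hx
    obtain ⟨t, ht, e⟩ := List.mem_iff_getElem.1 hx
    refine ⟨t, by omega, ?_⟩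
    have := hl t (by omega)
    rw [List.getElem?_eq_getElem ht, e] at this
    exact Option.some.inj this
  have h0 : l 0 = a := by
    have := hl 0 (by omega)
    have h' := h.head
    rw [List.head?_eq_getElem?, this] at h'
    exact Option.some.inj h'
  have hm : l m = b := by
    have := hl m (by omega)
    have h' := h.last
    rw [List.getLast?_eq_getElem?, this] at h'
    exact Option.some.inj h'
  have hB : ∀ u w, u ∉ R → w ∉ R → ((∃ r ∈ R, T.F u w r) ↔
      (∃ t < m, u = l t ∧ w = l (t+1)) ∨ (u = l m ∧ w = l 0)) := by
    intro u w hu hw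
    rw [h.bd u w hu hw, h0, hm, Cons.iff_idx]
    have : (∃ t, L[t]? = some u ∧ L[t + 1]? = some w) ↔ (∃ t < m, u = l t ∧ w = l (t+1)) := by
      constructor
      · rintro ⟨t, h1, h2⟩
        have ht : t + 1 < L.length := (List.getElem?_eq_some_iff.1 h2).1
        refine ⟨t, by omega, ?_, ?_⟩
        · rw [hl t (by omega)] at h1; exact (Option.some.inj h1).symm
        · rw [hl _ (by omega)] at h2; exact (Option.some.inj h2).symm
      · rintro ⟨t, ht, rfl, rfl⟩
        exact ⟨t, hl t (by omega), hl _ (by omega)⟩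
    rw [this]
  have hex : ∃ d, ∃ i j, j = i + d ∧ 2 ≤ d ∧ j ≤ m ∧ T.Adj (l i) (l j) := by
    refine ⟨m, 0, m, by omega, by omega, le_refl _, ?_⟩
    rw [h0, hm]
    have : ∃ r ∈ R, T.F b a r := (h.bd b a (h.disj b (List.mem_of_getLast? h.last))
      (h.disj a (List.mem_of_head? h.head))).2 (Or.inr ⟨rfl, rfl⟩)
    obtain ⟨r, _, hr⟩ := this
    exact T.adj_symm ⟨r, hr⟩
  classical
  obtain ⟨i, j, e, hd, hj, hij⟩ := Nat.find_spec hex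
  have hmin := fun d' (hd' : d' < Nat.find hex) => Nat.find_min hex hd'
  generalize Nat.find hex = d at *
  refine ⟨L.take i, l i, l (i+1), l (i+2), L.drop (i+3), ?_, ?_⟩
  · have hdrop : ∀ t ≤ m, L.drop t = l t :: L.drop (t+1) := by
      intro t ht
      have h1 : t < L.length := by omega
      rw [List.drop_eq_getElem_cons h1]
      congr 1
      have := hl t ht
      rw [List.getElem?_eq_getElem h1] at this
      exact Option.some.inj this
    conv_lhs => rw [← List.take_append_drop i L]
    rw [hdrop i (by omega), hdrop (i+1) (by omega), hdrop (i+2) (by omega)]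
  · intro x hx hzx
    obtain ⟨k, hk, rfl⟩ := hidx x hx
    by_cases hki : k = i
    · left; rw [hki]
    by_cases hki2 : k = i + 2
    · right; rw [hki2]
    exfalso
    by_cases hout : k < i ∨ j < k
    · exact T.noncross (by omega) hinj (fun t ht => h.disj _ (hmem t ht)) hB (z := i+1) (by omega) (by omega) hj hk hout hij hzx
    · have hk1 : k ≠ i + 1 := by
        rintro rfl
        exact T.adj_ne hzx rfl
      refine hmin (k - (i+1)) (by omega) ⟨i+1, k, by omega, by omega, by omega, hzx⟩

theorem peel [Fintype W] [DecidableEq W] (n : ℕ) : ∀ {R : Set W} {L : List W} {a b : W}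
    (h : T.St R L a b), R.Nonempty → (Rᶜ).ncard = n → ∃ τ, BuiltT T.Adj τ L Rᶜ := by
  induction n with
  | zero =>
    intro R L a b h hR hn
    exfalso
    rw [Set.ncard_eq_zero] at hn
    have : a ∈ Rᶜ := h.disj a (List.mem_of_head? h.head)
    rw [hn] at this
    exact this
  | succ n ih =>
    intro R L a b h hR hn
    by_cases hlen : 3 ≤ L.length
    · obtain ⟨A, p, z, q, B, rfl, hz⟩ := T.peel_min h hlen
      obtain ⟨M, hS, hA⟩ := T.peel_fan h hz
      have hzR : z ∉ R := h.disj z (by simp)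
      have hcompl : Rᶜ = insert z (insert z R)ᶜ := by
        ext x
        simp only [Set.mem_compl_iff, Set.mem_insert_iff]
        by_cases hx : x = z
        · simp [hx, hzR]
        · simp [hx]
      have hz' : z ∉ (insert z R)ᶜ := by simp
      obtain ⟨τ, hτ⟩ := ih hS ⟨z, Or.inl rfl⟩ (by
        rw [hcompl, Set.ncard_insert_of_notMem hz'] at hn
        omega)
      refine ⟨Function.update τ z (∑ w, τ w + 1), ?_⟩
      rw [hcompl]
      have hne : ∀ u ∈ (insert z R)ᶜ, u ≠ z := by
        rintro u hu rfl
        exact hz' hu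
      refine BuiltT.step A p M q B _ z (hτ.congr fun u hu => ?_) hz' hA fun u hu => ?_
      · rw [Function.update_of_ne (hne u hu)]
      · rw [Function.update_of_ne (hne u hu), Function.update_self]
        have := Finset.single_le_sum (f := τ) (fun _ _ => Nat.zero_le _) (Finset.mem_univ u)
        omega
    · obtain ⟨hn, hh, hl, hab, hd, hb, hc⟩ := h
      match L, hh, hl, hlen with
      | _ :: _ :: _ :: _, _, _, hlen => simp at hlen
      | [x], hh, hl, _ => simp at hh hl; exact absurd (hh.symm.trans hl) hab
      | [x, y], hh, hl, _ =>
        simp at hh hl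
        subst hh hl
        have haR := hd x (by simp)
        have hbR := hd y (by simp)
        obtain ⟨r1, hr1, f1⟩ := (hb x y haR hbR).2 (by simp)
        obtain ⟨r2, hr2, f2⟩ := (hb y x hbR haR).2 (by simp)
        have hNa : ∀ u, T.Adj x u → u ∈ {u | u ∈ R ∨ u = y} := by
          intro u hu
          refine T.link1 x _ ?_ y u (Or.inr rfl) ⟨_, f1⟩ hu
          intro w u hw hwu
          by_cases huR : u ∈ R
          · exact Or.inl huR
          right
          rcases hw with hw | rfl
          · have := (hb u x huR haR).1 ⟨w, hw, T.rot (T.rot hwu)⟩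
            simp at this
            grind
          · exact absurd hr1 (T.uniq hwu f1 ▸ huR)
        have hNb : ∀ u, T.Adj y u → u ∈ {u | u ∈ R ∨ u = x} := by
          intro u hu
          refine T.link1 y _ ?_ x u (Or.inr rfl) ⟨_, f2⟩ hu
          intro w u hw hwu
          by_cases huR : u ∈ R
          · exact Or.inl huR
          right
          rcases hw with hw | rfl
          · have := (hb u y huR hbR).1 ⟨w, hw, T.rot (T.rot hwu)⟩
            simp at this
            grind
          · exact absurd hr2 (T.uniq hwu f2 ▸ huR)
        have hall : ∀ u, u ∈ {u | u ∈ R ∨ u = x ∨ u = y} := by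
          refine T.conn _ x (Or.inr (Or.inl rfl)) ?_
          rintro w (hw | rfl | rfl) u hwu
          · have := hc w hw u hwu
            simpa using this
          · have := hNa u hwu
            simp only [Set.mem_setOf_eq] at this ⊢
            tauto
          · have := hNb u hwu
            simp only [Set.mem_setOf_eq] at this ⊢
            tauto
        have : Rᶜ = {x, y} := by
          ext u
          have := hall u
          simp only [Set.mem_setOf_eq, Set.mem_compl_iff, Set.mem_insert_iff, Set.mem_singleton_iff] at this ⊢
          grind
        rw [this]
        exact ⟨fun _ => 0, BuiltT.base x y hab rfl rfl⟩

theorem start [Fintype W] [DecidableEq W] (v b : W) (hb : T.Adj v b) :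
    ∃ τ L, BuiltT T.Adj τ L {v}ᶜ ∧ L.getLast? = some b ∧ L.Nodup ∧ ∀ u, u ∈ L ↔ T.Adj v u := by
  obtain ⟨a, hf⟩ := hb
  have hab : a ≠ b := (T.ne (T.rot hf)).symm
  let step : W → W → Prop := fun u w => T.F v u w ∧ u ≠ b
  have hreach : ∀ u, T.Adj v u → Relation.ReflTransGen step a u := by
    intro u hu
    refine T.link1 v {u | Relation.ReflTransGen step a u} ?_ a u Relation.ReflTransGen.refl (T.adj_of_F hf) hu
    intro w u hw hwu
    by_cases hwb : w = b
    · subst hwb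
      rw [T.uniq hwu hf]
      exact Relation.ReflTransGen.refl
    · exact Relation.ReflTransGen.tail hw ⟨hwu, hwb⟩
  obtain ⟨L, g1, g2, g3, g4, g5⟩ := chain_list step (fun u w w' h h' => T.uniq h.1 h'.1)
    (fun u u' w h h' => T.prev_uniq h.1 h'.1) a b
    (fun u hu => hu.2 (T.prev_uniq hu.1 hf)) (fun w hw => hw.2 rfl) (hreach b ⟨_, hf⟩)
  have hmem : ∀ u, u ∈ L ↔ T.Adj v u := by
    intro u
    constructor
    · intro hu
      by_cases hub : u = b
      · subst hub; exact ⟨_, hf⟩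
      obtain ⟨w, hw⟩ := Cons.exists_succ hu (by rw [g2]; simpa using fun h => hub h.symm)
      exact ⟨w, (hw.of_chain g4).1⟩
    · intro hu
      exact g5 u (hreach u hu)
  have hS : T.St {v} L a b := by
    refine ⟨g3, g1, g2, hab, ?_, ?_, ?_⟩
    · intro u hu
      simpa using (T.adj_ne ((hmem u).1 hu)).symm
    · intro u w hu hw
      simp only [Set.mem_singleton_iff, exists_eq_left]
      constructor
      · intro h
        have h' := T.rot (T.rot h)
        by_cases hub : u = b
        · subst hub
          exact Or.inr ⟨rfl, T.uniq h' hf⟩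
        · left
          obtain ⟨w', hw'⟩ := Cons.exists_succ ((hmem u).2 ⟨w, h'⟩) (by rw [g2]; simpa using fun h => hub h.symm)
          rw [T.uniq h' (hw'.of_chain g4).1]
          exact hw'
      · rintro (h | ⟨rfl, rfl⟩)
        · exact T.rot (h.of_chain g4).1
        · exact T.rot hf
    · rintro r rfl u hu
      exact Or.inr ((hmem u).2 hu)
  obtain ⟨τ, hτ⟩ := T.peel _ hS ⟨v, rfl⟩ rfl
  exact ⟨τ, L, hτ, g2, g3, hmem⟩
end Tri

end

section
set_option linter.unusedSectionVars false
set_option linter.unusedVariables false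
variable {W : Type*}

theorem BuiltT.basic {Ad : W → W → Prop} {τ : W → ℕ} {L : List W} {U : Set W}
    (h : BuiltT Ad τ L U) : L.Nodup ∧ (∀ u ∈ L, u ∈ U) ∧ (∀ u w, Cons L u w → τ u ≠ τ w ∨ L.length = 2)
      ∧ (∀ a, L.head? = some a → τ a = 0) ∧ (∀ a, L.getLast? = some a → τ a = 0) := by
  induction h with
  | base a b hab ha hb => refine ⟨by simpa using hab, by simp, by simp, by simpa using ha, by simpa using hb⟩
  | step A p M q B U z h hz h1 h2 ih =>
    obtain ⟨i1, i2, i3, i4, i5⟩ := ih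
    have hzL : z ∉ A ++ p :: (M ++ q :: B) := fun hh => hz (i2 z hh)
    have hn : (A ++ p :: z :: q :: B).Nodup := by
      simp only [List.nodup_append, List.nodup_cons, List.mem_cons, List.mem_append, List.not_mem_nil] at i1 hzL ⊢
      grind
    refine ⟨hn, ?_, ?_, ?_, ?_⟩
    · intro u hu
      simp only [List.mem_cons, List.mem_append] at hu i2
      simp only [Set.mem_insert_iff]
      grind
    · intro u w huw
      left
      have hp := h2 p (i2 p (by simp))
      have hq := h2 q (i2 q (by simp))
      rw [Cons.append, Cons.two, Cons.two] at huw
      have hlen : (∃ u w, Cons (A ++ [p]) u w) ∨ (∃ u w, Cons (q :: B) u w) → (A ++ p :: (M ++ q :: B)).length ≠ 2 := by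
        rintro (⟨u, w, h⟩ | ⟨u, w, h⟩)
        · cases A with
          | nil => simp at h
          | cons _ _ => simp; omega
        · cases B with
          | nil => simp at h
          | cons _ _ => simp; omega
      have key := i3 u w
      rw [Cons.append, ← List.cons_append, Cons.append (p :: M)] at key
      rcases huw with h | ⟨rfl, rfl⟩ | ⟨rfl, rfl⟩ | h
      · exact (key (Or.inl h)).resolve_right (hlen (Or.inl ⟨_, _, h⟩))
      · omega
      · omega
      · exact (key (Or.inr (Or.inr h))).resolve_right (hlen (Or.inr ⟨_, _, h⟩))
    · intro a ha
      apply i4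
      rw [← ha]
      cases A <;> simp
    · intro a ha
      apply i5
      rw [← ha]
      have e1 : A ++ p :: (M ++ q :: B) = (A ++ p :: M) ++ q :: B := by simp
      have e2 : A ++ p :: z :: q :: B = (A ++ [p, z]) ++ q :: B := by simp
      rw [e1, e2, List.getLast?_append_cons, List.getLast?_append_cons]

theorem BuiltT.reverse {Ad : W → W → Prop} {τ : W → ℕ} {L : List W} {U : Set W}
    (h : BuiltT Ad τ L U) : BuiltT Ad τ L.reverse U := by
  induction h with
  | base a b hab ha hb =>
    have := BuiltT.base (Ad := Ad) b a hab.symm hb ha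
    rw [Set.pair_comm] at this
    simpa using this
  | step A p M q B U z h hz h1 h2 ih =>
    have := BuiltT.step (Ad := Ad) (τ := τ) B.reverse q M.reverse p A.reverse U z (by simpa using ih) hz
      (fun u hu hzu => by
        have := h1 u hu hzu
        simp only [List.mem_cons, List.mem_append, List.mem_reverse] at this ⊢
        tauto) h2
    simpa using this

/-- construction steps with the `S` side conditions -/
inductive BuiltS (Ad : W → W → Prop) (S : Set W) : List W → Set W → Prop
  | base (a b : W) : a ≠ b → b ∉ S → BuiltS Ad S [a, b] {a, b}
  | step (A : List W) (p : W) (M : List W) (q : W) (B : List W) (U : Set W) (z : W) :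
      BuiltS Ad S (A ++ p :: (M ++ q :: B)) U → z ∉ U →
      (∀ u ∈ U, Ad z u → u ∈ p :: (M ++ [q])) → q ∉ S → (∀ m ∈ M, m ∉ S) →
      BuiltS Ad S (A ++ p :: z :: q :: B) (insert z U)

theorem BuiltT.toS {Ad : W → W → Prop} {τ : W → ℕ} {L : List W} {U : Set W}
    (h : BuiltT Ad τ L U) (S : Set W) (hlast : ∀ b ∈ S, L.getLast? ≠ some b)
    (hSL : ∀ u ∈ S, u ∈ U → u ∈ L) (hS : ∀ u w, Cons L u w → w ∈ S → τ u < τ w) :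
    BuiltS Ad S L U := by
  induction h with
  | base a b hab ha hb => exact BuiltS.base a b hab (fun h => hlast b h (by simp))
  | step A p M q B U z h hz h1 h2 ih =>
    obtain ⟨i1, i2, -⟩ := h.basic
    have hq : q ∉ S := by
      intro hq
      have := hS z q (by rw [Cons.append]; simp) hq
      have := h2 q (i2 q (by simp))
      omega
    have hM : ∀ m ∈ M, m ∉ S := by
      intro m hm hmS
      have hmU : m ∈ U := i2 m (by simp [hm])
      have := hSL m hmS (Or.inr hmU)
      have hmz : m ≠ z := by rintro rfl; exact hz hmU
      simp only [List.nodup_append, List.nodup_cons, List.mem_cons, List.mem_append, List.not_mem_nil] at i1 this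
      grind
    refine BuiltS.step A p M q B U z (ih ?_ ?_ ?_) hz h1 hq hM
    · intro b hb
      have := hlast b hb
      have e1 : A ++ p :: (M ++ q :: B) = (A ++ p :: M) ++ q :: B := by simp
      have e2 : A ++ p :: z :: q :: B = (A ++ [p, z]) ++ q :: B := by simp
      rw [e2, List.getLast?_append_cons] at this
      rw [e1, List.getLast?_append_cons]
      exact this
    · intro u hu huU
      have := hSL u hu (Or.inr huU)
      have huz : u ≠ z := by rintro rfl; exact hz huU
      simp only [List.mem_cons, List.mem_append] at this ⊢
      tauto
    · intro u w huw hw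
      have e3 : Cons (p :: (M ++ q :: B)) u w ↔ Cons (p :: (M ++ [q])) u w ∨ Cons (q :: B) u w :=
        Cons.append (p :: M) q B u w
      rw [Cons.append, e3] at huw
      have hS' := hS u w
      rw [Cons.append, Cons.two, Cons.two] at hS'
      rcases huw with h | h | h
      · exact hS' (Or.inl h) hw
      · have hmem := h.mem.2
        have hnd : (p :: (M ++ [q])).Nodup := by
          simp only [List.nodup_append, List.nodup_cons, List.mem_cons, List.mem_append, List.not_mem_nil] at i1 ⊢
          grind
        have := h.not_head hnd
        simp only [List.mem_cons, List.mem_append, List.head?_cons, ne_eq, Option.some.injEq, List.not_mem_nil, or_false] at hmem this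
        rcases hmem with h | h | h
        · exact absurd h.symm this
        · exact absurd hw (hM w h)
        · exact absurd hw (h ▸ hq)
      · exact hS' (Or.inr (Or.inr (Or.inr h))) hw

section updown
variable (τ : W → ℕ)
def ups : List W → List W
  | x :: y :: L => if τ x < τ y then y :: ups (y :: L) else ups (y :: L)
  | _ => []
def downs : List W → List W
  | x :: y :: L => if τ x < τ y then downs (y :: L) else x :: downs (y :: L)
  | L => L

theorem updown_len (L : List W) : (ups τ L).length + (downs τ L).length = L.length := by
  induction L with
  | nil => simp [ups, downs]
  | cons x L ih =>
    cases L with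
    | nil => simp [ups, downs]
    | cons y L =>
      simp only [ups, downs]
      split_ifs <;> simp at ih ⊢ <;> omega

theorem ups_sub (x : W) (L : List W) : (ups τ (x :: L)).Sublist L := by
  induction L generalizing x with
  | nil => simp [ups]
  | cons y L ih =>
    simp only [ups]
    split_ifs
    · exact (ih y).cons_cons y
    · exact (ih y).cons y

theorem downs_sub (L : List W) : (downs τ L).Sublist L := by
  induction L with
  | nil => simp [downs]
  | cons x L ih =>
    cases L with
    | nil => simp [downs]
    | cons y L =>
      simp only [downs]
      split_ifs
      · exact ih.cons x
      · exact ih.cons_cons x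

theorem ups_spec (L : List W) (hn : L.Nodup) {u w : W} (h : Cons L u w) (hw : w ∈ ups τ L) : τ u < τ w := by
  induction L with
  | nil => simp at h
  | cons x L ih =>
    cases L with
    | nil => simp at h
    | cons y L =>
      have hn' := List.nodup_cons.1 hn
      have hy : y ∉ ups τ (y :: L) := fun hy => (List.nodup_cons.1 hn'.2).1 ((ups_sub τ y L).subset hy)
      simp only [ups] at hw
      rw [Cons.two] at h
      rcases h with ⟨rfl, rfl⟩ | h
      · split_ifs at hw with h
        · exact h
        · exact absurd hw hy
      · split_ifs at hw with h'
        · rcases List.mem_cons.1 hw with rfl | hw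
          · exact (h.not_head hn'.2 rfl).elim
          · exact ih hn'.2 h hw
        · exact ih hn'.2 h hw

theorem downs_spec (L : List W) (hn : L.Nodup) {u w : W} (h : Cons L u w) (hw : u ∈ downs τ L) : τ w ≤ τ u := by
  induction L with
  | nil => simp at h
  | cons x L ih =>
    cases L with
    | nil => simp at h
    | cons y L =>
      have hn' := List.nodup_cons.1 hn
      have hx : x ∉ downs τ (y :: L) := fun hy => hn'.1 ((downs_sub τ _).subset hy)
      simp only [downs] at hw
      rw [Cons.two] at h
      rcases h with ⟨rfl, rfl⟩ | h
      · split_ifs at hw with h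
        · exact absurd hw hx
        · omega
      · split_ifs at hw with h'
        · exact ih hn'.2 h hw
        · rcases List.mem_cons.1 hw with rfl | hw
          · exact absurd h.mem.1 hn'.1
          · exact ih hn'.2 h hw
end updown

end

section
set_option linter.unusedSectionVars false
set_option linter.unusedVariables false
variable {W : Type*}

inductive BuiltX (Ad : W → W → Prop) (S : Set W) (x : W → ℝ) : List W → Set W → Prop
  | base (a b : W) : a ≠ b → b ∉ S → x a < x b → BuiltX Ad S x [a, b] {a, b}
  | step (A : List W) (p : W) (M : List W) (q : W) (B : List W) (U : Set W) (z : W) :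
      BuiltX Ad S x (A ++ p :: (M ++ q :: B)) U → z ∉ U →
      (∀ u ∈ U, Ad z u → u ∈ p :: (M ++ [q])) → q ∉ S → (∀ m ∈ M, m ∉ S) →
      (∀ m ∈ p :: M, x m < x z) → x z < x q →
      BuiltX Ad S x (A ++ p :: z :: q :: B) (insert z U)

theorem BuiltS.order {Ad : W → W → Prop} {S : Set W} {L : List W} {U : Set W}
    (h : BuiltS Ad S L U) : ∃ O : List W, O.Nodup ∧ (∀ u ∈ O, u ∈ U) ∧ L.Sublist O ∧
      ∀ x : W → ℝ, O.Pairwise (fun u w => x u < x w) → BuiltX Ad S x L U := by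
  induction h with
  | base a b hab hb =>
    refine ⟨[a, b], by simpa using hab, by simp, by simp, fun x hx => ?_⟩
    exact BuiltX.base a b hab hb (by simpa using hx)
  | step A p M q B U z h hz h1 hq hM ih =>
    obtain ⟨O, o1, o2, o3, o4⟩ := ih
    have e1 : A ++ p :: (M ++ q :: B) = (A ++ p :: M) ++ q :: B := by simp
    rw [e1, List.append_sublist_iff] at o3
    obtain ⟨r1, r2, rfl, h3, h4⟩ := o3
    rw [List.cons_sublist_iff] at h4
    obtain ⟨r3, r4, rfl, h5, h6⟩ := h4
    obtain ⟨s, t, rfl⟩ := List.append_of_mem h5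
    have hzO : z ∉ r1 ++ (s ++ q :: t ++ r4) := fun hh => hz (o2 z hh)
    refine ⟨r1 ++ s ++ z :: q :: (t ++ r4), ?_, ?_, ?_, ?_⟩
    · have hp : (r1 ++ s ++ z :: q :: (t ++ r4)).Perm (z :: (r1 ++ (s ++ q :: t ++ r4))) := by
        refine List.perm_middle.trans ?_
        simp
      rw [hp.nodup_iff, List.nodup_cons]
      exact ⟨hzO, o1⟩
    · intro u hu
      simp only [List.mem_append, List.mem_cons] at hu o2
      simp only [Set.mem_insert_iff]
      grind
    · have : A ++ p :: z :: q :: B = (A ++ [p]) ++ z :: q :: B := by simp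
      rw [this]
      refine List.Sublist.append ?_ ?_
      · have h7 : (A ++ [p]).Sublist (A ++ p :: M) := by simp
        exact (h7.trans h3).trans (by simp)
      · refine List.Sublist.cons_cons _ (List.Sublist.cons_cons _ ?_)
        exact h6.trans (by simp)
    · intro x hx
      have hsub : (r1 ++ (s ++ q :: t ++ r4)).Sublist (r1 ++ s ++ z :: q :: (t ++ r4)) := by
        simp
      refine BuiltX.step A p M q B U z (o4 x (hx.sublist hsub)) hz h1 hq hM ?_ ?_
      · intro m hm
        have hm' : m ∈ r1 := h3.subset (by simp only [List.mem_append]; exact Or.inr hm)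
        rw [List.pairwise_append] at hx
        exact hx.2.2 m (by simp [hm']) z (by simp)
      · rw [List.pairwise_append] at hx
        have := hx.2.1
        rw [List.pairwise_cons] at this
        exact this.1 q (by simp)

theorem exists_between_list (l : List W) (f : W → ℝ) (c : ℝ) (h : ∀ s ∈ l, c < f s) :
    ∃ c', c < c' ∧ ∀ s ∈ l, c' < f s := by
  induction l with
  | nil => exact ⟨c + 1, by linarith, by simp⟩
  | cons a l ih =>
    obtain ⟨c', h1, h2⟩ := ih fun s hs => h s (by simp [hs])
    have ha := h a (by simp)
    refine ⟨min c' ((c + f a)/2), ?_, ?_⟩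
    · rw [lt_min_iff]; constructor <;> linarith
    · intro s hs
      rw [List.mem_cons] at hs
      rcases hs with rfl | hs
      · exact lt_of_le_of_lt (min_le_right _ _) (by linarith)
      · exact lt_of_le_of_lt (min_le_left _ _) (h2 s hs)

theorem exists_x [DecidableEq W] (ξ : W → ℝ) (O : List W) (hO : O.Nodup) : ∀ (S : List W), S.Sublist O →
    S.Pairwise (fun u w => ξ u < ξ w) → ∀ c, (∀ s ∈ S, c < ξ s) →
    ∃ x : W → ℝ, O.Pairwise (fun u w => x u < x w) ∧ (∀ s ∈ S, x s = ξ s) ∧ ∀ u ∈ O, c < x u := by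
  induction O with
  | nil =>
    intro S hS _ c _
    rw [List.sublist_nil] at hS
    subst hS
    exact ⟨fun _ => 0, by simp⟩
  | cons o O ih =>
    intro S hS hp c hc
    rw [List.nodup_cons] at hO
    cases hS with
    | cons _ hS =>
      obtain ⟨c', h1, h2⟩ := exists_between_list S ξ c hc
      obtain ⟨x, g1, g2, g3⟩ := ih hO.2 S hS hp c' h2
      refine ⟨Function.update x o c', ?_, ?_, ?_⟩
      · rw [List.pairwise_cons]
        constructor
        · intro u hu
          have : u ≠ o := by rintro rfl; exact hO.1 hu
          rw [Function.update_self, Function.update_of_ne this]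
          exact g3 u hu
        · refine g1.imp_of_mem ?_
          intro a b ha hb hab
          have h1 : a ≠ o := by rintro rfl; exact hO.1 ha
          have h2 : b ≠ o := by rintro rfl; exact hO.1 hb
          rwa [Function.update_of_ne h1, Function.update_of_ne h2]
      · intro s hs
        have : s ≠ o := by rintro rfl; exact hO.1 (hS.subset hs)
        rw [Function.update_of_ne this]
        exact g2 s hs
      · intro u hu
        rw [List.mem_cons] at hu
        rcases hu with rfl | hu
        · rwa [Function.update_self]
        · have : u ≠ o := by rintro rfl; exact hO.1 hu
          rw [Function.update_of_ne this]
          exact h1.trans (g3 u hu)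
    | @cons_cons S' _ _ hS =>
      rw [List.pairwise_cons] at hp
      obtain ⟨x, g1, g2, g3⟩ := ih hO.2 S' hS hp.2 (ξ o) hp.1
      have hco := hc o (by simp)
      refine ⟨Function.update x o (ξ o), ?_, ?_, ?_⟩
      · rw [List.pairwise_cons]
        constructor
        · intro u hu
          have : u ≠ o := by rintro rfl; exact hO.1 hu
          rw [Function.update_self, Function.update_of_ne this]
          exact g3 u hu
        · refine g1.imp_of_mem ?_
          intro a b ha hb hab
          have h1 : a ≠ o := by rintro rfl; exact hO.1 ha
          have h2 : b ≠ o := by rintro rfl; exact hO.1 hb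
          rwa [Function.update_of_ne h1, Function.update_of_ne h2]
      · intro s hs
        rw [List.mem_cons] at hs
        rcases hs with rfl | hs
        · rw [Function.update_self]
        have : s ≠ o := by rintro rfl; exact hO.1 (hS.subset hs)
        rw [Function.update_of_ne this]
        exact g2 s hs
      · intro u hu
        rw [List.mem_cons] at hu
        rcases hu with rfl | hu
        · rwa [Function.update_self]
        · have : u ≠ o := by rintro rfl; exact hO.1 hu
          rw [Function.update_of_ne this]
          exact hco.trans (g3 u hu)

theorem BuiltS.toX [DecidableEq W] {Ad : W → W → Prop} {S : List W} {L : List W} {U : Set W}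
    (h : BuiltS Ad {s | s ∈ S} L U) (hS : S.Sublist L) (ξ : W → ℝ)
    (hp : S.Pairwise (fun u w => ξ u < ξ w)) :
    ∃ x : W → ℝ, BuiltX Ad {s | s ∈ S} x L U ∧ ∀ s ∈ S, x s = ξ s := by
  obtain ⟨O, o1, o2, o3, o4⟩ := h.order
  have : ∃ c, ∀ s ∈ S, c < ξ s := by
    clear h hS hp o4
    induction S with
    | nil => exact ⟨0, by simp⟩
    | cons a S ih =>
      obtain ⟨c, hc⟩ := ih
      refine ⟨min c (ξ a - 1), ?_⟩
      intro s hs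
      rw [List.mem_cons] at hs
      rcases hs with rfl | hs
      · exact lt_of_le_of_lt (min_le_right _ _) (by linarith)
      · exact lt_of_le_of_lt (min_le_left _ _) (hc s hs)
  obtain ⟨c, hc⟩ := this
  obtain ⟨x, g1, g2, g3⟩ := exists_x ξ O o1 S (hS.trans o3) hp c hc
  exact ⟨x, o4 x g1, g2⟩

end

section
set_option linter.unusedSectionVars false
set_option linter.unusedVariables false
variable {W : Type*}

noncomputable def lnv (x y : W → ℝ) (u w : W) (X : ℝ) : ℝ := y u + (y w - y u) / (x w - x u) * (X - x u)

def Bel (x y : W → ℝ) (L : List W) (P : ℝ × ℝ) : Prop :=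
  ∃ u w, Cons L u w ∧ x u ≤ P.1 ∧ P.1 ≤ x w ∧ P.2 ≤ lnv x y u w P.1

structure PInv (Ad : W → W → Prop) (x y : W → ℝ) (L : List W) (U : Set W) : Prop where
  mono : L.Pairwise (fun u w => x u < x w)
  sub : ∀ u ∈ L, u ∈ U
  inj : ∀ u ∈ U, ∀ w ∈ U, x u = x w → y u = y w → u = w
  vert : ∀ u ∈ U, ∀ v ∈ U, ∀ w ∈ U, Ad u v → (x w, y w) ∈ segment ℝ (x u, y u) (x v, y v) → w = u ∨ w = v
  edge : ∀ u ∈ U, ∀ v ∈ U, ∀ a ∈ U, ∀ b ∈ U, Ad u v → Ad a b → ({u, v} : Set W) ≠ {a, b} →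
    ∀ P : ℝ × ℝ, P ∈ segment ℝ (x u, y u) (x v, y v) → P ∈ segment ℝ (x a, y a) (x b, y b) →
      ∃ w, (w = u ∨ w = v) ∧ (w = a ∨ w = b) ∧ P = (x w, y w)
  belV : ∀ u ∈ U, Bel x y L (x u, y u)
  belE : ∀ u ∈ U, ∀ v ∈ U, Ad u v → ∀ P ∈ segment ℝ (x u, y u) (x v, y v), Bel x y L P

noncomputable def slp (x y : W → ℝ) (z u : W) : ℝ := (y z - y u) / (x z - x u)

section lines
variable {x y : W → ℝ}

theorem lnv_slp {z u : W} (h : x u < x z) (X : ℝ) : lnv x y u z X = y z - slp x y z u * (x z - X) := by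
  have : x z - x u ≠ 0 := by linarith
  simp only [lnv, slp]
  field_simp
  ring

theorem slp_mul {z u : W} (h : x u < x z) : slp x y z u * (x z - x u) = y z - y u := by
  have : x z - x u ≠ 0 := by linarith
  simp only [slp]
  field_simp

theorem slp_lt {z u w : W} (hu : x u < x z) (hw : x w < x z) (huw : x u < x w)
    (h : lnv x y u w (x z) < y z) : slp x y z u < slp x y z w := by
  have e1 := slp_mul (y := y) hu
  have e2 := slp_mul (y := y) hw
  have hs : (y w - y u) / (x w - x u) * (x w - x u) = y w - y u := by
    have : x w - x u ≠ 0 := by linarith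
    field_simp
  simp only [lnv] at h
  generalize (y w - y u) / (x w - x u) = s at *
  generalize slp x y z u = a at *
  generalize slp x y z w = b at *
  have h1 : s < a := by
    by_contra hn
    push Not at hn
    nlinarith
  by_contra hn
  push Not at hn
  nlinarith

theorem F1 {z u w : W} {X Y : ℝ} (hu : x u < x z) (huw : x u < x w)
    (h : lnv x y u w (x z) < y z) (hX : x u ≤ X) (hY : Y ≤ lnv x y u w X) :
    Y ≤ y z - slp x y z u * (x z - X) ∧ (x u < X → Y < y z - slp x y z u * (x z - X)) := by
  have e1 := slp_mul (y := y) hu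
  simp only [lnv] at h hY
  generalize (y w - y u) / (x w - x u) = s at *
  generalize slp x y z u = a at *
  have h1 : s < a := by
    by_contra hn
    push Not at hn
    nlinarith
  constructor
  · nlinarith
  · intro hX'
    nlinarith

theorem F2 {z u q : W} {X Y : ℝ} (hu : x u < x z) (hzq : x z < x q)
    (h : lnv x y u q (x z) < y z) (hX : X ≤ x q) (hY : Y ≤ lnv x y u q X) :
    Y ≤ lnv x y z q X ∧ (X < x q → Y < lnv x y z q X) := by
  rw [lnv_slp (by linarith)] at h hY
  rw [lnv_slp hzq]
  have e1 := slp_mul (y := y) hzq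
  generalize slp x y q u = s at *
  generalize slp x y q z = a at *
  have h1 : a < s := by
    by_contra hn
    push Not at hn
    nlinarith
  constructor
  · nlinarith
  · intro hX'
    nlinarith

theorem seg_left {z w : W} (h : x w < x z) {P : ℝ × ℝ} (hP : P ∈ segment ℝ (x z, y z) (x w, y w)) :
    x w ≤ P.1 ∧ P.1 ≤ x z ∧ P.2 = y z - slp x y z w * (x z - P.1) := by
  obtain ⟨a, b, ha, hb, hab, rfl⟩ := hP
  have e := slp_mul (y := y) h
  have ha' : a = 1 - b := by linarith
  subst ha'
  simp
  refine ⟨by nlinarith, by nlinarith, ?_⟩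
  linear_combination b * e

theorem seg_right {z w : W} (h : x z < x w) {P : ℝ × ℝ} (hP : P ∈ segment ℝ (x z, y z) (x w, y w)) :
    x z ≤ P.1 ∧ P.1 ≤ x w ∧ P.2 = lnv x y z w P.1 := by
  rw [lnv_slp h]
  obtain ⟨a, b, ha, hb, hab, rfl⟩ := hP
  have e := slp_mul (y := y) h
  have ha' : a = 1 - b := by linarith
  subst ha'
  simp
  refine ⟨by nlinarith, by nlinarith, ?_⟩
  linear_combination (1 - b) * e

theorem cons_gap {L : List W} (hL : L.Pairwise (fun u w => x u < x w)) {u v w : W} (h : Cons L u v)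
    (hw : w ∈ L) : x w ≤ x u ∨ x v ≤ x w := by
  induction L with
  | nil => simp at h
  | cons a L ih =>
    cases L with
    | nil => simp at h
    | cons b L =>
      rw [List.pairwise_cons] at hL
      rw [Cons.two] at h
      rw [List.mem_cons] at hw
      rcases h with ⟨rfl, rfl⟩ | h
      · rcases hw with rfl | hw
        · exact Or.inl le_rfl
        · right
          rw [List.mem_cons] at hw
          rcases hw with rfl | hw
          · exact le_rfl
          · exact ((List.pairwise_cons.1 hL.2).1 w hw).le
      · rcases hw with rfl | hw
        · exact Or.inl (hL.1 u h.mem.1).le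
        · exact ih hL.2 h hw

theorem pw_tri {r : W → W → Prop} {L : List W} (hL : L.Pairwise r) {u v : W} (hu : u ∈ L) (hv : v ∈ L) :
    u = v ∨ r u v ∨ r v u := by
  induction L with
  | nil => simp at hu
  | cons a L ih =>
    rw [List.pairwise_cons] at hL
    rw [List.mem_cons] at hu hv
    rcases hu with rfl | hu <;> rcases hv with rfl | hv
    · exact Or.inl rfl
    · exact Or.inr (Or.inl (hL.1 v hv))
    · exact Or.inr (Or.inr (hL.1 u hu))
    · exact ih hL.2 hu hv

theorem PInv.cons_lt {L : List W} (hL : L.Pairwise (fun u w => x u < x w)) {u v : W} (h : Cons L u v) : x u < x v :=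
  h.of_chain (r := fun u w => x u < x w) (List.isChain_iff_pairwise.2 hL)
end lines

theorem PInv.step {Ad : W → W → Prop} (hsym : ∀ u v, Ad u v → Ad v u) (hirr : ∀ u, ¬ Ad u u)
    {x y : W → ℝ} {A M B : List W} {p q z : W} {U : Set W}
    (h : PInv Ad x y (A ++ p :: (M ++ q :: B)) U) (hz : z ∉ U)
    (hadj : ∀ u ∈ U, Ad z u → u ∈ p :: (M ++ [q])) (hx : ∀ m ∈ p :: M, x m < x z) (hzq : x z < x q)
    (hln : ∀ u w, Cons (p :: (M ++ [q])) u w → lnv x y u w (x z) < y z) :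
    PInv Ad x y (A ++ p :: z :: q :: B) (insert z U) := by
  obtain ⟨mono, sub, inj, vert, edge, belV, belE⟩ := h
  -- basic order facts
  have hpor : (p :: (M ++ [q])).Pairwise (fun u w => x u < x w) := by
    refine mono.sublist ?_
    refine List.Sublist.trans (l₂ := p :: (M ++ q :: B)) ?_ (List.sublist_append_right _ _)
    simp
  have hpM : (p :: M).Pairwise (fun u w => x u < x w) := hpor.sublist (by simp)
  have hA : ∀ v ∈ A ++ [p], x v ≤ x p := by
    intro v hv
    rw [List.pairwise_append] at mono
    simp only [List.mem_append, List.mem_singleton] at hv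
    rcases hv with hv | rfl
    · exact (mono.2.2 v hv p (by simp)).le
    · exact le_rfl
  have hB : ∀ u ∈ q :: B, x q ≤ x u := by
    intro u hu
    have e1 : A ++ p :: (M ++ q :: B) = (A ++ p :: M) ++ q :: B := by simp
    rw [e1, List.pairwise_append, List.pairwise_cons] at mono
    rw [List.mem_cons] at hu
    rcases hu with rfl | hu
    · exact le_rfl
    · exact (mono.2.1.1 u hu).le
  have hp : ∀ u ∈ p :: M, x p ≤ x u := by
    intro u hu
    rw [List.mem_cons] at hu
    rcases hu with rfl | hu
    · exact le_rfl
    · exact ((List.pairwise_cons.1 hpM).1 u hu).le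
  have hporM : ∀ u ∈ p :: (M ++ [q]), u ∈ p :: M ∨ u = q := by
    intro u hu
    simp only [List.mem_cons, List.mem_append, List.not_mem_nil, or_false] at hu ⊢
    tauto
  have hxp := hx p (by simp)
  have hndp : (p :: (M ++ [q])).Nodup := hpor.imp (fun {a b} h => by rintro rfl; exact lt_irrefl _ h)
  have hconsM : ∀ u w, Cons (p :: (M ++ [q])) u w → u ∈ p :: M := by
    intro u w huw
    rcases hporM u huw.mem.1 with h | rfl
    · exact h
    · exact (huw.not_last hndp (List.getLast?_eq_some_iff.2 ⟨p :: M, by simp⟩)).elim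
  have hslp : (p :: M).Pairwise (fun u w => slp x y z u < slp x y z w) := by
    have htr : (p :: M).IsChain (fun u w => slp x y z u < slp x y z w) := by
      rw [Cons.chain_iff]
      intro u w huw
      have hm := huw.mem
      refine slp_lt (hx u hm.1) (hx w hm.2) (PInv.cons_lt hpM huw) (hln u w ?_)
      rw [← List.cons_append]
      have : ∃ L, (p :: M).getLast? = some L := ⟨_, List.getLast?_eq_some_getLast (by simp)⟩
      obtain ⟨l, hl⟩ := this
      rw [Cons.snoc hl]
      exact Or.inl huw
    exact List.isChain_iff_pairwise.1 htr
  have hboth : (p :: M).Pairwise (fun u w => x u < x w ∧ slp x y z u < slp x y z w) := hpM.and hslp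
  have hsl : ∀ u ∈ p :: M, ∀ v ∈ p :: M, x u < x v → slp x y z u < slp x y z v := by
    intro u hu v hv huv
    rcases pw_tri hboth hu hv with rfl | h | h
    · exact absurd huv (lt_irrefl _)
    · exact h.2
    · linarith [h.1]
  have hslp' : ∀ u ∈ p :: M, slp x y z p ≤ slp x y z u := by
    intro u hu
    rcases pw_tri hboth (by simp : p ∈ p :: M) hu with rfl | h | h
    · exact le_rfl
    · exact h.2.le
    · linarith [h.1, hp u hu]
  have hsplit : ∀ u v, Cons (A ++ p :: (M ++ q :: B)) u v ↔
      Cons (A ++ [p]) u v ∨ Cons (p :: (M ++ [q])) u v ∨ Cons (q :: B) u v := by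
    intro u v
    have e3 : Cons (p :: (M ++ q :: B)) u v ↔ Cons (p :: (M ++ [q])) u v ∨ Cons (q :: B) u v :=
        Cons.append (p :: M) q B u v
    rw [Cons.append, e3]
  -- key: new edges meet the old region only in their old endpoint
  have K : ∀ w ∈ p :: (M ++ [q]), ∀ P ∈ segment ℝ (x z, y z) (x w, y w),
      Bel x y (A ++ p :: (M ++ q :: B)) P → P = (x w, y w) := by
    intro w hw P hP ⟨u, v, huv, hu, hv, hY⟩
    rw [hsplit] at huv
    rcases hporM w hw with hwM | rfl
    · have hwz := hx w hwM
      obtain ⟨s1, s2, s3⟩ := seg_left hwz hP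
      have hend : P.1 = x w → P = (x w, y w) := by
        intro e
        refine Prod.ext e ?_
        have := slp_mul (y := y) hwz
        rw [s3, e]
        simp only
        linarith
      rcases huv with h | h | h
      · have h1 := hA v h.mem.2
        have h2 := hp w hwM
        exact hend (by linarith)
      · have huM := hconsM u v h
        rcases cons_gap hpor h hw with h1 | h1
        · obtain ⟨f1, f2⟩ := F1 (hx u huM) (PInv.cons_lt hpor h) (hln u v h) hu hY
          rcases pw_tri hboth hwM huM with rfl | h2 | h2
          · rcases hu.lt_or_eq with h3 | h3
            · have := f2 h3
              linarith
            · exact hend h3.symm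
          · exfalso
            have h3 : x z - P.1 ≤ 0 := by
              by_contra hn
              push Not at hn
              have := h2.2
              nlinarith
            have h4 : P.1 = x z := by linarith
            have := f2 (by rw [h4]; exact hx u huM)
            rw [s3, h4] at this
            simp at this
          · linarith [h2.1]
        · exact hend (by linarith)
      · have := hB u h.mem.1
        linarith
    · obtain ⟨s1, s2, s3⟩ := seg_right hzq hP
      have hend : P.1 = x w → P = (x w, y w) := by
        intro e
        refine Prod.ext e ?_
        rw [s3, e, lnv_slp hzq]
        simp
      rcases huv with h | h | h
      · have h1 := hA v h.mem.2
        linarith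
      · have huM := hconsM u v h
        rcases hporM v h.mem.2 with hvM | rfl
        · have := hx v hvM
          have := hv
          have hvz : P.1 = x z := by linarith
          linarith
        · obtain ⟨f1, f2⟩ := F2 (hx u huM) hzq (hln u v h) hv hY
          rcases hv.lt_or_eq with h3 | h3
          · have := f2 h3
            linarith
          · exact hend h3
      · have := hB u h.mem.1
        exact hend (by linarith)
  have hzB : ¬ Bel x y (A ++ p :: (M ++ q :: B)) (x z, y z) := by
    intro hb
    have := K p (by simp) (x z, y z) (left_mem_segment ℝ _ _) hb
    have := congrArg Prod.fst this
    simp at this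
    linarith
  have hsplit' : ∀ u v, Cons (A ++ p :: z :: q :: B) u v ↔
      Cons (A ++ [p]) u v ∨ (p = u ∧ z = v) ∨ (z = u ∧ q = v) ∨ Cons (q :: B) u v := by
    intro u v
    rw [Cons.append, Cons.two, Cons.two]
  have hBel : ∀ P, Bel x y (A ++ p :: (M ++ q :: B)) P → Bel x y (A ++ p :: z :: q :: B) P := by
    rintro P ⟨u, v, huv, hu, hv, hY⟩
    rw [hsplit] at huv
    rcases huv with h | h | h
    · exact ⟨u, v, by rw [hsplit']; exact Or.inl h, hu, hv, hY⟩
    · have huM := hconsM u v h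
      have huz := hx u huM
      by_cases hPz : P.1 ≤ x z
      · refine ⟨p, z, by rw [hsplit']; simp, (hp u huM).trans hu, hPz, ?_⟩
        rw [lnv_slp hxp]
        have := (F1 huz (PInv.cons_lt hpor h) (hln u v h) hu hY).1
        have := hslp' u huM
        nlinarith
      · push Not at hPz
        rcases hporM v h.mem.2 with hvM | rfl
        · have := hx v hvM
          linarith
        · exact ⟨z, v, by rw [hsplit']; simp, hPz.le, hv, (F2 huz hzq (hln u v h) hv hY).1⟩
    · exact ⟨u, v, by rw [hsplit']; exact Or.inr (Or.inr (Or.inr h)), hu, hv, hY⟩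
  have hnewE : ∀ w ∈ p :: (M ++ [q]), ∀ P ∈ segment ℝ (x z, y z) (x w, y w),
      Bel x y (A ++ p :: z :: q :: B) P := by
    intro w hw P hP
    rcases hporM w hw with hwM | rfl
    · obtain ⟨s1, s2, s3⟩ := seg_left (hx w hwM) hP
      refine ⟨p, z, by rw [hsplit']; simp, (hp w hwM).trans s1, s2, ?_⟩
      rw [lnv_slp hxp, s3]
      have := hslp' w hwM
      nlinarith
    · obtain ⟨s1, s2, s3⟩ := seg_right hzq hP
      exact ⟨z, w, by rw [hsplit']; simp, s1, s2, s3.le⟩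
  -- two new edges
  have hNN : ∀ w ∈ p :: (M ++ [q]), ∀ w' ∈ p :: (M ++ [q]), w ≠ w' → ∀ P ∈ segment ℝ (x z, y z) (x w, y w),
      P ∈ segment ℝ (x z, y z) (x w', y w') → P = (x z, y z) := by
    have main : ∀ w ∈ p :: (M ++ [q]), ∀ w' ∈ p :: (M ++ [q]), x w < x w' → ∀ P ∈ segment ℝ (x z, y z) (x w, y w),
      P ∈ segment ℝ (x z, y z) (x w', y w') → P = (x z, y z) := by
      intro w hw w' hw' hlt P hP hP'
      rcases hporM w hw with hwM | rfl
      · obtain ⟨s1, s2, s3⟩ := seg_left (hx w hwM) hP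
        have hPz : P.1 = x z → P = (x z, y z) := by
          intro e
          refine Prod.ext e ?_
          rw [s3, e]
          simp
        rcases hporM w' hw' with hwM' | rfl
        · obtain ⟨t1, t2, t3⟩ := seg_left (hx w' hwM') hP'
          have := hsl w hwM w' hwM' hlt
          apply hPz
          have h0 : (slp x y z w' - slp x y z w) * (x z - P.1) = 0 := by linarith
          rcases mul_eq_zero.1 h0 with h | h <;> linarith
        · obtain ⟨t1, t2, t3⟩ := seg_right hzq hP'
          exact hPz (by linarith)
      · rcases hporM w' hw' with hwM' | rfl
        · have := hx w' hwM'
          linarith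
        · linarith
    intro w hw w' hw' hne P hP hP'
    rcases pw_tri hpor hw hw' with h | h | h
    · exact absurd h hne
    · exact main w hw w' hw' h P hP hP'
    · exact main w' hw' w hw h P hP' hP
  have hporU : ∀ w ∈ p :: (M ++ [q]), w ∈ U := by
    intro w hw
    apply sub
    simp only [List.mem_cons, List.mem_append, List.not_mem_nil, or_false] at hw ⊢
    tauto
  -- old versus new edge
  have hON : ∀ u ∈ U, ∀ v ∈ U, Ad u v → ∀ w ∈ p :: (M ++ [q]), ∀ P ∈ segment ℝ (x u, y u) (x v, y v),
      P ∈ segment ℝ (x z, y z) (x w, y w) → (w = u ∨ w = v) ∧ P = (x w, y w) := by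
    intro u hu v hv huv w hw P hP hP'
    have e := K w hw P hP' (belE u hu v hv huv P hP)
    subst e
    exact ⟨vert u hu v hv w (hporU w hw) huv hP, rfl⟩
  have hzU : ∀ u ∈ U, u ≠ z := by rintro u hu rfl; exact hz hu
  refine ⟨?_, ?_, ?_, ?_, ?_, ?_, ?_⟩
  · rw [← List.isChain_iff_pairwise, Cons.chain_iff]
    intro u w huw
    rw [hsplit'] at huw
    have hold := fun h => PInv.cons_lt mono ((hsplit u w).2 h)
    rcases huw with h | ⟨rfl, rfl⟩ | ⟨rfl, rfl⟩ | h
    · exact hold (Or.inl h)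
    · exact hxp
    · exact hzq
    · exact hold (Or.inr (Or.inr h))
  · intro u hu
    simp only [List.mem_cons, List.mem_append] at hu sub
    simp only [Set.mem_insert_iff]
    grind
  · have hne : ∀ w ∈ U, x z = x w → y z = y w → False := by
      intro w hw e1 e2
      apply hzB
      rw [e1, e2]
      exact belV w hw
    rintro u (rfl | hu) w (rfl | hw) e1 e2
    · rfl
    · exact (hne w hw e1 e2).elim
    · exact (hne u hu e1.symm e2.symm).elim
    · exact inj u hu w hw e1 e2
  · have hnew : ∀ v ∈ U, Ad z v → ∀ w ∈ insert z U, (x w, y w) ∈ segment ℝ (x z, y z) (x v, y v) → w = z ∨ w = v := by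
      rintro v hv hzv w (rfl | hw) hseg
      · exact Or.inl rfl
      · have e := K v (hadj v hv hzv) _ hseg (belV w hw)
        simp only [Prod.mk.injEq] at e
        exact Or.inr (inj w hw v hv e.1 e.2)
    rintro u (rfl | hu) v (rfl | hv) w hw huv hseg
    · exact absurd huv (hirr _)
    · exact hnew v hv huv w hw hseg
    · rw [segment_symm] at hseg
      exact (hnew u hu (hsym _ _ huv) w hw hseg).symm
    · rcases hw with rfl | hw
      · exact absurd (belE u hu v hv huv _ hseg) hzB
      · exact vert u hu v hv w hw huv hseg
  · -- edges
    have case_new_new : ∀ v ∈ U, ∀ b ∈ U, Ad z v → Ad z b → v ≠ b → ∀ P ∈ segment ℝ (x z, y z) (x v, y v),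
        P ∈ segment ℝ (x z, y z) (x b, y b) → P = (x z, y z) :=
      fun v hv b hb h1 h2 hne P hP hP' => hNN v (hadj v hv h1) b (hadj b hb h2) hne P hP hP'
    rintro u hu v hv a ha b hb huv hab hne P hP hP'
    have huv' : u ≠ v := by rintro rfl; exact hirr _ huv
    have hab' : a ≠ b := by rintro rfl; exact hirr _ hab
    by_cases hU : u = z ∨ v = z
    · by_cases hAz : a = z ∨ b = z
      · -- both new
        obtain ⟨v', hv', hv'', hzv, hPv⟩ : ∃ v' ∈ U, ({u, v} : Set W) = {z, v'} ∧ Ad z v' ∧ P ∈ segment ℝ (x z, y z) (x v', y v') := by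
          rcases hU with rfl | rfl
          · exact ⟨v, hv.resolve_left huv'.symm, rfl, huv, hP⟩
          · exact ⟨u, hu.resolve_left huv', Set.pair_comm _ _, hsym _ _ huv, by rwa [segment_symm]⟩
        obtain ⟨b', hb', hb'', hzb, hPb⟩ : ∃ v' ∈ U, ({a, b} : Set W) = {z, v'} ∧ Ad z v' ∧ P ∈ segment ℝ (x z, y z) (x v', y v') := by
          rcases hAz with rfl | rfl
          · exact ⟨b, hb.resolve_left hab'.symm, rfl, hab, hP'⟩
          · exact ⟨a, ha.resolve_left hab', Set.pair_comm _ _, hsym _ _ hab, by rwa [segment_symm]⟩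
        refine ⟨z, ?_, ?_, ?_⟩
        · rcases hU with h | h <;> simp [h]
        · rcases hAz with h | h <;> simp [h]
        · refine case_new_new v' hv' b' hb' hzv hzb ?_ P hPv hPb
          rintro rfl
          exact hne (hv''.trans hb''.symm)
      · push Not at hAz
        have ha' := ha.resolve_left hAz.1
        have hb' := hb.resolve_left hAz.2
        rcases hU with rfl | rfl
        · have hv' := hv.resolve_left huv'.symm
          obtain ⟨h1, h2⟩ := hON a ha' b hb' hab v (hadj v hv' huv) P hP' hP
          exact ⟨v, Or.inr rfl, h1, h2⟩
        · have hu' := hu.resolve_left huv'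
          rw [segment_symm] at hP
          obtain ⟨h1, h2⟩ := hON a ha' b hb' hab u (hadj u hu' (hsym _ _ huv)) P hP' hP
          exact ⟨u, Or.inl rfl, h1, h2⟩
    · push Not at hU
      have hu' := hu.resolve_left hU.1
      have hv' := hv.resolve_left hU.2
      by_cases hAz : a = z ∨ b = z
      · rcases hAz with rfl | rfl
        · have hb' := hb.resolve_left hab'.symm
          obtain ⟨h1, h2⟩ := hON u hu' v hv' huv b (hadj b hb' hab) P hP hP'
          exact ⟨b, h1, Or.inr rfl, h2⟩
        · have ha' := ha.resolve_left hab'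
          rw [segment_symm] at hP'
          obtain ⟨h1, h2⟩ := hON u hu' v hv' huv a (hadj a ha' (hsym _ _ hab)) P hP hP'
          exact ⟨a, h1, Or.inl rfl, h2⟩
      · push Not at hAz
        exact edge u hu' v hv' a (ha.resolve_left hAz.1) b (hb.resolve_left hAz.2) huv hab hne P hP hP'
  · rintro u (rfl | hu)
    · exact hnewE p (by simp) _ (left_mem_segment ℝ _ _)
    · exact hBel _ (belV u hu)
  · rintro u (rfl | hu) v (rfl | hv) huv P hP
    · exact absurd huv (hirr _)
    · exact hnewE v (hadj v hv huv) P hP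
    · rw [segment_symm] at hP
      exact hnewE u (hadj u hu (hsym _ _ huv)) P hP
    · exact hBel _ (belE u hu v hv huv P hP)

end

section
set_option linter.unusedSectionVars false
set_option linter.unusedVariables false
variable {W : Type*}

theorem lnv_congr {x y y' : W → ℝ} {u w : W} (h1 : y u = y' u) (h2 : y w = y' w) (X : ℝ) :
    lnv x y u w X = lnv x y' u w X := by
  simp only [lnv, h1, h2]

theorem PInv.congr {Ad : W → W → Prop} {x y y' : W → ℝ} {L : List W} {U : Set W}
    (h : PInv Ad x y L U) (hy : ∀ u ∈ U, y u = y' u) : PInv Ad x y' L U := by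
  obtain ⟨mono, sub, inj, vert, edge, belV, belE⟩ := h
  have hB : ∀ P, Bel x y L P → Bel x y' L P := by
    rintro P ⟨u, w, h1, h2, h3, h4⟩
    refine ⟨u, w, h1, h2, h3, ?_⟩
    rwa [lnv_congr (hy u (sub u h1.mem.1)) (hy w (sub w h1.mem.2))] at h4
  refine ⟨mono, sub, ?_, ?_, ?_, ?_, ?_⟩
  · intro u hu w hw h1 h2
    rw [← hy u hu, ← hy w hw] at h2
    exact inj u hu w hw h1 h2
  · intro u hu v hv w hw ha h1
    rw [← hy u hu, ← hy v hv, ← hy w hw] at h1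
    exact vert u hu v hv w hw ha h1
  · intro u hu v hv a ha b hb h1 h2 h3 P h4 h5
    rw [← hy u hu, ← hy v hv] at h4
    rw [← hy a ha, ← hy b hb] at h5
    obtain ⟨w, w1, w2, w3⟩ := edge u hu v hv a ha b hb h1 h2 h3 P h4 h5
    refine ⟨w, w1, w2, ?_⟩
    have : w ∈ U := by rcases w1 with rfl | rfl <;> assumption
    rw [← hy w this]
    exact w3
  · intro u hu
    rw [← hy u hu]
    exact hB _ (belV u hu)
  · intro u hu v hv h1 P hP
    rw [← hy u hu, ← hy v hv] at hP
    exact hB _ (belE u hu v hv h1 P hP)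

theorem seg_lnv {x y : W → ℝ} {a b : W} (h : x a < x b) {P : ℝ × ℝ}
    (hP : P ∈ segment ℝ (x a, y a) (x b, y b)) :
    x a ≤ P.1 ∧ P.1 ≤ x b ∧ P.2 = lnv x y a b P.1 := by
  obtain ⟨s, t, hs, ht, hst, rfl⟩ := hP
  have e : s = 1 - t := by linarith
  subst e
  have : x b - x a ≠ 0 := by linarith
  simp only [Prod.fst_add, Prod.smul_fst, Prod.snd_add, Prod.smul_snd, smul_eq_mul, lnv]
  refine ⟨by nlinarith, by nlinarith, ?_⟩
  field_simp
  ring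

theorem PInv.base {Ad : W → W → Prop} (hirr : ∀ u, ¬ Ad u u) {x y : W → ℝ} {a b : W}
    (h : x a < x b) : PInv Ad x y [a, b] {a, b} := by
  have hl : ∀ P ∈ segment ℝ (x a, y a) (x b, y b), Bel x y [a, b] P := by
    intro P hP
    obtain ⟨h1, h2, h3⟩ := seg_lnv h hP
    exact ⟨a, b, by simp, h1, h2, h3.le⟩
  refine ⟨by simpa using h, by simp, ?_, ?_, ?_, ?_, ?_⟩
  · rintro u (rfl | rfl) w (rfl | rfl) h1 h2 <;> first | rfl | (exfalso; linarith)
  · rintro u (rfl | rfl) v (rfl | rfl) w (rfl | rfl) h1 h2 <;>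
      first | exact (hirr _ h1).elim | simp
  · rintro u (rfl | rfl) v (rfl | rfl) c (rfl | rfl) d (rfl | rfl) h1 h2 h3 <;>
      first
      | exact (hirr _ h1).elim
      | exact (hirr _ h2).elim
      | exact (h3 rfl).elim
      | exact (h3 (Set.pair_comm _ _)).elim
  · rintro u (rfl | rfl)
    · exact hl _ (left_mem_segment ℝ _ _)
    · exact hl _ (right_mem_segment ℝ _ _)
  · rintro u (rfl | rfl) v (rfl | rfl) h1 P hP
    · exact (hirr _ h1).elim
    · exact hl _ hP
    · rw [segment_symm] at hP
      exact hl _ hP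
    · exact (hirr _ h1).elim

theorem cons_bound (L : List W) (f : W → W → ℝ) (c B : ℝ) (hc : c < B)
    (h : ∀ u w, Cons L u w → f u w < B) : ∃ t, t < B ∧ c < t ∧ ∀ u w, Cons L u w → f u w < t := by
  induction L with
  | nil => exact ⟨(c + B) / 2, by linarith, by linarith, by simp⟩
  | cons a L ih =>
    cases L with
    | nil => exact ⟨(c + B) / 2, by linarith, by linarith, by simp⟩
    | cons b L =>
      obtain ⟨t, h1, h2, h3⟩ := ih (fun u w hh => h u w (by simp [hh]))
      have := h a b (by simp)
      refine ⟨(max t (f a b) + B) / 2, ?_, ?_, ?_⟩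
      · have : max t (f a b) < B := max_lt h1 this
        linarith
      · have := le_max_left t (f a b)
        linarith
      · intro u w huw
        rw [Cons.two] at huw
        rcases huw with ⟨rfl, rfl⟩ | huw
        · have := le_max_right t (f a b)
          linarith
        · have := le_max_left t (f a b)
          have := h3 u w huw
          linarith

theorem lnv_lt {x y : W → ℝ} {u w : W} {X : ℝ} (h : x u < x w) (hy : y w < y u) (hX : x u < X) :
    lnv x y u w X < y u := by
  simp only [lnv]
  have : (y w - y u) / (x w - x u) < 0 := div_neg_of_neg_of_pos (by linarith) (by linarith)
  nlinarith

theorem BuiltX.heights [DecidableEq W] {Ad : W → W → Prop} (hsym : ∀ u v, Ad u v → Ad v u)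
    (hirr : ∀ u, ¬ Ad u u)
    {S : Set W} {x : W → ℝ} {L : List W} {U : Set W} (hb : BuiltX Ad S x L U) (h : W → ℝ) :
    ∀ K : ℝ, ∃ y : W → ℝ, (∀ u ∈ S, u ∈ U → y u = h u) ∧ (∀ u ∈ U, u ∉ S → y u < -K) ∧
      (∀ u w, Cons L u w → w ∉ S → y w < y u) ∧ PInv Ad x y L U := by
  classical
  induction hb with
  | base a b hab hbS hx =>
    intro K
    let ya : ℝ := if a ∈ S then h a else -K - 1
    refine ⟨fun u => if u = a then ya else min ya (-K) - 1, ?_, ?_, ?_, PInv.base hirr hx⟩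
    · rintro u hu (rfl | rfl)
      · simp [ya, hu]
      · exact (hbS hu).elim
    · rintro u (rfl | rfl) hu
      · simp [ya, hu]
      · have := min_le_right ya (-K)
        simp only [hab.symm, if_false]
        linarith
    · intro u w huw hw
      simp only [Cons.two, Cons.one, or_false] at huw
      obtain ⟨rfl, rfl⟩ := huw
      have := min_le_left ya (-K)
      simp only [hab.symm, if_false, if_true]
      linarith
  | step A p M q B U z hB hz hadj hq hM hx hzq ih =>
    intro K
    obtain ⟨w1, R, hw1⟩ : ∃ w1 R, M ++ [q] = w1 :: R := by
      cases M with
      | nil => exact ⟨q, [], rfl⟩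
      | cons m M => exact ⟨m, M ++ [q], rfl⟩
    let T := min (h z) (-K)
    have hT1 : T ≤ h z := min_le_left _ _
    have hT2 : T ≤ -K := min_le_right _ _
    let lam : ℝ := (x z - x p) / (x w1 - x p)
    let K' := max (-T) (((1 - lam) * h p - T) / lam)
    obtain ⟨y, y1, y2, y3, y4⟩ := ih K'
    have hK1 : -T ≤ K' := le_max_left _ _
    have hK2 : ((1 - lam) * h p - T) / lam ≤ K' := le_max_right _ _
    have hmq : ∀ u ∈ M ++ [q], u ∉ S := by
      intro u hu
      simp only [List.mem_append, List.mem_singleton] at hu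
      rcases hu with hu | rfl
      · exact hM u hu
      · exact hq
    have hsl : (p :: (M ++ [q])).Sublist (A ++ p :: (M ++ q :: B)) := by
      refine List.Sublist.trans (l₂ := p :: (M ++ q :: B)) ?_ (List.sublist_append_right _ _)
      simp
    have hpor : (p :: (M ++ [q])).Pairwise (fun u w => x u < x w) := y4.mono.sublist hsl
    have hnd : (p :: (M ++ [q])).Nodup := hpor.imp (fun {a b} h => by rintro rfl; exact lt_irrefl _ h)
    have hU : ∀ u ∈ p :: (M ++ [q]), u ∈ U := fun u hu => y4.sub u (hsl.subset hu)
    have hcons : ∀ u w, Cons (p :: (M ++ [q])) u w → Cons (A ++ p :: (M ++ q :: B)) u w := by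
      intro u w huw
      rw [Cons.append]
      right
      have e : p :: (M ++ q :: B) = (p :: M) ++ q :: B := by simp
      rw [e, Cons.append]
      left
      simpa using huw
    have hcw : ∀ u w, Cons (p :: (M ++ [q])) u w → w ∈ M ++ [q] := by
      intro u w huw
      have h1 := huw.mem.2
      have h2 := huw.not_head hnd
      simp only [List.head?_cons, ne_eq, Option.some.injEq] at h2
      rw [List.mem_cons] at h1
      exact h1.resolve_left (fun e => h2 e.symm)
    have hcu : ∀ u w, Cons (p :: (M ++ [q])) u w → u ∈ p :: M := by
      intro u w huw
      have h1 := huw.mem.1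
      have h2 := huw.not_last hnd
      simp only [List.mem_cons, List.mem_append, List.not_mem_nil, or_false] at h1 ⊢
      rcases h1 with h1 | h1 | h1
      · exact Or.inl h1
      · exact Or.inr h1
      · subst h1
        exact (h2 (List.getLast?_eq_some_iff.2 ⟨p :: M, by simp⟩)).elim
    have hxx : ∀ u w, Cons (p :: (M ++ [q])) u w → x u < x w :=
      fun u w huw => huw.of_chain hpor.isChain
    have hyd : ∀ u w, Cons (p :: (M ++ [q])) u w → y w < y u :=
      fun u w huw => y3 u w (hcons u w huw) (hmq w (hcw u w huw))
    have hdesc : (p :: (M ++ [q])).Pairwise (fun u w => y w < y u) := by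
      have hc : (p :: (M ++ [q])).IsChain (fun u w => y w < y u) := Cons.chain_iff.2 hyd
      haveI : IsTrans W (fun u w => y w < y u) := ⟨fun a b c h1 h2 => lt_trans h2 h1⟩
      exact List.isChain_iff_pairwise.1 hc
    have hyp : ∀ u ∈ M ++ [q], y u < y p := (List.pairwise_cons.1 hdesc).1
    have hxp : x p < x w1 := (List.pairwise_cons.1 hpor).1 w1 (by simp [hw1])
    have hxpz : x p < x z := hx p (by simp)
    have hlam : 0 < lam := div_pos (by linarith) (by linarith)
    have hyS : ∀ u ∈ M ++ [q], y u < T := by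
      intro u hu
      have := y2 u (hU u (List.mem_cons_of_mem _ hu)) (hmq u hu)
      linarith
    have hlny : ∀ u w, Cons (p :: (M ++ [q])) u w → lnv x y u w (x z) < y u :=
      fun u w huw => lnv_lt (hxx u w huw) (hyd u w huw) (hx u (hcu u w huw))
    have hlnp : ∀ u w, Cons (p :: (M ++ [q])) u w → lnv x y u w (x z) < y p := by
      intro u w huw
      have h1 := hlny u w huw
      have h2 := huw.mem.1
      rw [List.mem_cons] at h2
      rcases h2 with rfl | h2
      · exact h1
      · exact h1.trans (hyp u h2)
    have hlnT : ∀ u w, Cons (p :: (M ++ [q])) u w → lnv x y u w (x z) < T := by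
      intro u w huw
      have h1 := hlny u w huw
      have h2 := huw.mem.1
      rw [List.mem_cons] at h2
      rcases h2 with rfl | h2
      · by_cases hpS : u ∈ S
        · have hw : w = w1 := huw.succ_uniq hnd (by rw [hw1]; simp)
          subst hw
          have e1 := y1 u hpS (hU u (by simp))
          have e2 := y2 w (hU w huw.mem.2) (hmq w (hcw u w huw))
          rw [div_le_iff₀ hlam] at hK2
          have e3 : lnv x y u w (x z) = (1 - lam) * h u + lam * y w := by
            have : x w - x u ≠ 0 := by linarith
            simp only [lnv, lam, e1]
            field_simp
            ring
          rw [e3]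
          nlinarith
        · have := y2 u (hU u (by simp)) hpS
          linarith
      · exact h1.trans (hyS u h2)
    have hyq : y q < T := hyS q (by simp)
    have hyqp : y q < y p := hyp q (by simp)
    obtain ⟨t, t1, t2, t3, t4⟩ : ∃ t : ℝ, (z ∈ S → t = h z) ∧ (z ∉ S → t < -K ∧ t < y p) ∧
        y q < t ∧ ∀ u w, Cons (p :: (M ++ [q])) u w → lnv x y u w (x z) < t := by
      by_cases hzS : z ∈ S
      · exact ⟨h z, fun _ => rfl, fun hh => (hh hzS).elim, by linarith,
          fun u w huw => lt_of_lt_of_le (hlnT u w huw) hT1⟩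
      · obtain ⟨t, s1, s2, s3⟩ := cons_bound (p :: (M ++ [q])) (fun u w => lnv x y u w (x z)) (y q)
          (min T (y p)) (lt_min hyq hyqp) (fun u w huw => lt_min (hlnT u w huw) (hlnp u w huw))
        rw [lt_min_iff] at s1
        exact ⟨t, fun hh => (hzS hh).elim, fun _ => ⟨by linarith, s1.2⟩, s2, s3⟩
    have hyy : ∀ u ∈ U, y u = Function.update y z t u := by
      intro u hu
      rw [Function.update_of_ne]
      rintro rfl
      exact hz hu
    have hyz : Function.update y z t z = t := by simp
    refine ⟨Function.update y z t, ?_, ?_, ?_, ?_⟩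
    · rintro u hu (rfl | hu')
      · rw [hyz]; exact t1 hu
      · rw [← hyy u hu']; exact y1 u hu hu'
    · rintro u (rfl | hu') hu
      · rw [hyz]; exact (t2 hu).1
      · rw [← hyy u hu']
        have := y2 u hu' hu
        linarith
    · intro u w huw hw
      have hold : Cons (A ++ p :: (M ++ q :: B)) u w →
          Function.update y z t w < Function.update y z t u := by
        intro hh
        rw [← hyy u (y4.sub u hh.mem.1), ← hyy w (y4.sub w hh.mem.2)]
        exact y3 u w hh hw
      rw [Cons.append, Cons.two, Cons.two] at huw
      rcases huw with huw | ⟨rfl, rfl⟩ | ⟨rfl, rfl⟩ | huw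
      · exact hold (by rw [Cons.append]; exact Or.inl huw)
      · rw [hyz, ← hyy p (hU p (by simp))]
        exact (t2 hw).2
      · rw [hyz, ← hyy q (hU q (by simp))]
        exact t3
      · refine hold ?_
        have e : A ++ p :: (M ++ q :: B) = (A ++ p :: M) ++ q :: B := by simp
        rw [e, Cons.append]
        exact Or.inr huw
    · refine (y4.congr hyy).step hsym hirr hz hadj hx hzq ?_
      intro u w huw
      rw [hyz, ← lnv_congr (hyy u (hU u huw.mem.1)) (hyy w (hU w huw.mem.2))]
      exact t4 u w huw

end

section
set_option linter.unusedSectionVars false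
set_option linter.unusedVariables false
variable {W : Type*}

theorem BuiltX.sub {Ad : W → W → Prop} {S : Set W} {x : W → ℝ} {L : List W} {U : Set W}
    (hb : BuiltX Ad S x L U) : ∀ u ∈ L, u ∈ U := by
  induction hb with
  | base a b => simp
  | step A p M q B U z hB hz hadj hq hM hx hzq ih =>
    intro u hu
    simp only [List.mem_append, List.mem_cons] at hu ih
    rw [Set.mem_insert_iff]
    grind

theorem BuiltX.congr {Ad : W → W → Prop} {S : Set W} {x x' : W → ℝ} {L : List W} {U : Set W}
    (hb : BuiltX Ad S x L U) (h : ∀ u ∈ U, x u = x' u) : BuiltX Ad S x' L U := by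
  induction hb with
  | base a b hab hbS hx =>
    exact .base a b hab hbS (by rwa [← h a (by simp), ← h b (by simp)])
  | step A p M q B U z hB hz hadj hq hM hx hzq ih =>
    have hs := hB.sub
    refine .step A p M q B U z (ih (fun u hu => h u (by simp [hu]))) hz hadj hq hM ?_ ?_
    · intro m hm
      have : m ∈ U := hs m (by simp only [List.mem_append, List.mem_cons] at hm ⊢; tauto)
      rw [← h m (by simp [this]), ← h z (by simp)]
      exact hx m hm
    · have : q ∈ U := hs q (by simp)
      rwa [← h q (by simp [this]), ← h z (by simp)]

theorem cons_ub (L : List W) (f : W → W → ℝ) : ∃ t, ∀ u w, Cons L u w → f u w < t := by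
  induction L with
  | nil => exact ⟨0, by simp⟩
  | cons a L ih =>
    cases L with
    | nil => exact ⟨0, by simp⟩
    | cons b L =>
      obtain ⟨t, ht⟩ := ih
      refine ⟨max t (f a b + 1), ?_⟩
      intro u w huw
      rw [Cons.two] at huw
      rcases huw with ⟨rfl, rfl⟩ | huw
      · exact lt_of_lt_of_le (lt_add_one _) (le_max_right _ _)
      · exact lt_of_lt_of_le (ht u w huw) (le_max_left _ _)

theorem BuiltX.ends {Ad : W → W → Prop} {S : Set W} {x : W → ℝ} {L : List W} {U : Set W}
    (hb : BuiltX Ad S x L U) : ∃ p M q, L = p :: (M ++ [q]) := by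
  cases hb with
  | base a b => exact ⟨a, [], b, rfl⟩
  | step A p M q B U z =>
    rcases A with _ | ⟨a, A⟩
    · rcases List.eq_nil_or_concat (z :: q :: B) with e | ⟨l, b, e⟩
      · simp at e
      · exact ⟨p, l, b, by simpa using e⟩
    · rcases List.eq_nil_or_concat (A ++ p :: z :: q :: B) with e | ⟨l, b, e⟩
      · simp at e
      · exact ⟨a, l, b, by simpa using e⟩

theorem BuiltX.draw [DecidableEq W] {Ad : W → W → Prop} (hsym : ∀ u v, Ad u v → Ad v u)
    (hirr : ∀ u, ¬ Ad u u) {S : Set W} {x : W → ℝ} {L : List W} {v : W}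
    (hb : BuiltX Ad S x L {v}ᶜ) (h : W → ℝ) (hv : ∀ u, Ad v u → u ∈ L) (hvS : v ∉ S) :
    ∃ x' y' L', PInv Ad x' y' L' Set.univ ∧ ∀ s ∈ S, x' s = x s ∧ y' s = h s := by
  obtain ⟨y0, -, -, -, hP0⟩ := hb.heights hsym hirr h 0
  obtain ⟨p, M, q, rfl⟩ : ∃ p M q, L = p :: (M ++ [q]) := hb.ends
  have hm := hP0.mono
  have hlt : ∀ s ∈ p :: M, - x q < - x s := by
    have : p :: (M ++ [q]) = (p :: M) ++ [q] := by simp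
    rw [this, List.pairwise_append] at hm
    intro s hs
    have := hm.2.2 s hs q (by simp)
    linarith
  obtain ⟨t, t1, t2⟩ := exists_between_list (p :: M) (fun s => - x s) (- x q) hlt
  have hxx : ∀ u ∈ ({v}ᶜ : Set W), x u = Function.update x v (-t) u := by
    intro u hu
    rw [Function.update_of_ne]
    simpa using hu
  have hsub := hb.sub
  obtain ⟨y, y1, y2, y3, y4⟩ := (hb.congr hxx).heights hsym hirr h 0
  obtain ⟨Y, hY⟩ := cons_ub (p :: (M ++ [q])) (fun u w => lnv (Function.update x v (-t)) y u w (-t))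
  have hyy : ∀ u ∈ ({v}ᶜ : Set W), y u = Function.update y v Y u := by
    intro u hu
    rw [Function.update_of_ne]
    simpa using hu
  have hP := (y4.congr hyy)
  refine ⟨Function.update x v (-t), Function.update y v Y, [] ++ p :: v :: q :: [], ?_, ?_⟩
  · have e : (Set.univ : Set W) = insert v {v}ᶜ := by ext u; simp [em]
    rw [e]
    refine PInv.step (M := M) hsym hirr (by simpa using hP) (by simp) (fun u _ hu => hv u hu) ?_ ?_ ?_
    · intro m hm
      rw [← hxx m (hsub m (by simp only [List.mem_append, List.mem_cons] at hm ⊢; tauto))]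
      have := t2 m hm
      simp only [Function.update_self]
      linarith
    · rw [← hxx q (hsub q (by simp))]
      simp only [Function.update_self]
      linarith
    · intro u w huw
      rw [← lnv_congr (hyy u (hsub u huw.mem.1)) (hyy w (hsub w huw.mem.2))]
      simp only [Function.update_self]
      exact hY u w huw
  · intro s hs
    have : s ∈ ({v}ᶜ : Set W) := by rintro rfl; exact hvS hs
    rw [← hxx s this, ← hyy s this]
    exact ⟨rfl, y1 s hs this⟩

end

section
set_option linter.unusedSectionVars false
set_option linter.unusedVariables false

theorem core {a b u1 u2 w1 w2 : ℝ} (ha : 0 ≤ a) (hb : 0 < b) (hab : a + b ≤ 1)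
    (hm1 : 0 < b * u1 - a * u2) (hm2 : 0 < a * w2 - b * w1)
    (hN : (u1 * w2 - u2 * w1) *
      (u1 * w2 - u2 * w1 - (b * u1 - a * u2) - (a * w2 - b * w1)) < 0)
    (hu : ¬ (0 ≤ u1 ∧ 0 ≤ u2 ∧ u1 + u2 ≤ 1)) :
    (u2 < 0 ∧ 0 < w2 ∧ 0 < u1 * w2 - u2 * w1 ∧ u1 * w2 - u2 * w1 < w2 - u2) ∨
    (1 < u1 + u2 ∧ w1 + w2 < 1 ∧ u1 * w2 - u2 * w1 + (w1 - u1) < 0 ∧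
      w2 - u2 ≤ u1 * w2 - u2 * w1) := by
  have eb : b * (u1 * w2 - u2 * w1) = w2 * (b * u1 - a * u2) + u2 * (a * w2 - b * w1) := by ring
  have ea : a * (u1 * w2 - u2 * w1) = w1 * (b * u1 - a * u2) + u1 * (a * w2 - b * w1) := by ring
  have eq1 : w2 * (1 - u1 - u2) - u2 * (1 - w1 - w2) = w2 - u2 - (u1 * w2 - u2 * w1) := by ring
  have ep : (1 - a - b) * (u1 * w2 - u2 * w1) + a * (u1 * w2 - u2 * w1 - (w2 - u2)) +
     b * (u1 * w2 - u2 * w1 + (w1 - u1)) =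
      (u1 * w2 - u2 * w1 - (b * u1 - a * u2) - (a * w2 - b * w1)) := by ring
  generalize hNN : u1 * w2 - u2 * w1 = N at *
  generalize h1 : b * u1 - a * u2 = m1 at *
  generalize h2 : a * w2 - b * w1 = m2 at *
  have hN0 : 0 < N := by
    by_contra hn
    push Not at hn
    nlinarith [mul_nonneg_of_nonpos_of_nonpos hn (show N - m1 - m2 ≤ 0 by linarith)]
  have hN1 : N - m1 - m2 < 0 := by
    by_contra hn
    push Not at hn
    nlinarith [mul_nonneg hN0.le hn]
  have hg : 0 < m2 * (1 - u1 - u2) + m1 * (1 - w1 - w2) := by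
    have : m2 * (1 - u1 - u2) + m1 * (1 - w1 - w2) = m1 + m2 - (a + b) * N := by
      linear_combination ea + eb
    rw [this]
    nlinarith
  have hbN : 0 < b * N := mul_pos hb hN0
  -- if v(q) ≥ 0 then v(t) < 0
  have hvt : w2 - u2 ≤ N → N + (w1 - u1) < 0 := by
    intro hq
    by_contra hn
    push Not at hn
    have t1 : 0 ≤ (1 - a - b) * N := mul_nonneg (by linarith) hN0.le
    have t2 : 0 ≤ a * (N - (w2 - u2)) := mul_nonneg ha (by linarith)
    have t3 : 0 ≤ b * (N + (w1 - u1)) := mul_nonneg hb.le hn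
    linarith
  have hgw : 1 < u1 + u2 → w1 + w2 < 1 := by
    intro hgu
    by_contra hn
    push Not at hn
    nlinarith
  rcases lt_or_ge u2 0 with hu2 | hu2
  · have hw2 : 0 < w2 := by
      by_contra hn
      push Not at hn
      nlinarith [mul_nonneg (neg_nonneg.2 hn) hm1.le, mul_pos (neg_pos.2 hu2) hm2]
    rcases lt_or_ge N (w2 - u2) with hq | hq
    · exact Or.inl ⟨hu2, hw2, hN0, hq⟩
    · right
      have hgu : 1 < u1 + u2 := by
        by_contra hn
        push Not at hn
        have gu : 0 ≤ 1 - u1 - u2 := by linarith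
        have h3 : w2 * (1 - u1 - u2) - u2 * (1 - w1 - w2) ≤ 0 := by linarith
        have h4 : 1 - w1 - w2 ≤ 0 := by
          by_contra h5
          push Not at h5
          nlinarith [mul_nonneg hw2.le gu, mul_pos (neg_pos.2 hu2) h5]
        have h6 : (- u2) * m2 < w2 * m1 := by linarith
        have h7 : w2 * m1 * (-(1 - w1 - w2)) < w2 * (m2 * (1 - u1 - u2)) := by
          have := mul_pos hw2 hg
          linarith [mul_add w2 (m2 * (1 - u1 - u2)) (m1 * (1 - w1 - w2)), mul_assoc w2 m1 (1 - w1 - w2)]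
        have h8 : m2 * (w2 * (1 - u1 - u2)) ≤ m2 * (u2 * (1 - w1 - w2)) :=
          mul_le_mul_of_nonneg_left (by linarith) hm2.le
        have h9 : (- u2) * m2 * (-(1 - w1 - w2)) ≤ w2 * m1 * (-(1 - w1 - w2)) :=
          mul_le_mul_of_nonneg_right h6.le (by linarith)
        nlinarith
      exact ⟨hgu, hgw hgu, hvt hq, hq⟩
  · right
    have hu1 : 0 < u1 := by
      by_contra hn
      push Not at hn
      nlinarith [mul_nonneg ha hu2, mul_nonneg hb.le (neg_nonneg.2 hn)]
    have hgu : 1 < u1 + u2 := by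
      by_contra hn
      push Not at hn
      exact hu ⟨hu1.le, hu2, hn⟩
    have hgw' := hgw hgu
    have hq : w2 - u2 ≤ N := by
      by_contra hn
      push Not at hn
      have hw2 : 0 < w2 := by linarith
      nlinarith [mul_pos hw2 (show 0 < u1 + u2 - 1 by linarith),
        mul_nonneg hu2 (show 0 ≤ 1 - w1 - w2 by linarith)]
    exact ⟨hgu, hgw', hvt hq, hq⟩

section
variable {V : Type*}

def od (X Y : V → ℝ) (a b c : V) : ℝ := (X b - X a) * (Y c - Y a) - (Y b - Y a) * (X c - X a)

def OnS (X Y : V → ℝ) (z p w : V) : Prop :=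
  ∃ t : ℝ, 0 < t ∧ t < 1 ∧ X w = X z + t * (X p - X z) ∧ Y w = Y z + t * (Y p - Y z)

def Crs (X Y : V → ℝ) (a b c d : V) : Prop :=
  od X Y a b c * od X Y a b d < 0 ∧ od X Y c d a * od X Y c d b < 0

structure PG (H : SimpleGraph V) (X Y : V → ℝ) : Prop where
  inj : ∀ u w, X u = X w → Y u = Y w → u = w
  vert : ∀ u v w, H.Adj u v → ¬ OnS X Y u v w
  cross : ∀ a b c d, H.Adj a b → H.Adj c d → ¬ Crs X Y a b c d
  max : ∀ z p, z ≠ p → (∀ w, ¬ OnS X Y z p w) → (∀ a b, H.Adj a b → ¬ Crs X Y z p a b) → H.Adj z p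

variable {H : SimpleGraph V} {X Y : V → ℝ}

section affine
variable (a b c d e f : ℝ)

theorem od_aff (u v w : V) : od (fun v => a * X v + b * Y v + c) (fun v => d * X v + e * Y v + f) u v w =
    (a * e - b * d) * od X Y u v w := by
  simp only [od]; ring

theorem Crs_aff (hD : a * e - b * d ≠ 0) (u v w z : V) :
    Crs (fun v => a * X v + b * Y v + c) (fun v => d * X v + e * Y v + f) u v w z ↔ Crs X Y u v w z := by
  have h2 : 0 < (a * e - b * d) * (a * e - b * d) := mul_self_pos.2 hD
  simp only [Crs, od_aff]
  have e1 : ∀ s t : ℝ, (a * e - b * d) * s * ((a * e - b * d) * t) < 0 ↔ s * t < 0 := by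
    intro s t
    rw [show (a * e - b * d) * s * ((a * e - b * d) * t) = (a * e - b * d) * (a * e - b * d) * (s * t) by ring]
    constructor
    · intro h
      by_contra hn
      push Not at hn
      nlinarith [mul_nonneg h2.le hn]
    · intro h
      exact mul_neg_of_pos_of_neg h2 h
  rw [e1, e1]

theorem aff_inj (hD : a * e - b * d ≠ 0) {x y x' y' : ℝ} (h1 : a * x + b * y = a * x' + b * y')
    (h2 : d * x + e * y = d * x' + e * y') : x = x' ∧ y = y' := by
  constructor
  · have : (a * e - b * d) * (x - x') = 0 := by linear_combination e * h1 - b * h2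
    rcases mul_eq_zero.1 this with h | h
    · exact (hD h).elim
    · linarith
  · have : (a * e - b * d) * (y - y') = 0 := by linear_combination a * h2 - d * h1
    rcases mul_eq_zero.1 this with h | h
    · exact (hD h).elim
    · linarith

theorem OnS_aff (hD : a * e - b * d ≠ 0) (u v w : V) :
    OnS (fun v => a * X v + b * Y v + c) (fun v => d * X v + e * Y v + f) u v w ↔ OnS X Y u v w := by
  constructor
  · rintro ⟨t, h0, h1, h2, h3⟩
    simp only at h2 h3
    have := aff_inj a b d e hD (x := X w) (y := Y w) (x' := X u + t * (X v - X u))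
      (y' := Y u + t * (Y v - Y u)) (by linear_combination h2) (by linear_combination h3)
    exact ⟨t, h0, h1, this.1, this.2⟩
  · rintro ⟨t, h0, h1, h2, h3⟩
    refine ⟨t, h0, h1, ?_, ?_⟩
    · linear_combination a * h2 + b * h3
    · linear_combination d * h2 + e * h3

theorem PG.aff (h : PG H X Y) (hD : a * e - b * d ≠ 0) :
    PG H (fun v => a * X v + b * Y v + c) (fun v => d * X v + e * Y v + f) := by
  obtain ⟨h1, h2, h3, h4⟩ := h
  refine ⟨?_, ?_, ?_, ?_⟩
  · intro u w e1 e2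
    have := aff_inj a b d e hD (x := X u) (y := Y u) (x' := X w) (y' := Y w) (by linarith) (by linarith)
    exact h1 u w this.1 this.2
  · intro u v w
    rw [OnS_aff a b c d e f hD]
    exact h2 u v w
  · intro u v w z
    rw [Crs_aff a b c d e f hD]
    exact h3 u v w z
  · intro z p
    simp only [OnS_aff a b c d e f hD, Crs_aff a b c d e f hD]
    exact h4 z p

end affine
end

end

section
set_option linter.unusedSectionVars false
set_option linter.unusedVariables false

section
variable {V : Type*} {H : SimpleGraph V} {X Y : V → ℝ}

theorem Crs.swap {a b c d : V} (h : Crs X Y a b c d) : Crs X Y a b d c := by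
  have e : ∀ v, od X Y d c v = - od X Y c d v := by intro v; simp only [od]; ring
  obtain ⟨h1, h2⟩ := h
  refine ⟨by linarith, ?_⟩
  rw [e, e]; linarith

theorem Crs.symm {a b c d : V} (h : Crs X Y a b c d) : Crs X Y c d a b := ⟨h.2, h.1⟩

theorem Crs.swap' {a b c d : V} (h : Crs X Y a b c d) : Crs X Y b a c d := h.symm.swap.symm

theorem V_norm [Finite V] (h : PG H X Y) {z t s p : V} {μ P : ℝ} (hz1 : X z = 0) (hz2 : Y z = 0)
    (ht1 : X t = 0) (ht2 : Y t = 1) (hs1 : X s = 1 + μ) (hs2 : Y s = -μ) (hμ : 0 < μ)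
    (hp1 : X p = P) (hp2 : Y p = 0) (hP : 1 < P) (hst : H.Adj s t)
    (hfree : ∀ w, ¬ OnS X Y z p w) :
    ∃ p', 0 ≤ X p' ∧ 0 ≤ Y p' ∧ p' ≠ z ∧
      (∀ a b, H.Adj a b → Crs X Y z p' a b → Crs X Y z p a b) ∧ ¬ Crs X Y z p' s t := by
  have hfin : ({v | v ≠ z ∧ 0 ≤ X v ∧ 0 ≤ Y v ∧ X v + Y v ≤ 1} : Set V).Finite := Set.toFinite _
  have htA : t ∈ ({v | v ≠ z ∧ 0 ≤ X v ∧ 0 ≤ Y v ∧ X v + Y v ≤ 1} : Set V) := by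
    refine ⟨?_, by simp [ht1], by simp [ht2], by simp [ht1, ht2]⟩
    rintro rfl
    rw [hz2] at ht2; norm_num at ht2
  obtain ⟨p', ⟨hp'z, ha, hb, hab⟩, hmin⟩ := Set.exists_min_image _ (fun v => Y v / (X v + Y v)) hfin ⟨t, htA⟩
  have hpos : ∀ v, v ≠ z → 0 ≤ X v → 0 ≤ Y v → 0 < X v + Y v := by
    intro v hv h1 h2
    rcases h1.lt_or_eq with h1 | h1
    · linarith
    · rcases h2.lt_or_eq with h2 | h2
      · linarith
      · exact (hv (h.inj v z (by linarith) (by linarith))).elim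
  have hmin' : ∀ v, v ≠ z → 0 ≤ X v → 0 ≤ Y v → X v + Y v ≤ 1 → Y p' * X v ≤ X p' * Y v := by
    intro v h1 h2 h3 h4
    have := hmin v ⟨h1, h2, h3, h4⟩
    rw [div_le_div_iff₀ (hpos p' hp'z ha hb) (hpos v h1 h2 h3)] at this
    nlinarith
  have hp'0 := hpos p' hp'z ha hb
  have hb0 : 0 < Y p' := by
    rcases hb.lt_or_eq with hb | hb
    · exact hb
    · exfalso
      refine hfree p' ⟨X p' / P, ?_, ?_, ?_, ?_⟩
      · apply div_pos <;> linarith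
      · rw [div_lt_one (by linarith)]; linarith
      · rw [hz1, hp1]; field_simp; ring
      · rw [hz2, hp2, ← hb]; ring
  refine ⟨p', ha, hb, hp'z, ?_, ?_⟩
  · have key : ∀ u w, H.Adj u w → od X Y z p' u < 0 → 0 < od X Y z p' w →
        od X Y u w z * od X Y u w p' < 0 → Crs X Y z p u w := by
      intro u w huw h1 h2 h3
      simp only [od, hz1, hz2, sub_zero, zero_sub] at h1 h2 h3
      have huz : u ≠ z := by
        rintro rfl
        rw [hz1, hz2] at h1; simp at h1
      have hc := core (a := X p') (b := Y p') (u1 := X u) (u2 := Y u) (w1 := X w) (w2 := Y w)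
        ha hb0 hab (by linarith) (by linarith) (by convert h3 using 1; ring) (by
          rintro ⟨g1, g2, g3⟩
          have := hmin' u huz g1 g2 g3
          linarith)
      rcases hc with ⟨c1, c2, c3, c4⟩ | ⟨c1, c2, c3, c4⟩
      · have hP' : Y w - Y u < P * (Y w - Y u) := by nlinarith
        constructor
        · simp only [od, hz1, hz2, hp1, hp2, sub_zero]
          have := mul_neg_of_neg_of_pos c1 c2
          have : 0 < P * P := by nlinarith
          nlinarith
        · simp only [od, hz1, hz2, hp1, hp2, sub_zero]
          refine mul_neg_of_pos_of_neg (by linarith) (by linarith)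
      · exfalso
        refine h.cross s t u w hst huw ⟨?_, ?_⟩
        · simp only [od, hs1, hs2, ht1, ht2]
          refine mul_neg_of_neg_of_pos ?_ ?_
          · nlinarith
          · nlinarith
        · simp only [od, hs1, hs2, ht1, ht2]
          refine mul_neg_of_pos_of_neg ?_ ?_
          · nlinarith
          · nlinarith
    intro u w huw hc
    rcases lt_or_ge (od X Y z p' u) 0 with h1 | h1
    · refine key u w huw h1 ?_ hc.2
      have := hc.1
      by_contra hn
      push Not at hn
      nlinarith
    · refine (key w u huw.symm ?_ ?_ hc.swap.2).swap
      · have := hc.1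
        by_contra hn
        push Not at hn
        nlinarith
      · have := hc.1
        rcases h1.lt_or_eq with h1 | h1
        · exact h1
        · rw [← h1] at this; simp at this
  · intro hc
    have := hc.2
    simp only [od, hs1, hs2, ht1, ht2, hz1, hz2] at this
    have e : (0 - (1 + μ)) * (0 - -μ) - (1 - -μ) * (0 - (1 + μ)) = 1 + μ := by ring
    have e' : (0 - (1 + μ)) * (Y p' - -μ) - (1 - -μ) * (X p' - (1 + μ)) = (1 + μ) * (1 - X p' - Y p') := by ring
    rw [e, e'] at this
    have : 0 ≤ (1 + μ) * ((1 + μ) * (1 - X p' - Y p')) := by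
      apply mul_nonneg (by linarith); apply mul_nonneg <;> linarith
    linarith

/-- coordinates in the affine frame `z, (q1,q2), (t1,t2)` -/
theorem PG.frame (h : PG H X Y) (z : V) (q1 q2 t1 t2 : ℝ)
    (hD : (q1 - X z) * (t2 - Y z) - (q2 - Y z) * (t1 - X z) ≠ 0) :
    ∃ X' Y' : V → ℝ, PG H X' Y' ∧ (∀ a b c d, Crs X' Y' a b c d ↔ Crs X Y a b c d) ∧
      (∀ a b c, OnS X' Y' a b c ↔ OnS X Y a b c) ∧
      (∀ a b c, od X Y a b c = ((q1 - X z) * (t2 - Y z) - (q2 - Y z) * (t1 - X z)) * od X' Y' a b c) ∧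
      (∀ v, X v = X z + X' v * (q1 - X z) + Y' v * (t1 - X z)) ∧
      (∀ v, Y v = Y z + X' v * (q2 - Y z) + Y' v * (t2 - Y z)) ∧
      (∀ v a b, X v = X z + a * (q1 - X z) + b * (t1 - X z) →
        Y v = Y z + a * (q2 - Y z) + b * (t2 - Y z) → X' v = a ∧ Y' v = b) := by
  set D := (q1 - X z) * (t2 - Y z) - (q2 - Y z) * (t1 - X z) with hDD
  have hdet : ((t2 - Y z) / D) * ((q1 - X z) / D) - (-(t1 - X z) / D) * (-(q2 - Y z) / D) ≠ 0 := by
    have : ((t2 - Y z) / D) * ((q1 - X z) / D) - (-(t1 - X z) / D) * (-(q2 - Y z) / D) = 1 / D := by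
      field_simp
      rw [hDD]; ring
    rw [this]
    exact one_div_ne_zero hD
  let c := (-(t2 - Y z) * X z + (t1 - X z) * Y z) / D
  let f := ((q2 - Y z) * X z - (q1 - X z) * Y z) / D
  refine ⟨fun v => ((t2 - Y z) / D) * X v + (-(t1 - X z) / D) * Y v + c,
    fun v => (-(q2 - Y z) / D) * X v + ((q1 - X z) / D) * Y v + f, h.aff _ _ _ _ _ _ hdet,
    Crs_aff _ _ _ _ _ _ hdet, OnS_aff _ _ _ _ _ _ hdet, ?_, ?_, ?_, ?_⟩
  · intro u v w
    rw [od_aff]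
    field_simp
    rw [hDD]; ring
  · intro v
    simp only [c, f]
    field_simp
    rw [hDD]; ring
  · intro v
    simp only [c, f]
    field_simp
    rw [hDD]; ring
  · intro v a b h1 h2
    simp only [c, f]
    rw [h1, h2]
    constructor
    · field_simp
      rw [hDD]; ring
    · field_simp
      rw [hDD]; ring

end

end

section
set_option linter.unusedSectionVars false
set_option linter.unusedVariables false

section
variable {V : Type*} {H : SimpleGraph V} {X Y : V → ℝ}

theorem Crs.point {z p s t : V} (h : Crs X Y z p s t) : ∃ l k : ℝ, 0 < l ∧ l < 1 ∧ 0 < k ∧ k < 1 ∧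
    X z + l * (X p - X z) = X t + k * (X s - X t) ∧ Y z + l * (Y p - Y z) = Y t + k * (Y s - Y t) := by
  have hE : od X Y s t z - od X Y s t p = od X Y z p t - od X Y z p s := by simp only [od]; ring
  have i1 : (od X Y s t z - od X Y s t p) * X z + od X Y s t z * (X p - X z) =
      (od X Y s t z - od X Y s t p) * X t + od X Y z p t * (X s - X t) := by simp only [od]; ring
  have i2 : (od X Y s t z - od X Y s t p) * Y z + od X Y s t z * (Y p - Y z) =
      (od X Y s t z - od X Y s t p) * Y t + od X Y z p t * (Y s - Y t) := by simp only [od]; ring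
  obtain ⟨h1, h2⟩ := h
  have fr : ∀ a b : ℝ, a * b < 0 → 0 < b / (b - a) ∧ b / (b - a) < 1 := by
    intro a b hab
    rcases mul_neg_iff.1 hab with ⟨h1, h2⟩ | ⟨h1, h2⟩
    · refine ⟨div_pos_of_neg_of_neg h2 (by linarith), ?_⟩
      rw [div_lt_one_of_neg (by linarith)]; linarith
    · refine ⟨div_pos h2 (by linarith), ?_⟩
      rw [div_lt_one (by linarith)]; linarith
  have g1 := fr _ _ h1
  have g2 := fr (od X Y s t p) (od X Y s t z) (by linarith)
  have hne : od X Y s t z - od X Y s t p ≠ 0 := by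
    intro h0
    rw [h0] at g2; simp at g2
  refine ⟨_, _, g2.1, g2.2, g1.1, g1.2, ?_, ?_⟩
  · rw [← hE]
    field_simp
    linarith
  · rw [← hE]
    field_simp
    linarith

theorem PG.half [Finite V] (h : PG H X Y) (z : V) (f1 f2 : ℝ) (p0 : V)
    (hp0 : 0 < f1 * (X p0 - X z) + f2 * (Y p0 - Y z)) :
    ∃ p, H.Adj z p ∧ 0 < f1 * (X p - X z) + f2 * (Y p - Y z) := by
  let C : V → Set (V × V) := fun p => {e | H.Adj e.1 e.2 ∧ Crs X Y z p e.1 e.2}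
  let A : Set V := {p | 0 < f1 * (X p - X z) + f2 * (Y p - Y z)}
  obtain ⟨p1, hp1, hm1⟩ := Set.exists_min_image A (fun p => (C p).ncard) (Set.toFinite _) ⟨p0, hp0⟩
  let B : Set V := {p | p ∈ A ∧ (C p).ncard ≤ (C p1).ncard}
  obtain ⟨p, ⟨hpA, hpB⟩, hm2⟩ := Set.exists_min_image B
    (fun p => (X p - X z) ^ 2 + (Y p - Y z) ^ 2) (Set.toFinite _) ⟨p1, hp1, le_rfl⟩
  refine ⟨p, ?_, hpA⟩
  have hpA' : 0 < f1 * (X p - X z) + f2 * (Y p - Y z) := hpA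
  have hpz : z ≠ p := by
    rintro rfl
    simp at hpA'
  have hfree : ∀ w, ¬ OnS X Y z p w := by
    rintro w ⟨t, t0, t1, tx, ty⟩
    have hwA : w ∈ A := by
      show 0 < f1 * (X w - X z) + f2 * (Y w - Y z)
      rw [tx, ty]
      have := mul_pos t0 hpA'
      linarith
    have hsub : C w ⊆ C p := by
      rintro ⟨a, b⟩ ⟨hab, hc1, hc2⟩
      refine ⟨hab, ?_, ?_⟩
      · have e : ∀ v, od X Y z w v = t * od X Y z p v := by
          intro v; simp only [od, tx, ty]; ring
        simp only [e] at hc1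
        by_contra hn
        push Not at hn
        have := mul_nonneg (mul_pos t0 t0).le hn
        simp only at *
        nlinarith
      · have e : od X Y a b w = (1 - t) * od X Y a b z + t * od X Y a b p := by
          simp only [od, tx, ty]; ring
        simp only [e] at hc2
        simp only at *
        by_contra hn
        push Not at hn
        nlinarith [mul_nonneg (show 0 ≤ 1 - t by linarith) (mul_self_nonneg (od X Y a b z)), mul_nonneg t0.le hn]
    have hwB : w ∈ B := ⟨hwA, (Set.ncard_le_ncard hsub (Set.toFinite _)).trans hpB⟩
    have := hm2 w hwB
    simp only [tx, ty] at this
    have hpos : 0 < (X p - X z) ^ 2 + (Y p - Y z) ^ 2 := by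
      by_contra hn
      push Not at hn
      have e1 : X p - X z = 0 := by nlinarith [sq_nonneg (X p - X z), sq_nonneg (Y p - Y z)]
      have e2 : Y p - Y z = 0 := by nlinarith [sq_nonneg (X p - X z), sq_nonneg (Y p - Y z)]
      rw [e1, e2] at hpA'; simp at hpA'
    nlinarith [mul_pos (show 0 < 1 - t * t by nlinarith) hpos]
  refine h.max z p hpz hfree ?_
  have key : ∀ s t, H.Adj s t → Crs X Y z p s t → 0 < f1 * (X t - X z) + f2 * (Y t - Y z) → False := by
    intro s t hst hc ht
    obtain ⟨l, k, l0, l1, k0, k1, ex, ey⟩ := hc.point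
    have hD : (X z + l * (X p - X z) - X z) * (Y t - Y z) - (Y z + l * (Y p - Y z) - Y z) * (X t - X z) ≠ 0 := by
      have e : (X z + l * (X p - X z) - X z) * (Y t - Y z) - (Y z + l * (Y p - Y z) - Y z) * (X t - X z) =
        l * od X Y z p t := by simp only [od]; ring
      rw [e]
      refine mul_ne_zero l0.ne' ?_
      intro h0
      have := hc.1
      rw [h0] at this; simp at this
    obtain ⟨X', Y', hPG, hCr, hOn, -, hX, hY, hXY⟩ := h.frame z _ _ (X t) (Y t) hD
    have cz := hXY z 0 0 (by ring) (by ring)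
    have ct := hXY t 0 1 (by ring) (by ring)
    have cp := hXY p (1 / l) 0 (by field_simp; ring) (by field_simp; ring)
    have cs := hXY s (1 + (1 - k) / k) (-((1 - k) / k)) (by rw [ex]; field_simp; ring)
      (by rw [ey]; field_simp; ring)
    obtain ⟨p', q1, q2, q3, q4, q5⟩ := V_norm hPG cz.1 cz.2 ct.1 ct.2 cs.1 cs.2
      (div_pos (by linarith) k0) cp.1 cp.2 (by rw [lt_div_iff₀ l0]; linarith) hst (fun w => by rw [hOn]; exact hfree w)
    have hp'A : p' ∈ A := by
      show 0 < f1 * (X p' - X z) + f2 * (Y p' - Y z)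
      have e : f1 * (X p' - X z) + f2 * (Y p' - Y z) = X' p' * (l * (f1 * (X p - X z) + f2 * (Y p - Y z))) +
          Y' p' * (f1 * (X t - X z) + f2 * (Y t - Y z)) := by
        rw [hX p', hY p']; ring
      rw [e]
      have g := mul_pos l0 hpA'
      rcases q1.lt_or_eq with q1 | q1
      · have := mul_pos q1 g
        have := mul_nonneg q2 ht.le
        linarith
      · rcases q2.lt_or_eq with q2 | q2
        · have := mul_pos q2 ht
          rw [← q1]; linarith
        · exact (q3 (hPG.inj p' z (by rw [← q1, cz.1]) (by rw [← q2, cz.2]))).elim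
    have hss : C p' ⊂ C p := by
      refine ⟨?_, ?_⟩
      · rintro ⟨a, b⟩ ⟨hab, hc⟩
        exact ⟨hab, (hCr _ _ _ _).1 (q4 a b hab ((hCr _ _ _ _).2 hc))⟩
      · intro hh
        have : (s, t) ∈ C p' := hh ⟨hst, hc⟩
        exact q5 ((hCr _ _ _ _).2 this.2)
    have := Set.ncard_lt_ncard hss (Set.toFinite _)
    have := hm1 p' hp'A
    omega
  intro a b hab hc
  rcases lt_or_ge 0 (f1 * (X b - X z) + f2 * (Y b - Y z)) with hb | hb
  · exact key a b hab hc hb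
  · refine key b a hab.symm hc.swap ?_
    obtain ⟨l, k, l0, l1, k0, k1, ex, ey⟩ := hc.point
    have g := mul_pos l0 hpA'
    have e : l * (f1 * (X p - X z) + f2 * (Y p - Y z)) =
        k * (f1 * (X a - X z) + f2 * (Y a - Y z)) + (1 - k) * (f1 * (X b - X z) + f2 * (Y b - Y z)) := by
      linear_combination f1 * ex + f2 * ey
    by_contra hn
    push Not at hn
    nlinarith
end

end

section
set_option linter.unusedSectionVars false
set_option linter.unusedVariables false

section
variable {V : Type*} {H : SimpleGraph V} {X Y : V → ℝ}

theorem tri_b (h : PG H X Y) {w z u : V} (w1 : X w = 0) (w2 : Y w = 0) (z1 : X z = 1) (z2 : Y z = 0)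
    (u1 : X u = 0) (u2 : Y u = 1) (hwz : H.Adj w z) (hzu : H.Adj z u)
    (hem : ∀ v, v ≠ z → v ≠ w → v ≠ u → ¬ (0 ≤ X v ∧ 0 ≤ Y v ∧ X v + Y v ≤ 1))
    (hr : ∀ r, H.Adj z r → ¬ Crs X Y w u z r) : H.Adj w u := by
  have hne : w ≠ u := by rintro rfl; rw [w2] at u2; norm_num at u2
  refine h.max w u hne ?_ ?_
  · rintro v ⟨t, t0, t1, tx, ty⟩
    rw [w1, u1] at tx
    rw [w2, u2] at ty
    refine hem v ?_ ?_ ?_ ⟨by linarith, by linarith, by linarith⟩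
    · rintro rfl; rw [z1] at tx; linarith
    · rintro rfl; rw [w2] at ty; linarith
    · rintro rfl; rw [u2] at ty; linarith
  · have key : ∀ a b, H.Adj a b → Crs X Y w u a b → 0 < X a → False := by
      intro a b hab hc ha
      by_cases haz : a = z
      · subst haz
        exact hr b hab hc
      have hb : X b < 0 := by
        have := hc.1
        simp only [od, w1, w2, u1, u2] at this
        by_contra hn
        push Not at hn
        nlinarith
      have hc2 := hc.2
      simp only [od, w1, w2, u1, u2] at hc2
      have hco := core (a := 0) (b := 1) (u1 := X a) (u2 := Y a) (w1 := X b) (w2 := Y b)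
        le_rfl one_pos (by norm_num) (by linarith) (by linarith) (by convert hc2 using 1; ring)
        (hem a haz (by rintro rfl; linarith) (by rintro rfl; linarith))
      rcases hco with ⟨c1, c2, c3, c4⟩ | ⟨c1, c2, c3, c4⟩
      · refine h.cross w z a b hwz hab ⟨?_, ?_⟩
        · simp only [od, w1, w2, z1, z2]
          nlinarith
        · simp only [od, w1, w2, z1, z2]
          exact mul_neg_of_pos_of_neg (by linarith) (by linarith)
      · rcases c4.lt_or_eq with c4 | c4
        · refine h.cross z u a b hzu hab ⟨?_, ?_⟩
          · simp only [od, u1, u2, z1, z2]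
            exact mul_neg_of_neg_of_pos (by linarith) (by linarith)
          · simp only [od, u1, u2, z1, z2]
            exact mul_neg_of_pos_of_neg (by linarith) (by linarith)
        · have hd : 0 < X a + Y a - (X b + Y b) := by linarith
          refine h.vert a b z hab ⟨(X a + Y a - 1) / (X a + Y a - (X b + Y b)), ?_, ?_, ?_, ?_⟩
          · exact div_pos (by linarith) hd
          · rw [div_lt_one hd]; linarith
          · rw [z1]; field_simp; linear_combination -c4
          · rw [z2]; field_simp; linear_combination c4
    intro a b hab hc
    rcases lt_or_ge 0 (X a) with ha | ha
    · exact key a b hab hc ha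
    · refine key b a hab.symm hc.swap ?_
      have := hc.1
      simp only [od, w1, w2, u1, u2] at this
      by_contra hn
      push Not at hn
      nlinarith

theorem tri_a [Finite V] (h : PG H X Y) {w z u : V} (z1 : X z = 0) (z2 : Y z = 0) (w1 : X w = 1) (w2 : Y w = 0)
    (u1 : X u = 0) (u2 : Y u = 1) (hzw : H.Adj z w) (hzu : H.Adj z u)
    (hr : ∀ r, H.Adj z r → 0 < Y r → X r ≤ 0) :
    ∀ v, v ≠ z → v ≠ w → v ≠ u → ¬ (0 ≤ X v ∧ 0 ≤ Y v ∧ X v + Y v ≤ 1) := by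
  intro v0 v1 v2 v3 v4
  let T : Set V := {v | v ≠ z ∧ v ≠ w ∧ v ≠ u ∧ 0 ≤ X v ∧ 0 ≤ Y v ∧ X v + Y v ≤ 1}
  obtain ⟨r, ⟨rz, rw', ru, ha, hb, hab⟩, hmin⟩ := Set.exists_min_image T (fun v => X v + Y v) (Set.toFinite _)
    ⟨v0, v1, v2, v3, v4⟩
  have ha0 : 0 < X r := by
    rcases ha.lt_or_eq with g | g
    · exact g
    · exfalso
      refine h.vert z u r hzu ⟨Y r, ?_, ?_, by rw [z1, u1, ← g]; ring, by rw [z2, u2]; ring⟩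
      · refine hb.lt_of_ne' (fun e => rz (h.inj _ _ (by rw [z1, ← g]) (by rw [z2, e])))
      · refine lt_of_le_of_ne (by linarith) (fun e => ru (h.inj _ _ (by rw [u1, ← g]) (by rw [u2, e])))
  have hb0 : 0 < Y r := by
    rcases hb.lt_or_eq with g | g
    · exact g
    · exfalso
      refine h.vert z w r hzw ⟨X r, ha0, ?_, by rw [z1, w1]; ring, by rw [z2, w2, ← g]; ring⟩
      refine lt_of_le_of_ne (by linarith) (fun e => rw' (h.inj _ _ (by rw [w1, e]) (by rw [w2, ← g])))
  have hnadj : ¬ H.Adj z r := fun hh => by linarith [hr r hh hb0]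
  apply hnadj
  refine h.max z r (Ne.symm rz) ?_ ?_
  · rintro v ⟨t, t0, t1, tx, ty⟩
    rw [z1] at tx
    rw [z2] at ty
    have p1 : 0 < X v := by rw [tx]; nlinarith
    have p2 : 0 < Y v := by rw [ty]; nlinarith
    have p3 : X v + Y v < X r + Y r := by rw [tx, ty]; nlinarith
    have := hmin v ⟨by rintro rfl; linarith, by rintro rfl; linarith, by rintro rfl; linarith,
      p1.le, p2.le, by linarith⟩
    linarith
  · have hin : ∀ s, X s + Y s < X r + Y r → s ≠ z → ¬ (0 ≤ X s ∧ 0 ≤ Y s ∧ X s + Y s ≤ 1) := by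
      rintro s hs hsz ⟨q1, q2, q3⟩
      have := hmin s ⟨hsz, by rintro rfl; linarith, by rintro rfl; linarith, q1, q2, q3⟩
      linarith
    have key : ∀ s t, H.Adj s t → Crs X Y z r s t → X s + Y s ≤ X t + Y t → False := by
      intro s t hst hc hS
      obtain ⟨c1, c2⟩ := hc
      have hsz : s ≠ z := by
        rintro rfl
        simp [od] at c1
      obtain ⟨l, k, l0, l1, k0, k1, ex, ey⟩ := Crs.point ⟨c1, c2⟩
      rw [z1] at ex
      rw [z2] at ey
      have hSs : X s + Y s < X r + Y r := by nlinarith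
      have hnot := hin s hSs hsz
      simp only [od, z1, z2] at c1 c2
      rcases mul_neg_iff.1 c1 with ⟨d1, d2⟩ | ⟨d1, d2⟩
      · have hco := core (a := Y r) (b := X r) (u1 := Y s) (u2 := X s) (w1 := Y t) (w2 := X t) hb ha0
          (by linarith) (by linarith) (by linarith) (by convert c2 using 1; ring) (by
            rintro ⟨q1, q2, q3⟩; exact hnot ⟨q2, q1, by linarith⟩)
        rcases hco with ⟨e1, e2, e3, e4⟩ | ⟨e1, -⟩
        · refine h.cross z u s t hzu hst ⟨?_, ?_⟩
          · simp only [od, z1, z2, u1, u2]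
            nlinarith
          · simp only [od, z1, z2, u1, u2]
            exact mul_neg_of_neg_of_pos (by linarith) (by linarith)
        · linarith
      · have hco := core (a := X r) (b := Y r) (u1 := X s) (u2 := Y s) (w1 := X t) (w2 := Y t) ha hb0
          (by linarith) (by linarith) (by linarith) (by convert c2 using 1; ring) hnot
        rcases hco with ⟨e1, e2, e3, e4⟩ | ⟨e1, -⟩
        · refine h.cross z w s t hzw hst ⟨?_, ?_⟩
          · simp only [od, z1, z2, w1, w2]
            nlinarith
          · simp only [od, z1, z2, w1, w2]
            exact mul_neg_of_pos_of_neg (by linarith) (by linarith)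
        · linarith
    intro s t hst hc
    rcases le_total (X s + Y s) (X t + Y t) with hS | hS
    · exact key s t hst hc hS
    · exact key t s hst.symm hc.swap hS

def Face (H : SimpleGraph V) (X Y : V → ℝ) (z w u : V) : Prop :=
  H.Adj z w ∧ H.Adj w u ∧ H.Adj u z ∧ 0 < od X Y z w u ∧
    ∀ v, v ≠ z → v ≠ w → v ≠ u → ¬ (0 ≤ od X Y z w v ∧ 0 ≤ od X Y w u v ∧ 0 ≤ od X Y u z v)

theorem od_rot (a b c : V) : od X Y a b c = od X Y b c a := by simp only [od]; ring
theorem od_swap (a b c : V) : od X Y a b c = - od X Y b a c := by simp only [od]; ring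
theorem od_swap' (a b c : V) : od X Y a b c = - od X Y a c b := by simp only [od]; ring

theorem Face.rot {z w u : V} (h : Face H X Y z w u) : Face H X Y w u z := by
  obtain ⟨h1, h2, h3, h4, h5⟩ := h
  refine ⟨h2, h3, h1, by rwa [← od_rot], ?_⟩
  rintro v g1 g2 g3 ⟨g4, g5, g6⟩
  exact h5 v g3 g1 g2 ⟨g6, g4, g5⟩

theorem PG.face [Finite V] (h : PG H X Y) {z w : V} (hzw : H.Adj z w) (hl : ∃ v, 0 < od X Y z w v) :
    ∃ u, Face H X Y z w u := by
  obtain ⟨v, hv⟩ := hl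
  obtain ⟨u0, hu0, hu0'⟩ := h.half z (-(Y w - Y z)) (X w - X z) v (by simp only [od] at hv; linarith)
  let A : Set V := {u | H.Adj z u ∧ 0 < od X Y z w u}
  obtain ⟨u, ⟨hu1, hu2⟩, hmin⟩ := Set.exists_min_image A
    (fun u => -((X w - X z) * (X u - X z) + (Y w - Y z) * (Y u - Y z)) / od X Y z w u)
    (Set.toFinite _) ⟨u0, hu0, by simp only [od]; linarith⟩
  have hfirst : ∀ r, H.Adj z r → 0 < od X Y z w r → 0 ≤ od X Y z u r := by
    intro r h1 h2
    have := hmin r ⟨h1, h2⟩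
    rw [div_le_div_iff₀ hu2 h2] at this
    have hpos : 0 < (X w - X z) ^ 2 + (Y w - Y z) ^ 2 := by
      by_contra hn
      push Not at hn
      have e1 : X w - X z = 0 := by nlinarith [sq_nonneg (X w - X z), sq_nonneg (Y w - Y z)]
      have e2 : Y w - Y z = 0 := by nlinarith [sq_nonneg (X w - X z), sq_nonneg (Y w - Y z)]
      simp [od, e1, e2] at h2
    have e : ((X w - X z) ^ 2 + (Y w - Y z) ^ 2) * od X Y z u r =
        ((X w - X z) * (X u - X z) + (Y w - Y z) * (Y u - Y z)) * od X Y z w r -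
        ((X w - X z) * (X r - X z) + (Y w - Y z) * (Y r - Y z)) * od X Y z w u := by
      simp only [od]; ring
    by_contra hn
    push Not at hn
    have := mul_neg_of_pos_of_neg hpos hn
    linarith
  -- frame at z
  obtain ⟨X', Y', hPG, hCr, hOn, hod, hX, hY, hXY⟩ := h.frame z (X w) (Y w) (X u) (Y u) (ne_of_gt hu2)
  have hD : (X w - X z) * (Y u - Y z) - (Y w - Y z) * (X u - X z) = od X Y z w u := rfl
  rw [hD] at hod
  have cz := hXY z 0 0 (by ring) (by ring)
  have cw := hXY w 1 0 (by ring) (by ring)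
  have cu := hXY u 0 1 (by ring) (by ring)
  have o1 : ∀ v, od X' Y' z w v = Y' v := by
    intro v; simp only [od, cz.1, cz.2, cw.1, cw.2]; ring
  have o2 : ∀ v, od X' Y' w u v = 1 - X' v - Y' v := by
    intro v; simp only [od, cu.1, cu.2, cw.1, cw.2]; ring
  have o3 : ∀ v, od X' Y' u z v = X' v := by
    intro v; simp only [od, cu.1, cu.2, cz.1, cz.2]; ring
  have hem := tri_a hPG cz.1 cz.2 cw.1 cw.2 cu.1 cu.2 hzw hu1 (by
    intro r hr hYr
    have h2 : 0 < od X Y z w r := by rw [hod, o1]; exact mul_pos hu2 hYr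
    have h3 := hfirst r hr h2
    rw [od_swap, hod, o3] at h3
    by_contra hn
    push Not at hn
    have := mul_pos hu2 hn
    linarith)
  have hnn : ∀ t : ℝ, 0 ≤ od X Y z w u * t → 0 ≤ t := fun t ht => by
    by_contra hn
    push Not at hn
    have := mul_neg_of_pos_of_neg hu2 hn
    linarith
  have hem' : ∀ v, v ≠ z → v ≠ w → v ≠ u → ¬ (0 ≤ od X Y z w v ∧ 0 ≤ od X Y w u v ∧ 0 ≤ od X Y u z v) := by
    rintro v v1 v2 v3 ⟨v4, v5, v6⟩
    rw [hod, o1] at v4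
    rw [hod, o2] at v5
    rw [hod, o3] at v6
    have := hnn _ v5
    exact hem v v1 v2 v3 ⟨hnn _ v6, hnn _ v4, by linarith⟩
  refine ⟨u, hzw, ?_, hu1.symm, hu2, hem'⟩
  -- frame at w
  obtain ⟨X2, Y2, hPG2, hCr2, -, hod2, hX2, hY2, hXY2⟩ := h.frame w (X z) (Y z) (X u) (Y u) (by
    have e : (X z - X w) * (Y u - Y w) - (Y z - Y w) * (X u - X w) = - od X Y z w u := by
      simp only [od]; ring
    rw [e]; linarith)
  have e : (X z - X w) * (Y u - Y w) - (Y z - Y w) * (X u - X w) = - od X Y z w u := by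
    simp only [od]; ring
  rw [e] at hod2
  have dz := hXY2 z 1 0 (by ring) (by ring)
  have dw := hXY2 w 0 0 (by ring) (by ring)
  have du := hXY2 u 0 1 (by ring) (by ring)
  have q1 : ∀ v, od X2 Y2 z w v = - Y2 v := by
    intro v; simp only [od, dz.1, dz.2, dw.1, dw.2]; ring
  have q2 : ∀ v, od X2 Y2 w u v = - X2 v := by
    intro v; simp only [od, du.1, du.2, dw.1, dw.2]; ring
  have q3 : ∀ v, od X2 Y2 u z v = - (1 - X2 v - Y2 v) := by
    intro v; simp only [od, du.1, du.2, dz.1, dz.2]; ring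
  refine tri_b hPG2 dw.1 dw.2 dz.1 dz.2 du.1 du.2 hzw.symm hu1 ?_ ?_
  · rintro v v1 v2 v3 ⟨v4, v5, v6⟩
    refine hem' v v1 v2 v3 ⟨?_, ?_, ?_⟩
    · rw [hod2, q1]; have := mul_nonneg hu2.le v5; linarith
    · rw [hod2, q2]; have := mul_nonneg hu2.le v4; linarith
    · rw [hod2, q3]; have := mul_nonneg hu2.le (show 0 ≤ 1 - X2 v - Y2 v by linarith); linarith
  · intro r hr hc
    rw [hCr2, ← hCr] at hc
    obtain ⟨l, k, l0, l1, k0, k1, ex, ey⟩ := hc.point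
    rw [cw.1, cu.1, cz.1] at ex
    rw [cw.2, cu.2, cz.2] at ey
    have hYr : 0 < Y' r := by
      by_contra hn
      push Not at hn
      nlinarith
    have hXr : 0 < X' r := by
      by_contra hn
      push Not at hn
      nlinarith
    have h2 : 0 < od X Y z w r := by rw [hod, o1]; exact mul_pos hu2 hYr
    have h3 := hfirst r hr h2
    rw [od_swap, hod, o3] at h3
    have := mul_pos hu2 hXr
    linarith
end

end

section
set_option linter.unusedSectionVars false
set_option linter.unusedVariables false

section
variable {V : Type*} {H : SimpleGraph V} {X Y : V → ℝ}

theorem PG.ray0 (h : PG H X Y) {z u u' : V} (hu : H.Adj z u) (hu' : H.Adj z u') (k : ℝ) (hk : 0 < k)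
    (e1 : X u' - X z = k * (X u - X z)) (e2 : Y u' - Y z = k * (Y u - Y z)) : u = u' := by
  rcases lt_trichotomy k 1 with h1 | h1 | h1
  · exact (h.vert z u u' hu ⟨k, hk, h1, by linarith, by linarith⟩).elim
  · subst h1
    exact h.inj _ _ (by linarith) (by linarith)
  · refine (h.vert z u' u hu' ⟨1 / k, by positivity, ?_, ?_, ?_⟩).elim
    · rw [div_lt_one hk]; exact h1
    · rw [e1]; field_simp; ring
    · rw [e2]; field_simp; ring

theorem cramer (z u v w : V) :
    od X Y z u v * (X w - X z) = od X Y z w v * (X u - X z) + od X Y z u w * (X v - X z) ∧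
    od X Y z u v * (Y w - Y z) = od X Y z w v * (Y u - Y z) + od X Y z u w * (Y v - Y z) := by
  constructor <;> (simp only [od]; ring)

theorem plucker (z a b c d : V) :
    od X Y z a b * od X Y z c d - od X Y z a c * od X Y z b d + od X Y z a d * od X Y z b c = 0 := by
  simp only [od]; ring

theorem od_self1 (a b : V) : od X Y a b a = 0 := by simp only [od]; ring
theorem od_self2 (a b : V) : od X Y a b b = 0 := by simp only [od]; ring

/-- two neighbours in the same direction coincide -/
theorem PG.ray (h : PG H X Y) {z u u' v : V} (hu : H.Adj z u) (hu' : H.Adj z u')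
    (h0 : od X Y z u u' = 0) (h1 : od X Y z u v ≠ 0) (h2 : 0 ≤ od X Y z u v * od X Y z u' v) : u = u' := by
  obtain ⟨c1, c2⟩ := cramer (X := X) (Y := Y) z u v u'
  rw [h0, zero_mul, add_zero] at c1 c2
  have h3 : od X Y z u' v ≠ 0 := by
    intro h3
    rw [h3, zero_mul] at c1 c2
    have e1 := (mul_eq_zero.1 c1).resolve_left h1
    have e2 := (mul_eq_zero.1 c2).resolve_left h1
    exact hu'.ne (h.inj _ _ (by linarith) (by linarith))
  refine h.ray0 hu hu' (od X Y z u' v / od X Y z u v) ?_ ?_ ?_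
  · have : 0 < od X Y z u v * od X Y z u' v := lt_of_le_of_ne h2 (Ne.symm (mul_ne_zero h1 h3))
    have e : od X Y z u' v / od X Y z u v = (od X Y z u v * od X Y z u' v) / (od X Y z u v) ^ 2 := by
      field_simp
    rw [e]
    positivity
  · field_simp; linarith
  · field_simp; linarith

theorem Face.empty (h : PG H X Y) {z w u u' : V} (hf : Face H X Y z w u) (hu' : H.Adj z u')
    (h1 : 0 < od X Y z w u') (h2 : 0 < od X Y z u' u) : False := by
  obtain ⟨f1, f2, f3, f4, f5⟩ := hf
  have e1 : od X Y u z u' = od X Y z u' u := od_rot _ _ _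
  rcases lt_or_ge (od X Y w u u') 0 with h3 | h3
  · refine h.cross z u' w u hu' f2 ⟨?_, ?_⟩
    · rw [od_swap' z u' w]; nlinarith
    · rw [← od_rot z w u]; nlinarith
  · refine f5 u' hu'.ne' ?_ ?_ ⟨h1.le, h3, by rw [e1]; exact h2.le⟩
    · rintro rfl; rw [od_self2] at h1; exact lt_irrefl _ h1
    · rintro rfl; rw [od_self2] at h2; exact lt_irrefl _ h2

theorem Face.uniq (h : PG H X Y) {z w u u' : V} (hf : Face H X Y z w u) (hf' : Face H X Y z w u') :
    u = u' := by
  rcases lt_trichotomy (od X Y z u u') 0 with h1 | h1 | h1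
  · exact (hf.empty h hf'.2.2.1.symm hf'.2.2.2.1 (by rw [od_swap']; linarith)).elim
  · have := hf.2.2.2.1
    have := hf'.2.2.2.1
    refine h.ray (v := w) hf.2.2.1.symm hf'.2.2.1.symm h1 ?_ ?_
    · rw [od_swap']; linarith
    · rw [od_swap' z u w, od_swap' z u' w]; nlinarith
  · exact (hf'.empty h hf.2.2.1.symm hf.2.2.2.1 h1).elim

theorem PG.chain [Finite V] (h : PG H X Y) (z u : V) (hu : H.Adj z u) (P : V → Prop) (n : ℕ) :
    ∀ w, ({k | H.Adj z k ∧ 0 < od X Y z w k ∧ 0 ≤ od X Y z k u} : Set V).ncard ≤ n → H.Adj z w →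
      0 < od X Y z w u → P w → (∀ k, H.Adj z k → 0 < od X Y z w k → 0 ≤ od X Y z k u → P k) →
      Relation.ReflTransGen (fun k k' => Face H X Y z k k' ∧ P k ∧ P k') w u := by
  induction n with
  | zero =>
    intro w hn hw hwu
    exfalso
    have : u ∈ ({k | H.Adj z k ∧ 0 < od X Y z w k ∧ 0 ≤ od X Y z k u} : Set V) :=
      ⟨hu, hwu, by rw [od_self2]⟩
    have h0 := (Set.ncard_eq_zero (Set.toFinite _)).1 (Nat.le_zero.1 hn)
    rw [h0] at this
    exact this
  | succ n ih =>
    intro w hn hw hwu hPw hP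
    obtain ⟨k, hk⟩ := h.face hw ⟨u, hwu⟩
    have hzk := hk.2.2.1.symm
    have hwk := hk.2.2.2.1
    rcases lt_trichotomy (od X Y z k u) 0 with h1 | h1 | h1
    · exact (hk.empty h hu hwu (by rw [od_swap']; linarith)).elim
    · have : k = u := by
        refine h.ray (v := w) hzk hu h1 ?_ ?_
        · rw [od_swap']; linarith
        · rw [od_swap' z k w, od_swap' z u w]; nlinarith
      subst this
      exact Relation.ReflTransGen.single ⟨hk, hPw, hP k hzk hwk h1.ge⟩
    · have hPk := hP k hzk hwk h1.le
      have hcone : ∀ j, 0 < od X Y z k j → 0 ≤ od X Y z j u → 0 < od X Y z w j := by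
        intro j j1 j2
        have hp := plucker (X := X) (Y := Y) z w k j u
        by_contra hn
        push Not at hn
        nlinarith [mul_nonneg hwk.le j2, mul_pos hwu j1, mul_nonneg (neg_nonneg.2 hn) h1.le]
      refine Relation.ReflTransGen.head (b := k) ⟨hk, hPw, hPk⟩ (ih k ?_ hzk h1 hPk ?_)
      · have hss : ({j | H.Adj z j ∧ 0 < od X Y z k j ∧ 0 ≤ od X Y z j u} : Set V) ⊂
          {j | H.Adj z j ∧ 0 < od X Y z w j ∧ 0 ≤ od X Y z j u} := by
          refine ⟨?_, ?_⟩
          · rintro j ⟨j1, j2, j3⟩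
            exact ⟨j1, hcone j j2 j3, j3⟩
          · intro hh
            have : k ∈ ({j | H.Adj z j ∧ 0 < od X Y z k j ∧ 0 ≤ od X Y z j u} : Set V) :=
              hh ⟨hzk, hwk, h1.le⟩
            have := this.2.1
            rw [od_self2] at this
            exact lt_irrefl _ this
        have := Set.ncard_lt_ncard hss (Set.toFinite _)
        omega
      · intro j j1 j2 j3
        exact hP j j1 (hcone j j2 j3) j3

def Out (H : SimpleGraph V) (X Y : V → ℝ) (a b : V) : Prop := H.Adj a b ∧ ∀ u, od X Y a b u ≤ 0

theorem PG.face_or [Finite V] (h : PG H X Y) {z w : V} (hzw : H.Adj z w) :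
    (∃ u, Face H X Y z w u) ∨ Out H X Y z w := by
  by_cases hl : ∃ v, 0 < od X Y z w v
  · exact Or.inl (h.face hzw hl)
  · push Not at hl
    exact Or.inr ⟨hzw, hl⟩

theorem noncol (hX : Function.Injective X) (hnc : ∃ a b c, od X Y a b c ≠ 0) {a b : V} (hab : a ≠ b) :
    ∃ v, od X Y a b v ≠ 0 := by
  by_contra hn
  push Not at hn
  obtain ⟨p, q, r, hpqr⟩ := hnc
  apply hpqr
  have hx : X b - X a ≠ 0 := fun e => hab (hX (by linarith))
  have hp := hn p
  have hq := hn q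
  have hr := hn r
  simp only [od] at *
  have : (X b - X a) * ((X q - X p) * (Y r - Y p) - (Y q - Y p) * (X r - X p)) = 0 := by
    linear_combination (X q - X p) * (hr - hp) - (X r - X p) * (hq - hp)
  exact (mul_eq_zero.1 this).resolve_left hx

end

end

section
set_option linter.unusedSectionVars false
set_option linter.unusedVariables false

section
variable {V : Type*} {H : SimpleGraph V} {X Y : V → ℝ}

theorem Face.adj13 {z w u : V} (h : Face H X Y z w u) : H.Adj z u := h.2.2.1.symm

theorem Out.uniq (h : PG H X Y) (hX : Function.Injective X) (hnc : ∃ a b c, od X Y a b c ≠ 0)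
    {a b d : V} (h1 : Out H X Y a b) (h2 : Out H X Y a d) : b = d := by
  obtain ⟨v, hv⟩ := noncol hX hnc h1.1.ne
  refine h.ray (v := v) h1.1 h2.1 ?_ hv (mul_nonneg_of_nonpos_of_nonpos (h1.2 v) (h2.2 v))
  have := h1.2 d
  have := h2.2 b
  rw [od_swap'] at this
  linarith

theorem Out.uniq' (h : PG H X Y) (hX : Function.Injective X) (hnc : ∃ a b c, od X Y a b c ≠ 0)
    {a b d : V} (h1 : Out H X Y b a) (h2 : Out H X Y d a) : b = d := by
  obtain ⟨v, hv⟩ := noncol hX hnc h1.1.ne'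
  have g1 : ∀ u, 0 ≤ od X Y a b u := fun u => by
    have := h1.2 u; rw [od_swap] at this; linarith
  have g2 : ∀ u, 0 ≤ od X Y a d u := fun u => by
    have := h2.2 u; rw [od_swap] at this; linarith
  refine h.ray (v := v) h1.1.symm h2.1.symm ?_ hv (mul_nonneg (g1 v) (g2 v))
  have := g1 d
  have := g2 b
  rw [od_swap'] at this
  linarith

theorem Face.prev (h : PG H X Y) {z w w' u : V} (h1 : Face H X Y z w u) (h2 : Face H X Y z w' u) :
    w = w' := h1.rot.rot.uniq h h2.rot.rot

theorem fin_succ_pred {N : Type*} [Finite N] (R : N → N → Prop)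
    (hi : ∀ a a' b, R a b → R a' b → a = a') (ht : ∀ a, ∃ b, R a b) : ∀ b, ∃ a, R a b := by
  choose f hf using ht
  have hinj : Function.Injective f := by
    intro a a' e
    have := hf a'
    rw [← e] at this
    exact hi _ _ _ (hf a) this
  intro b
  obtain ⟨a, rfl⟩ := Finite.surjective_of_injective hinj b
  exact ⟨a, hf a⟩

theorem PG.out_succ [Finite V] (h : PG H X Y) {a b : V} (hb : Out H X Y b a) : ∃ d, Out H X Y a d := by
  by_contra hn
  push Not at hn
  have := fin_succ_pred (N := {w // H.Adj a w}) (fun w u => Face H X Y a w u)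
    (fun w w' u h1 h2 => Subtype.ext (h1.prev h h2))
    (fun w => by
      rcases h.face_or w.2 with ⟨u, hu⟩ | ho
      · exact ⟨⟨u, hu.adj13⟩, hu⟩
      · exact (hn _ ho).elim) ⟨b, hb.1.symm⟩
  obtain ⟨w, hw⟩ := this
  have h1 := hw.rot.rot.2.2.2.1
  have h2 := hb.2 w
  simp only at h1
  linarith

theorem PG.out_pred [Finite V] (h : PG H X Y) {a b : V} (hb : Out H X Y a b) : ∃ d, Out H X Y d a := by
  by_contra hn
  push Not at hn
  have := fin_succ_pred (N := {w // H.Adj a w}) (fun u w => Face H X Y a w u)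
    (fun w w' u h1 h2 => Subtype.ext (h1.uniq h h2))
    (fun w => by
      rcases h.face_or w.2.symm with ⟨u, hu⟩ | ho
      · exact ⟨⟨u, hu.rot.1⟩, hu.rot⟩
      · exact (hn _ ho).elim) ⟨b, hb.1⟩
  obtain ⟨w, hw⟩ := this
  have h1 := hw.2.2.2.1
  have h2 := hb.2 w
  simp only at h1
  linarith

/-- link connectivity at a real vertex -/
theorem PG.link_real [Finite V] (h : PG H X Y) (hX : Function.Injective X) (hnc : ∃ a b c, od X Y a b c ≠ 0)
    (z : V) (U : Set V) (hU : ∀ w u, Face H X Y z w u → (w ∈ U ↔ u ∈ U)) (w w' : V) (hw : w ∈ U)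
    (h1 : H.Adj z w) (h2 : H.Adj z w') : w' ∈ U := by
  by_contra hw'
  have key : ∀ a b, H.Adj z a → H.Adj z b → 0 < od X Y z a b → (a ∈ U ↔ b ∈ U) := by
    intro a b ha hb hab
    have := h.chain z b hb (fun _ => True) _ a le_rfl ha hab trivial (fun _ _ _ _ => trivial)
    clear hab hb
    induction this with
    | refl => rfl
    | tail _ hs ih => exact ih.trans (hU _ _ hs.1)
  have key2 : ∀ a b, H.Adj z a → H.Adj z b → a ∈ U → b ∉ U → od X Y z a b = 0 := by
    intro a b ha hb haU hbU
    rcases lt_trichotomy (od X Y z a b) 0 with g | g | g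
    · exact (hbU ((key b a hb ha (by rw [od_swap']; linarith)).2 haU)).elim
    · exact g
    · exact (hbU ((key a b ha hb g).1 haU)).elim
  have h0 := key2 w w' h1 h2 hw hw'
  have fin : ∀ u, H.Adj z u → u ∈ U → od X Y z w u ≠ 0 → False := by
    intro u hu huU hwu
    have h3 := key2 u w' hu h2 huU hw'
    have c := cramer (X := X) (Y := Y) z w u w'
    rw [h0, od_swap' z w' u, h3] at c
    simp only [neg_zero, zero_mul, add_zero] at c
    have e1 := (mul_eq_zero.1 c.1).resolve_left hwu
    have e2 := (mul_eq_zero.1 c.2).resolve_left hwu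
    exact h2.ne (h.inj _ _ (by linarith) (by linarith))
  obtain ⟨v, hv⟩ := noncol hX hnc h1.ne
  rcases lt_or_gt_of_ne hv with hv | hv
  · obtain ⟨u, hu⟩ := h.face h1.symm ⟨v, by rw [od_swap]; linarith⟩
    have hu' := hu.rot
    refine fin u hu'.1 ((hU _ _ hu').2 hw) ?_
    have := hu.2.2.2.1
    rw [od_swap] at this
    linarith
  · obtain ⟨u, hu⟩ := h.face h1 ⟨v, hv⟩
    exact fin u hu.adj13 ((hU _ _ hu).1 hw) hu.2.2.2.1.ne'

theorem Out.rightmost (h : PG H X Y) (hX : Function.Injective X) (hnc : ∃ a b c, od X Y a b c ≠ 0)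
    {z b c : V} (hb : Out H X Y z b) (hc : Out H X Y c z) (hbz : X b < X z) (hcz : X c < X z) :
    ∀ v, X v ≤ X z := by
  have gc : ∀ u, 0 ≤ od X Y z c u := fun u => by
    have := hc.2 u; rw [od_swap] at this; linarith
  intro v
  rcases (hb.2 c).lt_or_eq with h1 | h1
  · have e := (cramer (X := X) (Y := Y) z b c v).1
    rw [od_swap' z v c] at e
    by_contra hn
    push Not at hn
    nlinarith [mul_nonneg (gc v) (show 0 ≤ X z - X b by linarith),
      mul_nonneg (neg_nonneg.2 (hb.2 v)) (show 0 ≤ X z - X c by linarith)]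
  · exfalso
    obtain ⟨t, ht⟩ := noncol hX hnc hb.1.ne
    have ht' := lt_of_le_of_ne (hb.2 t) ht
    have e := (cramer (X := X) (Y := Y) z b t c).1
    rw [h1, zero_mul, add_zero] at e
    nlinarith [mul_nonneg (gc t) (show 0 ≤ X z - X b by linarith)]

theorem PG.link_inf [Finite V] (h : PG H X Y) (hX : Function.Injective X) (hnc : ∃ a b c, od X Y a b c ≠ 0)
    (U : Set V) (hU : ∀ w u, Out H X Y w u → (w ∈ U ↔ u ∈ U)) (w w' : V) (hw : w ∈ U)
    (h1 : ∃ c, Out H X Y w c) (h2 : ∃ c, Out H X Y w' c) : w' ∈ U := by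
  by_contra hw'
  have key : ∀ U : Set V, (∀ w u, Out H X Y w u → (w ∈ U ↔ u ∈ U)) → ∀ w ∈ U, (∃ c, Out H X Y w c) →
      ∃ z ∈ U, ∀ v, X v ≤ X z := by
    intro U hU w hw hc
    obtain ⟨z, ⟨hzU, hzc⟩, hmax⟩ := Set.exists_max_image {w | w ∈ U ∧ ∃ c, Out H X Y w c} X (Set.toFinite _)
      ⟨w, hw, hc⟩
    refine ⟨z, hzU, ?_⟩
    obtain ⟨b, hb⟩ := hzc
    obtain ⟨c, hc⟩ := h.out_pred hb
    have b1 := hmax b ⟨(hU _ _ hb).1 hzU, h.out_succ hb⟩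
    have c1 := hmax c ⟨(hU _ _ hc).2 hzU, z, hc⟩
    exact Out.rightmost h hX hnc hb hc (lt_of_le_of_ne b1 (fun e => hb.1.ne' (hX e)))
      (lt_of_le_of_ne c1 (fun e => hc.1.ne (hX e)))
  obtain ⟨z, hz, hz'⟩ := key U hU w hw h1
  obtain ⟨z2, hz2, hz2'⟩ := key Uᶜ (fun w u hh => not_congr (hU w u hh)) w' hw' h2
  have : z = z2 := hX (le_antisymm (hz2' z) (hz' z2))
  subst this
  exact hz2 hz

theorem PG.ex_out [Finite V] (h : PG H X Y) (hX : Function.Injective X) (hnc : ∃ a b c, od X Y a b c ≠ 0) :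
    ∃ a b, Out H X Y a b := by
  obtain ⟨a, b, c, habc⟩ := hnc
  obtain ⟨r, -, hr⟩ := Set.exists_max_image (Set.univ : Set V) X (Set.toFinite _) ⟨a, trivial⟩
  have hr' : ∀ v, v ≠ r → X v < X r := fun v hv =>
    lt_of_le_of_ne (hr v trivial) (fun e => hv (hX e))
  obtain ⟨q, hq⟩ : ∃ q, q ≠ r := by
    by_contra hn
    push Not at hn
    rw [hn a, hn b, hn c, od_self2] at habc
    exact habc rfl
  obtain ⟨p, hp, -⟩ := h.half r (-1) 0 q (by have := hr' q hq; linarith)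
  obtain ⟨m, hm, hmax⟩ := Set.exists_max_image {u | H.Adj r u} (fun u => (Y u - Y r) / (X u - X r))
    (Set.toFinite _) ⟨p, hp⟩
  refine ⟨r, m, ?_⟩
  rcases h.face_or hm with ⟨u, hu⟩ | ho
  · exfalso
    have h1 := hmax u hu.adj13
    have h2 := hu.2.2.2.1
    have d1 : X m - X r < 0 := by have := hr' m (SimpleGraph.Adj.ne' hm); linarith
    have d2 : X u - X r < 0 := by have := hr' u hu.adj13.ne'; linarith
    have e1 : (Y m - Y r) / (X m - X r) * (X m - X r) = Y m - Y r := div_mul_cancel₀ _ d1.ne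
    have e2 : (Y u - Y r) / (X u - X r) * (X u - X r) = Y u - Y r := div_mul_cancel₀ _ d2.ne
    simp only [od] at h2
    rw [← e1, ← e2] at h2
    have d12 := mul_pos_of_neg_of_neg d1 d2
    nlinarith [mul_nonneg d12.le (sub_nonneg.2 h1)]
  · exact ho

end

end

section
set_option linter.unusedSectionVars false
set_option linter.unusedVariables false

section
variable {V : Type*} {H : SimpleGraph V} {X Y : V → ℝ}

def OF (H : SimpleGraph V) (X Y : V → ℝ) : Option V → Option V → Option V → Prop
  | some a, some b, some c => Face H X Y a b c
  | some a, some b, none => Out H X Y a b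
  | some a, none, some b => Out H X Y b a
  | none, some a, some b => Out H X Y a b
  | _, _, _ => False

theorem OF_adj [Finite V] (h : PG H X Y) (a b : V) : (∃ c, OF H X Y (some a) (some b) c) ↔ H.Adj a b := by
  constructor
  · rintro ⟨_ | c, hc⟩
    · exact And.left (show Out H X Y a b from hc)
    · exact And.left (show Face H X Y a b c from hc)
  · intro hab
    rcases h.face_or hab with ⟨u, hu⟩ | ho
    · exact ⟨some u, hu⟩
    · exact ⟨none, ho⟩

theorem OF_rot {a b c : Option V} (hh : OF H X Y a b c) : OF H X Y b c a := by
  rcases a with _ | a <;> rcases b with _ | b <;> rcases c with _ | c <;>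
    first | exact hh.elim | exact hh | exact Face.rot hh

theorem OF_ne {a b c : Option V} (hh : OF H X Y a b c) : a ≠ b := by
  rcases a with _ | a <;> rcases b with _ | b <;> rcases c with _ | c <;>
    first | exact hh.elim | simp
  · exact (And.left (show Out H X Y a b from hh)).ne
  · exact (And.left (show Face H X Y a b c from hh)).ne

theorem Face.not_out {a b c : V} (h1 : Face H X Y a b c) (h2 : Out H X Y a b) : False := by
  have := h1.2.2.2.1
  have := h2.2 c
  linarith

theorem OF_uniq (h : PG H X Y) (hX : Function.Injective X) (hnc : ∃ a b c, od X Y a b c ≠ 0)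
    {a b c d : Option V} (h1 : OF H X Y a b c) (h2 : OF H X Y a b d) : c = d := by
  rcases a with _ | a <;> rcases b with _ | b <;> rcases c with _ | c <;> rcases d with _ | d <;>
    first
    | rfl
    | exact h1.elim
    | exact h2.elim
    | exact congrArg some (Out.uniq h hX hnc h1 h2)
    | exact congrArg some (Out.uniq' h hX hnc h1 h2)
    | exact congrArg some (Face.uniq h h1 h2)
    | exact (Face.not_out h1 h2).elim
    | exact (Face.not_out h2 h1).elim

theorem OF_opp [Finite V] (h : PG H X Y) {a b c : Option V} (hh : OF H X Y a b c) :
    ∃ d, OF H X Y b a d := by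
  rcases a with _ | a <;> rcases b with _ | b
  · rcases c with _ | c <;> exact hh.elim
  · rcases c with _ | c
    · exact hh.elim
    · obtain ⟨d, hd⟩ := h.out_pred hh
      exact ⟨some d, hd⟩
  · rcases c with _ | c
    · exact hh.elim
    · obtain ⟨d, hd⟩ := h.out_succ hh
      exact ⟨some d, hd⟩
  · exact (OF_adj h b a).2 ((OF_adj h a b).1 ⟨c, hh⟩).symm

theorem OF_link [Finite V] (h : PG H X Y) (hX : Function.Injective X) (hnc : ∃ a b c, od X Y a b c ≠ 0)
    (z : Option V) (U : Set (Option V)) (hU : ∀ w u, OF H X Y z w u → (w ∈ U ↔ u ∈ U))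
    (w w' : Option V) (hw : w ∈ U) (h1 : ∃ c, OF H X Y z w c) (h2 : ∃ c, OF H X Y z w' c) : w' ∈ U := by
  rcases z with _ | z
  · obtain ⟨c, hc⟩ := h1
    obtain ⟨c', hc'⟩ := h2
    rcases w with _ | w <;> rcases c with _ | c <;> first | exact hc.elim | skip
    rcases w' with _ | w' <;> rcases c' with _ | c' <;> first | exact hc'.elim | skip
    exact h.link_inf hX hnc {v | some v ∈ U} (fun w u ho => hU (some w) (some u) ho) w w' hw ⟨c, hc⟩ ⟨c', hc'⟩
  · have key : ∀ w, (∃ c, OF H X Y (some z) w c) → ∃ w1, H.Adj z w1 ∧ (w ∈ U ↔ some w1 ∈ U) := by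
      rintro (_ | w) ⟨c, hc⟩
      · rcases c with _ | c
        · exact hc.elim
        · exact ⟨c, (And.left (show Out H X Y c z from hc)).symm, hU _ _ hc⟩
      · exact ⟨w, (OF_adj h z w).1 ⟨c, hc⟩, Iff.rfl⟩
    obtain ⟨a, ha, ha'⟩ := key w h1
    obtain ⟨b, hb, hb'⟩ := key w' h2
    rw [hb']
    exact h.link_real hX hnc z {v | some v ∈ U} (fun w u hf => hU (some w) (some u) hf) a b (ha'.1 hw) ha hb

noncomputable def ork (X : V → ℝ) : Option V → ℕ
  | some z => ({u | X u < X z} : Set V).ncard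
  | none => Nat.card V

theorem ork_lt [Finite V] (a b : V) : ork X (some a) < ork X (some b) ↔ X a < X b := by
  constructor
  · intro hh
    by_contra hn
    push Not at hn
    have : ({u | X u < X b} : Set V).ncard ≤ ({u | X u < X a} : Set V).ncard :=
      Set.ncard_le_ncard (fun u hu => lt_of_lt_of_le hu hn) (Set.toFinite _)
    simp only [ork] at hh
    omega
  · intro hh
    exact Set.ncard_lt_ncard ⟨fun u hu => lt_trans hu hh, fun hs => lt_irrefl (X a) (hs hh)⟩ (Set.toFinite _)

theorem ork_none [Finite V] (a : V) : ork X (some a) < ork X none := by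
  have : ({u | X u < X a} : Set V).ncard < (Set.univ : Set V).ncard :=
    Set.ncard_lt_ncard ⟨fun u _ => trivial, fun hs => lt_irrefl (X a) (hs (Set.mem_univ a))⟩ (Set.toFinite _)
  rwa [Set.ncard_univ] at this

theorem ork_inj [Finite V] (hX : Function.Injective X) : Function.Injective (ork X) := by
  rintro (_ | a) (_ | b) e
  · rfl
  · exact absurd e (ork_none b).ne'
  · exact absurd e (ork_none a).ne
  · rcases lt_trichotomy (X a) (X b) with g | g | g
    · exact absurd e ((ork_lt a b).2 g).ne
    · rw [hX g]
    · exact absurd e ((ork_lt b a).2 g).ne'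

theorem OF_low [Finite V] (h : PG H X Y) (hX : Function.Injective X) (hnc : ∃ a b c, od X Y a b c ≠ 0)
    (r w w' : Option V) (h1 : ∃ c, OF H X Y r w c) (h2 : ∃ c, OF H X Y r w' c)
    (hw : ork X w < ork X r) (hw' : ork X w' < ork X r) : Relation.ReflTransGen
      (fun u u' => ork X u < ork X r ∧ ork X u' < ork X r ∧ (OF H X Y r u u' ∨ OF H X Y r u' u)) w w' := by
  rcases r with _ | r
  · refine OF_link h hX hnc none {u | Relation.ReflTransGen
      (fun u u' => ork X u < ork X none ∧ ork X u' < ork X none ∧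
        (OF H X Y none u u' ∨ OF H X Y none u' u)) w u} ?_ w w' .refl h1 h2
    intro u u' hu
    rcases u with _ | u <;> rcases u' with _ | u' <;> first | exact hu.elim | skip
    exact ⟨fun g => g.tail ⟨ork_none _, ork_none _, .inl hu⟩, fun g => g.tail ⟨ork_none _, ork_none _, .inr hu⟩⟩
  · rcases w with _ | w
    · exact absurd hw (ork_none r).le.not_gt
    rcases w' with _ | w'
    · exact absurd hw' (ork_none r).le.not_gt
    rw [ork_lt] at hw hw'
    rw [OF_adj h] at h1 h2
    have key : ∀ w w', H.Adj r w → H.Adj r w' → X w < X r → X w' < X r → 0 < od X Y r w w' →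
        Relation.ReflTransGen (fun k k' => Face H X Y r k k' ∧ X k < X r ∧ X k' < X r) w w' := by
      intro w w' h1 h2 hw hw' ho
      refine h.chain r w' h2 (fun k => X k < X r) _ w le_rfl h1 ho hw ?_
      intro k hk g1 g2
      have e := (cramer (X := X) (Y := Y) r w w' k).1
      show X k < X r
      by_contra hn
      push Not at hn
      nlinarith [mul_nonneg ho.le (sub_nonneg.2 hn), mul_nonneg g2 (sub_pos.2 hw).le,
        mul_pos g1 (sub_pos.2 hw')]
    rcases lt_trichotomy (od X Y r w w') 0 with g | g | g
    · have := key w' w h2 h1 hw' hw (by rw [od_swap']; linarith)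
      have := Relation.reflTransGen_swap.2 this
      refine Relation.ReflTransGen.lift some ?_ _ _ this
      rintro a b ⟨hf, ha, hb⟩
      exact ⟨(ork_lt _ _).2 hb, (ork_lt _ _).2 ha, .inr hf⟩
    · have d1 : X w - X r ≠ 0 := by linarith
      have : w = w' := by
        refine h.ray0 h1 h2 ((X w' - X r) / (X w - X r)) (div_pos_of_neg_of_neg (by linarith) (by linarith)) ?_ ?_
        · field_simp
        · simp only [od] at g
          field_simp
          linarith
      rw [this]
    · have := key w w' h1 h2 hw hw' g
      refine Relation.ReflTransGen.lift some ?_ _ _ this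
      rintro a b ⟨hf, ha, hb⟩
      exact ⟨(ork_lt _ _).2 ha, (ork_lt _ _).2 hb, .inl hf⟩

theorem OF_lower [Finite V] (h : PG H X Y) (hX : Function.Injective X) (hnc : ∃ a b c, od X Y a b c ≠ 0)
    (z : Option V) : (∀ u, ork X z ≤ ork X u) ∨ ∃ u c, OF H X Y z u c ∧ ork X u < ork X z := by
  rcases z with _ | z
  · obtain ⟨a, b, hab⟩ := h.ex_out hX hnc
    exact .inr ⟨some a, some b, hab, ork_none _⟩
  · by_cases hz : ∃ p, X p < X z
    · obtain ⟨p, hp⟩ := hz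
      obtain ⟨q, hq, hq'⟩ := h.half z (-1) 0 p (by linarith)
      obtain ⟨c, hc⟩ := (OF_adj h z q).2 hq
      exact .inr ⟨some q, c, hc, (ork_lt _ _).2 (by linarith)⟩
    · push Not at hz
      left
      rintro (_ | u)
      · exact (ork_none z).le
      · by_contra hn
        push Not at hn
        rw [ork_lt] at hn
        exact absurd hn (hz u).not_gt

noncomputable def PG.tri [Finite V] (h : PG H X Y) (hX : Function.Injective X)
    (hnc : ∃ a b c, od X Y a b c ≠ 0) : Tri (Option V) where
  F := OF H X Y
  rot := OF_rot
  ne := OF_ne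
  uniq := OF_uniq h hX hnc
  opp := OF_opp h
  link := OF_link h hX hnc
  rank := ork X
  rank_inj := ork_inj hX
  low_conn := OF_low h hX hnc
  lower := OF_lower h hX hnc

theorem PG.tri_adj [Finite V] (h : PG H X Y) (hX : Function.Injective X)
    (hnc : ∃ a b c, od X Y a b c ≠ 0) (a b : V) : (h.tri hX hnc).Adj (some a) (some b) ↔ H.Adj a b :=
  OF_adj h a b

end

end

section
set_option linter.unusedSectionVars false
set_option linter.unusedVariables false

section
variable {V : Type*} {H : SimpleGraph V} {X Y : V → ℝ}

structure PL (H : SimpleGraph V) (X Y : V → ℝ) : Prop where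
  inj : ∀ u w, X u = X w → Y u = Y w → u = w
  vert : ∀ u v w, H.Adj u v → ¬ OnS X Y u v w
  cross : ∀ a b c d, H.Adj a b → H.Adj c d → ¬ Crs X Y a b c d

theorem PL.mono {H' : SimpleGraph V} (h : PL H X Y) (hl : H' ≤ H) : PL H' X Y :=
  ⟨h.inj, fun u v w hh => h.vert u v w (hl hh), fun a b c d h1 h2 => h.cross a b c d (hl h1) (hl h2)⟩

theorem PL.aff (a b c d e f : ℝ) (h : PL H X Y) (hD : a * e - b * d ≠ 0) :
    PL H (fun v => a * X v + b * Y v + c) (fun v => d * X v + e * Y v + f) := by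
  obtain ⟨h1, h2, h3⟩ := h
  refine ⟨?_, ?_, ?_⟩
  · intro u w e1 e2
    have := aff_inj a b d e hD (x := X u) (y := Y u) (x' := X w) (y' := Y w) (by linarith) (by linarith)
    exact h1 u w this.1 this.2
  · intro u v w
    rw [OnS_aff a b c d e f hD]
    exact h2 u v w
  · intro u v w z
    rw [Crs_aff a b c d e f hD]
    exact h3 u v w z

theorem PL.toPG [Finite V] (h : PL H X Y) : ∃ H', H ≤ H' ∧ PG H' X Y := by
  obtain ⟨M, hM, hmax⟩ := Set.Finite.exists_le_maximal (Set.toFinite {K : SimpleGraph V | PL K X Y}) h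
  refine ⟨M, hM, ?_⟩
  have hP : PL M X Y := hmax.1
  refine ⟨hP.inj, hP.vert, hP.cross, ?_⟩
  intro z p hzp hv hc
  have hK : PL (M ⊔ SimpleGraph.edge z p) X Y := by
    refine ⟨hP.inj, ?_, ?_⟩
    · rintro u v w (huv | huv) ⟨t, t0, t1, t2, t3⟩
      · exact hP.vert u v w huv ⟨t, t0, t1, t2, t3⟩
      · rw [SimpleGraph.edge_adj] at huv
        rcases huv.1 with ⟨rfl, rfl⟩ | ⟨rfl, rfl⟩
        · exact hv w ⟨t, t0, t1, t2, t3⟩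
        · exact hv w ⟨1 - t, by linarith, by linarith, by linarith, by linarith⟩
    · have hzz : ¬ Crs X Y z p z p := by
        rintro ⟨h1, -⟩
        rw [od_self1, zero_mul] at h1
        exact lt_irrefl _ h1
      have key : ∀ a b, (M ⊔ SimpleGraph.edge z p).Adj a b → ¬ Crs X Y z p a b := by
        rintro a b (hab | hab)
        · exact hc a b hab
        · rw [SimpleGraph.edge_adj] at hab
          rcases hab.1 with ⟨rfl, rfl⟩ | ⟨rfl, rfl⟩
          · exact hzz
          · exact fun g => hzz g.swap
      rintro a b c d (hab | hab) hcd g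
      · rcases hcd with hcd | hcd
        · exact hP.cross a b c d hab hcd g
        · rw [SimpleGraph.edge_adj] at hcd
          rcases hcd.1 with ⟨rfl, rfl⟩ | ⟨rfl, rfl⟩
          · exact hc _ _ hab g.symm
          · exact hc _ _ hab g.swap.symm
      · rw [SimpleGraph.edge_adj] at hab
        rcases hab.1 with ⟨rfl, rfl⟩ | ⟨rfl, rfl⟩
        · exact key _ _ hcd g
        · exact key _ _ hcd g.swap'
  have := hmax.2 hK le_sup_left
  exact this (Or.inr (by rw [SimpleGraph.edge_adj]; exact ⟨.inl ⟨rfl, rfl⟩, hzp⟩))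

theorem mem_seg {u v p : ℝ × ℝ} : p ∈ segment ℝ u v ↔ ∃ t : ℝ, 0 ≤ t ∧ t ≤ 1 ∧
    p.1 = u.1 + t * (v.1 - u.1) ∧ p.2 = u.2 + t * (v.2 - u.2) := by
  rw [segment_eq_image']
  constructor
  · rintro ⟨t, ⟨t0, t1⟩, rfl⟩
    exact ⟨t, t0, t1, by simp, by simp⟩
  · rintro ⟨t, t0, t1, e1, e2⟩
    exact ⟨t, ⟨t0, t1⟩, Prod.ext (by simp [e1]) (by simp [e2])⟩

theorem IsPlaneDrawing.toPL {δ : V → ℝ × ℝ} (h : IsPlaneDrawing H δ) :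
    PL H (fun v => (δ v).1) (fun v => (δ v).2) := by
  obtain ⟨h1, h2, h3⟩ := h
  refine ⟨fun u w e1 e2 => h1 (Prod.ext e1 e2), ?_, ?_⟩
  · rintro u v w huv ⟨t, t0, t1, e1, e2⟩
    simp only at e1 e2
    apply huv.ne
    apply h1
    rcases h2 u v w huv (mem_seg.2 ⟨t, t0.le, t1.le, e1, e2⟩) with rfl | rfl
    · refine Prod.ext ?_ ?_
      · have : t * ((δ v).1 - (δ w).1) = 0 := by linarith
        rcases mul_eq_zero.1 this with g | g <;> linarith
      · have : t * ((δ v).2 - (δ w).2) = 0 := by linarith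
        rcases mul_eq_zero.1 this with g | g <;> linarith
    · refine Prod.ext ?_ ?_
      · have : (1 - t) * ((δ w).1 - (δ u).1) = 0 := by linarith
        rcases mul_eq_zero.1 this with g | g <;> linarith
      · have : (1 - t) * ((δ w).2 - (δ u).2) = 0 := by linarith
        rcases mul_eq_zero.1 this with g | g <;> linarith
  · intro a b c d hab hcd hX
    obtain ⟨l, k, l0, l1, k0, k1, e1, e2⟩ := hX.point
    have n1 : c ≠ a ∧ c ≠ b ∧ d ≠ a ∧ d ≠ b := by
      obtain ⟨g, -⟩ := hX
      refine ⟨?_, ?_, ?_, ?_⟩ <;> (rintro rfl; simp [od_self1, od_self2] at g)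
    obtain ⟨w, g1, g2, -⟩ := h3 a b c d hab hcd (by
      intro e
      have : c ∈ ({a, b} : Set V) := by rw [e]; simp
      rcases this with g | g
      · exact n1.1 g
      · exact n1.2.1 g) ((δ a).1 + l * ((δ b).1 - (δ a).1), (δ a).2 + l * ((δ b).2 - (δ a).2))
      (mem_seg.2 ⟨l, l0.le, l1.le, rfl, rfl⟩)
      (mem_seg.2 ⟨1 - k, by linarith, by linarith, by simp only; linarith, by simp only; linarith⟩)
    rcases g1 with rfl | rfl <;> rcases g2 with rfl | rfl <;> simp at n1

/-- collinear overlap is impossible -/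
theorem PL.col (h : PL H X Y) {u v a b : V} (huv : H.Adj u v) (hab : H.Adj a b)
    (hne : ({u, v} : Set V) ≠ {a, b}) {s t α β : ℝ} (s0 : 0 < s) (s1 : s < 1) (t0 : 0 < t) (t1 : t < 1)
    (a1 : X a = X u + α * (X v - X u)) (a2 : Y a = Y u + α * (Y v - Y u))
    (b1 : X b = X u + β * (X v - X u)) (b2 : Y b = Y u + β * (Y v - Y u))
    (hs : s = (1 - t) * α + t * β) (hl : α ≤ β) : False := by
  have hα : ¬ (0 < α ∧ α < 1) := fun g => h.vert u v a huv ⟨α, g.1, g.2, a1, a2⟩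
  have hβ : ¬ (0 < β ∧ β < 1) := fun g => h.vert u v b huv ⟨β, g.1, g.2, b1, b2⟩
  have α0 : α ≤ 0 := by
    by_contra hn
    push Not at hn
    have : 1 ≤ α := by by_contra g; exact hα ⟨hn, by linarith⟩
    nlinarith
  have β1 : 1 ≤ β := by
    by_contra hn
    push Not at hn
    have : β ≤ 0 := by by_contra g; exact hβ ⟨by linarith, hn⟩
    nlinarith
  have d0 : 0 < β - α := by linarith
  rcases α0.lt_or_eq with g | rfl
  · refine h.vert a b u hab ⟨-α / (β - α), by apply div_pos <;> linarith, ?_, ?_, ?_⟩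
    · rw [div_lt_one d0]; linarith
    · rw [a1, b1]; field_simp; ring
    · rw [a2, b2]; field_simp; ring
  · have ha : a = u := h.inj _ _ (by linarith) (by linarith)
    rcases β1.lt_or_eq with g | rfl
    · refine h.vert a b v hab ⟨1 / β, by positivity, ?_, ?_, ?_⟩
      · rw [div_lt_one (by linarith)]; linarith
      · rw [a1, b1]; field_simp; ring
      · rw [a2, b2]; field_simp; ring
    · have hb : b = v := h.inj _ _ (by linarith) (by linarith)
      subst ha hb
      exact hne rfl

theorem od_zero_param {u v a : V} (hinj : ∀ u w, X u = X w → Y u = Y w → u = w) (huv : u ≠ v)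
    (h : od X Y u v a = 0) : ∃ α : ℝ, X a = X u + α * (X v - X u) ∧ Y a = Y u + α * (Y v - Y u) := by
  simp only [od] at h
  by_cases h1 : X v - X u = 0
  · have h2 : Y v - Y u ≠ 0 := fun h2 => huv (hinj _ _ (by linarith) (by linarith))
    rw [h1] at h
    have : X a - X u = 0 := by
      have : (Y v - Y u) * (X a - X u) = 0 := by linarith
      exact (mul_eq_zero.1 this).resolve_left h2
    exact ⟨(Y a - Y u) / (Y v - Y u), by rw [h1]; linarith, by field_simp; ring⟩
  · refine ⟨(X a - X u) / (X v - X u), by field_simp; ring, ?_⟩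
    field_simp
    linarith

theorem PL.col' (h : PL H X Y) {u v a b : V} (huv : H.Adj u v) (hab : H.Adj a b)
    (hne : ({u, v} : Set V) ≠ {a, b}) {s t : ℝ} (s0 : 0 < s) (s1 : s < 1) (t0 : 0 < t) (t1 : t < 1)
    (e1 : X u + s * (X v - X u) = X a + t * (X b - X a)) (e2 : Y u + s * (Y v - Y u) = Y a + t * (Y b - Y a))
    (ha : od X Y u v a = 0) (hb : od X Y u v b = 0) : False := by
  obtain ⟨α, a1, a2⟩ := od_zero_param h.inj huv.ne ha
  obtain ⟨β, b1, b2⟩ := od_zero_param h.inj huv.ne hb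
  have hs : s = (1 - t) * α + t * β := by
    rw [a1, b1] at e1
    rw [a2, b2] at e2
    have g1 : (s - ((1 - t) * α + t * β)) * (X v - X u) = 0 := by linear_combination e1
    have g2 : (s - ((1 - t) * α + t * β)) * (Y v - Y u) = 0 := by linear_combination e2
    by_contra hn
    have hn' : s - ((1 - t) * α + t * β) ≠ 0 := fun g => hn (by linarith)
    have := (mul_eq_zero.1 g1).resolve_left hn'
    have := (mul_eq_zero.1 g2).resolve_left hn'
    exact huv.ne (h.inj _ _ (by linarith) (by linarith))
  rcases le_total α β with g | g
  · exact h.col huv hab hne s0 s1 t0 t1 a1 a2 b1 b2 hs g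
  · exact h.col huv hab.symm (by rwa [Set.pair_comm b a]) (t := 1 - t) s0 s1 (by linarith) (by linarith)
      b1 b2 a1 a2 (by linarith) g

theorem PL.vert' (h : PL H X Y) {u v w : V} (huv : H.Adj u v)
    (hw : (X w, Y w) ∈ segment ℝ (X u, Y u) (X v, Y v)) : w = u ∨ w = v := by
  obtain ⟨t, t0, t1, e1, e2⟩ := mem_seg.1 hw
  simp only at e1 e2
  rcases t0.lt_or_eq with t0 | rfl
  · rcases t1.lt_or_eq with t1 | rfl
    · exact (h.vert u v w huv ⟨t, t0, t1, e1, e2⟩).elim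
    · exact .inr (h.inj _ _ (by linarith) (by linarith))
  · exact .inl (h.inj _ _ (by linarith) (by linarith))

theorem PL.toPlane (h : PL H X Y) : IsPlaneDrawing H (fun v => (X v, Y v)) := by
  refine ⟨fun u v e => ?_, fun u v w huv hw => h.vert' huv hw, ?_⟩
  · simp only [Prod.mk.injEq] at e
    exact h.inj _ _ e.1 e.2
  intro u v a b huv hab hne p hp hp'
  obtain ⟨s, s0, s1, e1, e2⟩ := mem_seg.1 hp
  obtain ⟨t, t0, t1, f1, f2⟩ := mem_seg.1 hp'
  simp only at e1 e2 f1 f2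
  rcases s0.lt_or_eq with s0 | rfl
  swap
  · have : p = (X u, Y u) := Prod.ext (by simp [e1]) (by simp [e2])
    subst this
    exact ⟨u, .inl rfl, h.vert' hab hp', rfl⟩
  rcases s1.lt_or_eq with s1 | rfl
  swap
  · have : p = (X v, Y v) := Prod.ext (by simp [e1]) (by simp [e2])
    subst this
    exact ⟨v, .inr rfl, h.vert' hab hp', rfl⟩
  rcases t0.lt_or_eq with t0 | rfl
  swap
  · have : p = (X a, Y a) := Prod.ext (by simp [f1]) (by simp [f2])
    subst this
    exact ⟨a, h.vert' huv hp, .inl rfl, rfl⟩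
  rcases t1.lt_or_eq with t1 | rfl
  swap
  · have : p = (X b, Y b) := Prod.ext (by simp [f1]) (by simp [f2])
    subst this
    exact ⟨b, h.vert' huv hp, .inr rfl, rfl⟩
  exfalso
  have g1 : X u + s * (X v - X u) = X a + t * (X b - X a) := by linarith
  have g2 : Y u + s * (Y v - Y u) = Y a + t * (Y b - Y a) := by linarith
  have k1 : (1 - t) * od X Y u v a + t * od X Y u v b = 0 := by
    simp only [od]; linear_combination (Y v - Y u) * g1 - (X v - X u) * g2
  have k2 : (1 - s) * od X Y a b u + s * od X Y a b v = 0 := by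
    simp only [od]; linear_combination (X b - X a) * g2 - (Y b - Y a) * g1
  have aux : ∀ r A B : ℝ, 0 < r → r < 1 → (1 - r) * A + r * B = 0 → A ≠ 0 → A * B < 0 := by
    intro r A B r0 r1 hh hA
    have : r * (A * B) = - ((1 - r) * (A * A)) := by linear_combination A * hh
    have := mul_pos (sub_pos.2 r1) (mul_self_pos.2 hA)
    by_contra hn
    push Not at hn
    nlinarith [mul_nonneg r0.le hn]
  have aux0 : ∀ r A B : ℝ, 0 < r → (1 - r) * A + r * B = 0 → A = 0 → B = 0 := by
    intro r A B r0 hh hA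
    rw [hA, mul_zero, zero_add] at hh
    exact (mul_eq_zero.1 hh).resolve_left r0.ne'
  by_cases c1 : od X Y u v a = 0
  · exact h.col' huv hab hne s0 s1 t0 t1 g1 g2 c1 (aux0 _ _ _ t0 k1 c1)
  by_cases c2 : od X Y a b u = 0
  · exact h.col' hab huv hne.symm t0 t1 s0 s1 g1.symm g2.symm c2 (aux0 _ _ _ s0 k2 c2)
  exact h.cross u v a b huv hab ⟨aux t _ _ t0 t1 k1 c1, aux s _ _ s0 s1 k2 c2⟩

end

end

section
set_option linter.unusedSectionVars false
set_option linter.unusedVariables false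

section
variable {W : Type*}

theorem es_lab (R : W → W → Prop) (S : List W) (hS : S.Nodup) : ∃ g : W → ℕ,
    (∀ x ∈ S, ∃ T, (x :: T).Sublist S ∧ (x :: T).IsChain R ∧ (x :: T).length = g x) ∧
    S.Pairwise (fun x y => R x y → g y < g x) := by
  classical
  induction S with
  | nil => exact ⟨fun _ => 0, by simp, by simp⟩
  | cons a S ih =>
    rw [List.nodup_cons] at hS
    obtain ⟨g, h1, h2⟩ := ih hS.2
    have hbest : ∃ T, (a :: T).Sublist (a :: S) ∧ (a :: T).IsChain R ∧ ∀ y ∈ S, R a y → g y < (a :: T).length := by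
      by_cases hne : ∃ y ∈ S, R a y
      · obtain ⟨y0, hy0, hr0⟩ := hne
        obtain ⟨m, hm, hmax⟩ := Finset.exists_max_image (S.toFinset.filter (fun y => R a y)) g
          ⟨y0, by simp [hy0, hr0]⟩
        simp only [Finset.mem_filter, List.mem_toFinset] at hm hmax
        obtain ⟨T, t1, t2, t3⟩ := h1 m hm.1
        refine ⟨m :: T, t1.cons_cons a, ?_, ?_⟩
        · rw [List.isChain_cons_cons]
          exact ⟨hm.2, t2⟩
        · intro y hy hr
          have := hmax y ⟨hy, hr⟩
          rw [List.length_cons, t3]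
          omega
      · push Not at hne
        exact ⟨[], by simp, by simp, fun y hy hr => (hne y hy hr).elim⟩
    obtain ⟨T, t1, t2, t3⟩ := hbest
    have hga : ∀ y ∈ S, Function.update g a (a :: T).length y = g y := fun y hy =>
      by
      rw [Function.update_of_ne]
      rintro rfl
      exact hS.1 hy
    refine ⟨Function.update g a (a :: T).length, ?_, ?_⟩
    · intro x hx
      rcases List.mem_cons.1 hx with rfl | hx
      · exact ⟨T, t1, t2, by simp⟩
      · obtain ⟨T', q1, q2, q3⟩ := h1 x hx
        exact ⟨T', q1.cons a, q2, by rw [q3, hga x hx]⟩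
    · rw [List.pairwise_cons]
      refine ⟨fun y hy hr => ?_, ?_⟩
      · rw [hga y hy, Function.update_self]
        exact t3 y hy hr
      · refine List.Pairwise.imp_of_mem ?_ h2
        intro x y hx hy hh
        rw [hga x hx, hga y hy]
        exact hh

theorem erdos_szekeres' (S : List W) (hS : S.Nodup) (ξ : W → ℝ) (hξ : ∀ u ∈ S, ∀ w ∈ S, ξ u = ξ w → u = w) :
    ∃ T : List W, T.Sublist S ∧ S.length ≤ T.length ^ 2 ∧
      (T.Pairwise (fun u w => ξ u < ξ w) ∨ T.Pairwise (fun u w => ξ w < ξ u)) := by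
  classical
  by_contra hcon
  push Not at hcon
  obtain ⟨g, g1, g2⟩ := es_lab (fun u w => ξ u < ξ w) S hS
  obtain ⟨k, k1, k2⟩ := es_lab (fun u w => ξ w < ξ u) S hS
  have : IsTrans W (fun u w => ξ u < ξ w) := ⟨fun _ _ _ a b => lt_trans a b⟩
  have : IsTrans W (fun u w => ξ w < ξ u) := ⟨fun _ _ _ a b => lt_trans b a⟩
  have bound : ∀ T : List W, T.Sublist S → (T.IsChain (fun u w => ξ u < ξ w) ∨ T.IsChain (fun u w => ξ w < ξ u)) →
      T.length ≤ Nat.sqrt (S.length - 1) := by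
    intro T hT hc
    rw [Nat.le_sqrt']
    by_contra hn
    have h0 : S.length ≤ T.length ^ 2 := by omega
    have := hcon T hT h0
    rcases hc with hc | hc
    · exact this.1 (List.isChain_iff_pairwise.1 hc)
    · exact this.2 (List.isChain_iff_pairwise.1 hc)
  have hb : ∀ x ∈ S, (g x, k x) ∈ Finset.Icc 1 (Nat.sqrt (S.length - 1)) ×ˢ Finset.Icc 1 (Nat.sqrt (S.length - 1)) := by
    intro x hx
    obtain ⟨T, a1, a2, a3⟩ := g1 x hx
    obtain ⟨T', b1, b2, b3⟩ := k1 x hx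
    have := bound _ a1 (.inl a2)
    have := bound _ b1 (.inr b2)
    simp only [List.length_cons] at *
    simp only [Finset.mem_product, Finset.mem_Icc]
    omega
  have hinj : (S.map (fun x => (g x, k x))).Nodup := by
    rw [List.Nodup, List.pairwise_map]
    refine List.Pairwise.imp_of_mem ?_ ((List.pairwise_and_iff.2 ⟨hS, List.pairwise_and_iff.2 ⟨g2, k2⟩⟩))
    rintro x y hx hy ⟨hne, q1, q2⟩ e
    simp only [Prod.mk.injEq] at e
    rcases lt_trichotomy (ξ x) (ξ y) with c | c | c
    · have := q1 c; omega
    · exact hne (hξ _ hx _ hy c)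
    · have := q2 c; omega
  have hcard := List.toFinset_card_of_nodup hinj
  have hsub : (S.map (fun x => (g x, k x))).toFinset ⊆
      Finset.Icc 1 (Nat.sqrt (S.length - 1)) ×ˢ Finset.Icc 1 (Nat.sqrt (S.length - 1)) := by
    intro p hp
    rw [List.mem_toFinset, List.mem_map] at hp
    obtain ⟨x, hx, rfl⟩ := hp
    exact hb x hx
  have := Finset.card_le_card hsub
  rw [hcard, List.length_map, Finset.card_product, Nat.card_Icc] at this
  have h3 := Nat.sqrt_le (S.length - 1)
  have h4 := hcon [] (by simp)
  simp only [Nat.add_sub_cancel] at this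
  have h5 : S.length ≠ 0 := fun e => by
    simp [e] at h4
  omega

/-- choice of the fixed list -/
theorem BuiltT.choose {Ad : W → W → Prop} {τ : W → ℕ} {L : List W} {U : Set W} (hB : BuiltT Ad τ L U)
    (h3 : 3 ≤ L.length) (i : W) (hi : i ∈ L → L.getLast? = some i) (D : ℕ)
    (hD : D ≤ L.length) (hD' : i ∈ L → D + 1 ≤ L.length) :
    ∃ L1 S : List W, BuiltT Ad τ L1 U ∧ (∀ u, u ∈ L1 ↔ u ∈ L) ∧ S.Sublist L1 ∧ i ∉ S ∧
      (∀ b ∈ S, L1.getLast? ≠ some b) ∧ (∀ u w, Cons L1 u w → w ∈ S → τ u < τ w) ∧ D + 1 ≤ 2 * S.length := by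
  classical
  obtain ⟨b1, b2, b3, b4, b5⟩ := hB.basic
  have hlen := updown_len τ L
  obtain ⟨a, L', rfl⟩ : ∃ a L', L = a :: L' := by
    cases L with
    | nil => simp at h3
    | cons a L' => exact ⟨a, L', rfl⟩
  have ha0 := b4 a rfl
  have hX : ∀ b ∈ a :: ups τ (a :: L'), (a :: L').getLast? ≠ some b := by
    intro b hb hl
    rcases List.mem_cons.1 hb with rfl | hb
    · cases L' with
      | nil => simp at h3
      | cons c L' => exact Cons.not_last b1 (show Cons (b :: c :: L') b c by simp) hl
    · have hbL := (ups_sub τ a L').subset hb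
      obtain ⟨u, hu⟩ := Cons.exists_pred (L := a :: L') (w := b) (List.mem_cons_of_mem _ hbL) (by
        rw [List.head?_cons, ne_eq, Option.some.injEq]
        rintro rfl
        exact (List.nodup_cons.1 b1).1 hbL)
      have := ups_spec τ _ b1 hu hb
      have := b5 b hl
      omega
  by_cases hc : D + 1 ≤ 2 * (a :: ups τ (a :: L')).length
  · refine ⟨a :: L', a :: ups τ (a :: L'), hB, fun _ => Iff.rfl, (ups_sub τ a L').cons_cons a, ?_, hX, ?_, hc⟩
    · intro hm
      have : i ∈ a :: L' := ((ups_sub τ a L').cons_cons a).subset hm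
      exact hX i hm (hi this)
    · intro u w hc hw
      rcases List.mem_cons.1 hw with rfl | hw
      · exact (Cons.not_head b1 hc rfl).elim
      · exact ups_spec τ _ b1 hc hw
  · refine ⟨(a :: L').reverse, ((downs τ (a :: L')).erase i).reverse, hB.reverse, fun u => List.mem_reverse, ?_, ?_, ?_, ?_, ?_⟩
    · rw [List.reverse_sublist]
      exact List.erase_sublist.trans (downs_sub τ _)
    · rw [List.mem_reverse]
      exact ((downs_sub τ _).nodup b1).not_mem_erase
    · intro b hb hl
      rw [List.getLast?_reverse, List.head?_cons, Option.some.injEq] at hl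
      subst hl
      rw [List.mem_reverse] at hb
      have hb := List.mem_of_mem_erase hb
      cases L' with
      | nil => simp at h3
      | cons c L' =>
        have hc : Cons (a :: c :: L') a c := by simp
        have := downs_spec τ _ b1 hc hb
        rcases b3 _ _ hc with q | q
        · omega
        · omega
    · intro u w hc hw
      rw [List.mem_reverse] at hw
      have hw := List.mem_of_mem_erase hw
      have hc := (Cons.reverse _ _ _).1 hc
      have := downs_spec τ _ b1 hc hw
      rcases b3 _ _ hc with q | q
      · omega
      · omega
    · simp only [List.length_cons, List.length_reverse] at *
      by_cases hm : i ∈ a :: L'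
      · have := hD' hm
        have : (downs τ (a :: L')).length - 1 ≤ ((downs τ (a :: L')).erase i).length := by
          rw [List.length_erase]; split_ifs <;> omega
        omega
      · have : ((downs τ (a :: L')).erase i) = downs τ (a :: L') :=
          List.erase_of_not_mem (fun h => hm ((downs_sub τ _).subset h))
        rw [this]
        omega

end

end

section
set_option linter.unusedSectionVars false
set_option linter.unusedVariables false

section
variable {V : Type*} {H : SimpleGraph V} {X Y : V → ℝ}

theorem PG.noncol3 (h : PG H X Y) (hX : Function.Injective X) (v : V)
    (hd : 3 ≤ ({u | H.Adj v u} : Set V).ncard) : ∃ a b c, od X Y a b c ≠ 0 := by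
  by_contra hn
  push Not at hn
  have key : ∀ a b, H.Adj v a → H.Adj v b → a ≠ b → ¬ 0 < (X b - X v) / (X a - X v) := by
    intro a b ha hb hab hk
    have d1 : X a - X v ≠ 0 := fun e => ha.ne (hX (by linarith))
    have g := hn v a b
    refine hab (h.ray0 ha hb ((X b - X v) / (X a - X v)) hk ?_ ?_)
    · field_simp
    · simp only [od] at g
      field_simp
      linarith
  obtain ⟨a, ha, b, hb, c, hc, hab, hac, hbc⟩ := (Set.two_lt_ncard (Set.finite_of_ncard_pos (by omega))).1 hd
  have k1 := key a b ha hb hab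
  have k2 := key a c ha hc hac
  have k3 := key b c hb hc hbc
  have da : X a - X v ≠ 0 := fun e => (SimpleGraph.Adj.ne ha) (hX (by linarith))
  have db : X b - X v ≠ 0 := fun e => (SimpleGraph.Adj.ne hb) (hX (by linarith))
  have dc : X c - X v ≠ 0 := fun e => (SimpleGraph.Adj.ne hc) (hX (by linarith))
  rcases lt_or_gt_of_ne da with da | da <;> rcases lt_or_gt_of_ne db with db | db <;>
    rcases lt_or_gt_of_ne dc with dc | dc <;>
    first
    | exact k1 (div_pos_of_neg_of_neg db da)
    | exact k2 (div_pos_of_neg_of_neg dc da)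
    | exact k3 (div_pos_of_neg_of_neg dc db)
    | exact k1 (div_pos db da)
    | exact k2 (div_pos dc da)
    | exact k3 (div_pos dc db)

theorem PInv.toPL {x y : Option V → ℝ} {L : List (Option V)} {Ad : Option V → Option V → Prop}
    (h : PInv Ad x y L Set.univ) (hAd : ∀ a b, H.Adj a b → Ad (some a) (some b)) :
    PL H (fun v => x (some v)) (fun v => y (some v)) := by
  have : IsPlaneDrawing H (fun v => (x (some v), y (some v))) := by
    refine ⟨?_, ?_, ?_⟩
    · intro u w e
      simp only [Prod.mk.injEq] at e
      exact Option.some_injective _ (h.inj _ trivial _ trivial e.1 e.2)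
    · intro u v w huv hw
      rcases h.vert _ trivial _ trivial (some w) trivial (hAd _ _ huv) hw with g | g
      · exact .inl (Option.some_injective _ g)
      · exact .inr (Option.some_injective _ g)
    · intro u v a b huv hab hne p hp hp'
      obtain ⟨w, w1, w2, w3⟩ := h.edge _ trivial _ trivial _ trivial _ trivial (hAd _ _ huv) (hAd _ _ hab) (by
        intro e
        apply hne
        have := congrArg (fun S => some ⁻¹' S) e
        ext q
        have := congrArg (fun S : Set (Option V) => some q ∈ S) e
        simpa using this) p hp hp'
      rcases w1 with rfl | rfl
      · refine ⟨u, .inl rfl, ?_, w3⟩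
        simpa using w2
      · refine ⟨v, .inr rfl, ?_, w3⟩
        simpa using w2
  exact this.toPL

theorem PG.main [Fintype V] (h : PG H X Y) (hX : Function.Injective X) (v : V) (D : ℕ) (h3 : 3 ≤ D)
    (hd : D ≤ ({u | H.Adj v u} : Set V).ncard) (ξ η : V → ℝ) (hξ : Function.Injective ξ) :
    ∃ x y : V → ℝ, PL H x y ∧ Real.sqrt (((D : ℝ) + 1) / 2) ≤ (({u | x u = ξ u ∧ y u = η u} : Set V).ncard : ℝ) := by
  classical
  have hnc := h.noncol3 hX v (h3.trans hd)
  set T := h.tri hX hnc with hT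
  have hadj : ∀ a b, H.Adj a b ↔ T.Adj (some a) (some b) := fun a b => (h.tri_adj hX hnc a b).symm
  obtain ⟨b, hb, hbn⟩ : ∃ b, T.Adj (some v) b ∧ (T.Adj (some v) none → b = none) := by
    by_cases hn : T.Adj (some v) none
    · exact ⟨none, hn, fun _ => rfl⟩
    · have : ({u | H.Adj v u} : Set V).Nonempty := (Set.ncard_pos (Set.toFinite _)).1 (by omega)
      obtain ⟨u, hu⟩ := this
      exact ⟨some u, (hadj _ _).1 hu, fun g => (hn g).elim⟩
  obtain ⟨τ, L, hB, hlast, hnd, hmem⟩ := T.start (some v) b hb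
  have hcard : L.toFinset.card = L.length := List.toFinset_card_of_nodup hnd
  set N : Finset (Option V) := (Finset.univ.filter (fun u => H.Adj v u)).image some with hN
  have hNc : D ≤ N.card := by
    rw [hN, Finset.card_image_of_injective _ (Option.some_injective _)]
    rwa [Set.ncard_eq_toFinset_card', Set.toFinset_ofPred] at hd
  have hNs : N ⊆ L.toFinset := by
    intro o ho
    rw [hN, Finset.mem_image] at ho
    obtain ⟨u, hu, rfl⟩ := ho
    rw [List.mem_toFinset, hmem, ← hadj]
    simpa using hu
  have hDL : D ≤ L.length := by
    have := Finset.card_le_card hNs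
    omega
  obtain ⟨L1, S, hB1, hm1, hSL, hiS, hl1, hc1, hlen⟩ := hB.choose (h3.trans hDL) none
    (fun hi => by rw [hlast, hbn ((hmem _).1 hi)]) D hDL (fun hi => by
      have : insert none N ⊆ L.toFinset := by
        rw [Finset.insert_subset_iff]
        exact ⟨by simpa using hi, hNs⟩
      have := Finset.card_le_card this
      rw [Finset.card_insert_of_notMem (by simp [hN])] at this
      omega)
  have hnd1 := hB1.basic.1
  have hSnd := hSL.nodup hnd1
  let ξ' : Option V → ℝ := fun o => o.elim 0 ξ
  let η' : Option V → ℝ := fun o => o.elim 0 η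
  obtain ⟨S', hS', hlen', hmono⟩ := erdos_szekeres' S hSnd ξ' (by
    rintro (_ | u) hu (_ | w) hw e
    · rfl
    · exact (hiS hu).elim
    · exact (hiS hw).elim
    · rw [hξ e])
  have hS1 := hS'.trans hSL
  have hBS : BuiltS T.Adj {s | s ∈ S'} L1 {some v}ᶜ := hB1.toS _ (fun b hb => hl1 b (hS'.subset hb))
    (fun u hu _ => hS1.subset hu) (fun u w hc hw => hc1 u w hc (hS'.subset hw))
  have draw : ∀ ζ : Option V → ℝ, S'.Pairwise (fun u w => ζ u < ζ w) → ∃ x y : Option V → ℝ,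
      PL H (fun v => x (some v)) (fun v => y (some v)) ∧ ∀ s ∈ S', x s = ζ s ∧ y s = η' s := by
    intro ζ hζ
    obtain ⟨x, hx, hx'⟩ := hBS.toX hS1 ζ hζ
    obtain ⟨x', y', L', hP, hfix⟩ := hx.draw (fun u v => T.adj_symm) (fun u hu => T.adj_ne hu rfl) η'
      (fun u hu => (hm1 u).2 ((hmem u).2 hu)) (fun hv => T.adj_ne ((hmem _).1 ((hm1 _).1 (hS1.subset hv))) rfl)
    refine ⟨x', y', hP.toPL (fun a b => (hadj a b).1), fun s hs => ?_⟩
    rw [(hfix s hs).1, hx' s hs]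
    exact ⟨rfl, (hfix s hs).2⟩
  have fin : ∀ x y : V → ℝ, (∀ u, some u ∈ S' → x u = ξ u ∧ y u = η u) →
      Real.sqrt (((D : ℝ) + 1) / 2) ≤ (({u | x u = ξ u ∧ y u = η u} : Set V).ncard : ℝ) := by
    intro x y hxy
    have c1 : S'.length ≤ ({u | x u = ξ u ∧ y u = η u} : Set V).ncard := by
      rw [← List.toFinset_card_of_nodup (hS'.nodup hSnd), ← Set.ncard_coe_finset]
      refine (Set.ncard_le_ncard (t := some '' {u | x u = ξ u ∧ y u = η u}) ?_ (Set.toFinite _)).trans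
        (Set.ncard_image_le (Set.toFinite _))
      rintro (_ | u) hu
      · exact (hiS (hS'.subset (by simpa using hu))).elim
      · exact ⟨u, hxy u (by simpa using hu), rfl⟩
    have c2 : Real.sqrt (((D : ℝ) + 1) / 2) ≤ (S'.length : ℝ) := by
      rw [Real.sqrt_le_left (by positivity)]
      have : D + 1 ≤ 2 * S'.length ^ 2 := by omega
      have : (D : ℝ) + 1 ≤ 2 * (S'.length : ℝ) ^ 2 := by exact_mod_cast this
      linarith
    exact c2.trans (by exact_mod_cast c1)
  rcases hmono with hmono | hmono
  · obtain ⟨x, y, hP, hf⟩ := draw ξ' hmono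
    exact ⟨_, _, hP, fin _ _ (fun u hu => hf _ hu)⟩
  · obtain ⟨x, y, hP, hf⟩ := draw (fun o => - ξ' o) (by simpa using hmono)
    have hP' := hP.aff (-1) 0 0 0 1 0 (by norm_num)
    refine ⟨_, _, hP', fin _ _ (fun u hu => ?_)⟩
    have := hf _ hu
    have e : ξ' (some u) = ξ u := rfl
    have e' : η' (some u) = η u := rfl
    rw [e, e'] at this
    constructor
    · rw [this.1]; ring
    · rw [this.2]; ring

end

theorem exists_shear {V : Type*} [Finite V] (δ : V → ℝ × ℝ) (hδ : Function.Injective δ) :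
    ({t : ℝ | ¬ Function.Injective (fun v => (δ v).1 + t * (δ v).2)} : Set ℝ).Finite := by
  have : ({t : ℝ | ¬ Function.Injective (fun v => (δ v).1 + t * (δ v).2)} : Set ℝ) ⊆
      Set.range (fun p : V × V => - ((δ p.1).1 - (δ p.2).1) / ((δ p.1).2 - (δ p.2).2)) := by
    intro t ht
    simp only [Set.mem_ofPred_eq, Function.Injective] at ht
    push Not at ht
    obtain ⟨u, w, e, hne⟩ := ht
    refine ⟨(u, w), ?_⟩
    have d : (δ u).2 - (δ w).2 ≠ 0 := by
      intro d
      apply hne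
      apply hδ
      have d' : (δ u).2 = (δ w).2 := by linarith
      refine Prod.ext ?_ d'
      rw [d'] at e
      linarith
    simp only
    field_simp
    linarith
  exact (Set.finite_range _).subset this

theorem two_fixed {V : Type*} [Finite V] {H : SimpleGraph V} {X Y : V → ℝ} (h : PL H X Y) (ξ η : V → ℝ)
    (hξ : ∀ u w, ξ u = ξ w → η u = η w → u = w) (u w : V) (huw : u ≠ w) :
    ∃ x y : V → ℝ, PL H x y ∧ 2 ≤ ({v | x v = ξ v ∧ y v = η v} : Set V).ncard := by
  have aux : ∀ p q : ℝ, ¬ (p = 0 ∧ q = 0) → p * p + q * q ≠ 0 := by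
    intro p q hn e
    have h1 := mul_self_nonneg p
    have h2 := mul_self_nonneg q
    exact hn ⟨mul_self_eq_zero.1 (by linarith), mul_self_eq_zero.1 (by linarith)⟩
  have hN := aux (X w - X u) (Y w - Y u) (fun g => huw (h.inj _ _ (by linarith) (by linarith)))
  have hE := aux (ξ w - ξ u) (η w - η u) (fun g => huw (hξ _ _ (by linarith) (by linarith)))
  set d1 := X w - X u with hd1
  set d2 := Y w - Y u with hd2
  set e1 := ξ w - ξ u with he1
  set e2 := η w - η u with he2
  set c1 := (e1 * d1 + e2 * d2) / (d1 * d1 + d2 * d2) with hc1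
  set c2 := (e2 * d1 - e1 * d2) / (d1 * d1 + d2 * d2) with hc2
  have m1 : c1 * (d1 * d1 + d2 * d2) = e1 * d1 + e2 * d2 := div_mul_cancel₀ _ hN
  have m2 : c2 * (d1 * d1 + d2 * d2) = e2 * d1 - e1 * d2 := div_mul_cancel₀ _ hN
  have k1 : c1 * d1 - c2 * d2 = e1 := by
    apply mul_right_cancel₀ hN
    linear_combination d1 * m1 - d2 * m2
  have k2 : c2 * d1 + c1 * d2 = e2 := by
    apply mul_right_cancel₀ hN
    linear_combination d1 * m2 + d2 * m1
  have hD : c1 * c1 - (-c2) * c2 ≠ 0 := by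
    intro e
    apply hE
    have : e1 * e1 + e2 * e2 = (c1 * c1 - (-c2) * c2) * (d1 * d1 + d2 * d2) := by
      rw [← k1, ← k2]; ring
    rw [this, e, zero_mul]
  have hP := h.aff c1 (-c2) (ξ u - c1 * X u + c2 * Y u) c2 c1 (η u - c2 * X u - c1 * Y u) hD
  refine ⟨_, _, hP, ?_⟩
  rw [← Set.ncard_pair huw]
  refine Set.ncard_le_ncard ?_ (Set.toFinite _)
  rintro z (rfl | rfl)
  · exact ⟨by ring, by ring⟩
  · constructor
    · linear_combination k1
    · linear_combination k2

end

/-- Let `G` be a triangulated planar graph (planar, `n ≥ 3` vertices, `3n - 6` edges)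
with maximum degree `Δ`.  Then `fix(G) ≥ √((Δ+1)/2)`: for every straight-line drawing
`δ` of `G` there is a plane straight-line drawing `δ'` fixing at least `√((Δ+1)/2)`
vertices of `δ`. -/
theorem fix_ge_sqrt_maxDegree {V : Type*} [Fintype V] (G : SimpleGraph V)
    [DecidableRel G.Adj]
    (hplanar : ∃ δ : V → ℝ × ℝ, IsPlaneDrawing G δ)
    (hn : 3 ≤ Fintype.card V)
    (hedges : G.edgeSet.ncard = 3 * Fintype.card V - 6)
    (δ : V → ℝ × ℝ) (hδ : Function.Injective δ) :
    ∃ δ' : V → ℝ × ℝ, IsPlaneDrawing G δ' ∧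
      Real.sqrt (((G.maxDegree : ℝ) + 1) / 2) ≤ ({v : V | δ' v = δ v}.ncard : ℝ) := by
  obtain ⟨δ₀, hδ₀⟩ := hplanar
  have hP0 := hδ₀.toPL
  by_cases hΔ : G.maxDegree ≤ 2
  · obtain ⟨u, w, huw⟩ := Fintype.exists_pair_of_one_lt_card (α := V) (by omega)
    obtain ⟨x, y, hP, hc⟩ := two_fixed hP0 (fun v => (δ v).1) (fun v => (δ v).2)
      (fun u w a b => hδ (Prod.ext a b)) u w huw
    refine ⟨_, hP.toPlane, ?_⟩
    simp only [Prod.ext_iff]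
    have h2 : (2 : ℝ) ≤ (({v | x v = (δ v).1 ∧ y v = (δ v).2} : Set V).ncard : ℝ) := by exact_mod_cast hc
    refine le_trans ?_ h2
    rw [Real.sqrt_le_left (by norm_num)]
    have : (G.maxDegree : ℝ) ≤ 2 := by exact_mod_cast hΔ
    linarith
  · push Not at hΔ
    obtain ⟨t, ht⟩ := ((exists_shear δ hδ).union (exists_shear δ₀ hδ₀.1)).infinite_compl.nonempty
    simp only [Set.mem_compl_iff, Set.mem_union, Set.mem_ofPred_eq, not_or, not_not] at ht
    have hP1 := hP0.aff 1 t 0 0 1 0 (by norm_num)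
    obtain ⟨H, hGH, hPG⟩ := hP1.toPG
    have : Nonempty V := Fintype.card_pos_iff.1 (by omega)
    obtain ⟨v, hv⟩ := G.exists_maximal_degree_vertex
    have hd : G.maxDegree ≤ ({u | H.Adj v u} : Set V).ncard := by
      rw [hv, ← SimpleGraph.card_neighborFinset_eq_degree, ← Set.ncard_coe_finset]
      refine Set.ncard_le_ncard ?_ (Set.toFinite _)
      intro u hu
      exact hGH (by simpa using hu)
    obtain ⟨x, y, hP, hc⟩ := hPG.main (by simpa using ht.2) v G.maxDegree hΔ hd
      (fun v => (δ v).1 + t * (δ v).2) (fun v => (δ v).2) ht.1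
    have hP' := (hP.mono hGH).aff 1 (-t) 0 0 1 0 (by norm_num)
    refine ⟨_, hP'.toPlane, ?_⟩
    refine hc.trans ?_
    have : ({u | x u = (δ u).1 + t * (δ u).2 ∧ y u = (δ u).2} : Set V).ncard ≤
        ({v : V | (fun v => (1 * x v + -t * y v + 0, 0 * x v + 1 * y v + 0)) v = δ v} : Set V).ncard := by
      refine Set.ncard_le_ncard ?_ (Set.toFinite _)
      rintro u ⟨a1, a2⟩
      refine Prod.ext ?_ ?_
      · simp only
        rw [a1, a2]; ring
      · simp only
        rw [a2]; ring
    exact_mod_cast this
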